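/- There is an absolute constant C > 0 such that for every Dirichlet character χ modulo q, every α ∈ ℝ, and all reals z ≥ 1 and y ≥ 10, one has |∑_{1 ≤ |n| ≤ z, P⁺(|n|) ≤ y} χ(n)·(1 − e(nα))/n| ≤ 2·e^γ·log y + 2·log 2 + C·(log log y)/(log y), where the sum is over all nonzero integers n with |n| ≤ z whose absolute value has all prime factors at most y. -/

import Mathlib

open Real Complex MeasureTheory
open scoped BigOperators

attribute [local instance] Classical.propDecidable

/-- `e(x) = exp(2πix)` -/
noncomputable def e2pi (x : ℝ) : ℂ := Complex.exp (2 * Real.pi * Complex.I * x)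

/-- `∑_{n ≤ x} χ(n)` -/
noncomputable def charSum {q : ℕ} (χ : DirichletCharacter ℂ q) (x : ℝ) : ℂ :=
  ∑ n ∈ Finset.Icc 1 ⌊x⌋₊, χ (n : ZMod q)

/-- `M(χ) = max_{1 ≤ N ≤ q} |∑_{n ≤ N} χ(n)|` -/
noncomputable def Mchi {q : ℕ} (χ : DirichletCharacter ℂ q) : ℝ :=
  ⨆ N ∈ Finset.Icc 1 q, ‖charSum χ (N : ℝ)‖

/-- `m(χ) = π M(χ)/(e^γ √q)` -/
noncomputable def mchi {q : ℕ} (χ : DirichletCharacter ℂ q) : ℝ :=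
  Real.pi * Mchi χ / (Real.exp Real.eulerMascheroniConstant * Real.sqrt q)

/-- the modified Bessel function `I₀` -/
noncomputable def I0 (t : ℝ) : ℝ := ∑' n : ℕ, (t ^ 2 / 4) ^ n / ((n.factorial : ℝ)) ^ 2

/-- the constant `A` -/
noncomputable def Aconst : ℝ :=
  Real.log 2 - 1 - (∫ t in (0:ℝ)..2, Real.log (I0 t) / t ^ 2)
    - ∫ t in Set.Ioi (2:ℝ), (Real.log (I0 t) - t) / t ^ 2

/-- `Φ_q(τ)` -/
noncomputable def Phi (q : ℕ) (τ : ℝ) : ℝ :=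
  (Nat.card {χ : DirichletCharacter ℂ q // χ ≠ 1 ∧ τ < mchi χ} : ℝ) / q.totient

/-- `S_𝒜(χ) = max_{α ∈ [0,1]} |∑_{n ∈ 𝒜} χ(n) e(nα)/n|` -/
noncomputable def SA {q : ℕ} (χ : DirichletCharacter ℂ q) (A : Finset ℕ) : ℝ :=
  ⨆ α : Set.Icc (0:ℝ) 1, ‖∑ n ∈ A, χ (n : ZMod q) * e2pi (n * (α : ℝ)) / n‖

/-- `S_{y,z}(χ)` -/
noncomputable def Syz {q : ℕ} (χ : DirichletCharacter ℂ q) (y z : ℝ) : ℝ :=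
  SA χ ((Finset.Icc 1 ⌊z⌋₊).filter fun n => ∃ p : ℕ, p.Prime ∧ p ∣ n ∧ y < (p : ℝ))

/-- `L(1,χ)` -/
noncomputable def Lone {q : ℕ} (χ : DirichletCharacter ℂ q) : ℂ :=
  ∑' n : ℕ, χ (n : ZMod q) / n

/-- the Gauss sum `G(χ) = ∑_{a=1}^{q} χ(a) e(a/q)` -/
noncomputable def gaussS {q : ℕ} (χ : DirichletCharacter ℂ q) : ℂ :=
  ∑ a ∈ Finset.Icc 1 q, χ (a : ZMod q) * e2pi ((a : ℝ) / q)

/-- the pretentious distance `𝔻(χ, ξ; y)` -/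
noncomputable def Ddist {q D : ℕ} (χ : DirichletCharacter ℂ q) (ξ : DirichletCharacter ℂ D)
    (y : ℝ) : ℝ :=
  Real.sqrt (∑ p ∈ (Finset.Icc 1 ⌊y⌋₊).filter Nat.Prime,
    (1 - (χ (p : ZMod q) * (starRingEnd ℂ) (ξ (p : ZMod D))).re) / p)

theorem abs_sum_mul_le_of_antitone {f c : ℕ → ℝ} {L : ℕ} {B : ℝ}
    (hf0 : ∀ m, L < m → 0 ≤ f m) (hf : ∀ m n, L < m → m ≤ n → f n ≤ f m)
    (hB : ∀ n, |∑ m ∈ Finset.Ioc L n, c m| ≤ B) (R : ℕ) :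
    |∑ m ∈ Finset.Ioc L R, f m * c m| ≤ f (L + 1) * B := by
  have hB0 : 0 ≤ B := (abs_nonneg _).trans (hB 0)
  rcases Nat.lt_or_ge L R with h | h
  · have key : |∑ m ∈ Finset.Ioc L R, f m * c m - f R * ∑ m ∈ Finset.Ioc L R, c m| ≤
        (f (L + 1) - f R) * B := by
      induction R, h using Nat.le_induction with
      | base => simp
      | succ R hR ih =>
        have e : ∀ g : ℕ → ℝ, ∑ m ∈ Finset.Ioc L (R + 1), g m =
            ∑ m ∈ Finset.Ioc L R, g m + g (R + 1) := fun g =>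
          Finset.sum_Ioc_succ_top (by omega) g
        rw [e, e]
        have h1 : f (R + 1) ≤ f R := hf _ _ (by omega) (by omega)
        have h2 := hB R
        have h3 : |(f R - f (R + 1)) * ∑ m ∈ Finset.Ioc L R, c m| ≤ (f R - f (R + 1)) * B := by
          rw [abs_mul, abs_of_nonneg (sub_nonneg.2 h1)]
          exact mul_le_mul_of_nonneg_left h2 (sub_nonneg.2 h1)
        have h4 := abs_add_le (∑ m ∈ Finset.Ioc L R, f m * c m - f R * ∑ m ∈ Finset.Ioc L R, c m)
          ((f R - f (R + 1)) * ∑ m ∈ Finset.Ioc L R, c m)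
        calc _ = _ := by congr 1; ring
          _ ≤ _ := h4
          _ ≤ _ := add_le_add ih h3
          _ = _ := by ring
    have h5 : |f R * ∑ m ∈ Finset.Ioc L R, c m| ≤ f R * B := by
      rw [abs_mul, abs_of_nonneg (hf0 R h)]
      exact mul_le_mul_of_nonneg_left (hB R) (hf0 R h)
    have h6 := abs_add_le (∑ m ∈ Finset.Ioc L R, f m * c m - f R * ∑ m ∈ Finset.Ioc L R, c m)
      (f R * ∑ m ∈ Finset.Ioc L R, c m)
    rw [sub_add_cancel] at h6
    linarith
  · rw [Finset.Ioc_eq_empty_of_le h]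
    simpa using mul_nonneg (hf0 (L + 1) (by omega)) hB0

theorem norm_coe_eq (x : ℝ) : ‖(x : UnitAddCircle)‖ = |x - round x| := by
  simpa using UnitAddCircle.norm_eq (x := x)

theorem cos_mul_sub_round (β : ℝ) (m : ℕ) :
    Real.cos (2 * Real.pi * (m * β)) = Real.cos (2 * Real.pi * (m * (β - round β))) := by
  have : 2 * Real.pi * (m * β) = 2 * Real.pi * (m * (β - round β)) +
      ((m * round β : ℤ) : ℝ) * (2 * Real.pi) := by push_cast; ring
  rw [this, Real.cos_add_int_mul_two_pi]

theorem two_mul_norm_le_abs_sin (β : ℝ) :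
    2 * ‖(β : UnitAddCircle)‖ ≤ |Real.sin (Real.pi * (β - round β))| := by
  rw [norm_coe_eq]
  set r := β - round β
  have hr : |r| ≤ 1 / 2 := abs_sub_round β
  have h := Real.mul_le_sin (x := Real.pi * |r|) (by positivity) (by nlinarith [Real.pi_pos])
  have h2 : 2 / Real.pi * (Real.pi * |r|) = 2 * |r| := by field_simp
  have h3 : |Real.sin (Real.pi * r)| = |Real.sin (Real.pi * |r|)| := by
    rcases abs_cases r with ⟨h, -⟩ | ⟨h, -⟩ <;> rw [h]
    rw [mul_neg, Real.sin_neg, abs_neg]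
  rw [h3, ← h2]
  exact h.trans (le_abs_self _)

theorem abs_sum_cos_le {β δ : ℝ} (hδ : 0 < δ) (h : δ ≤ ‖(β : UnitAddCircle)‖) (L n : ℕ) :
    |∑ m ∈ Finset.Ioc L n, Real.cos (2 * Real.pi * (m * β))| ≤ 1 / (2 * δ) := by
  set r := β - round β with hr
  have hs := two_mul_norm_le_abs_sin β
  rw [← hr] at hs
  simp_rw [cos_mul_sub_round β, ← hr]
  rcases Nat.le_total L n with hL | hL
  · have key : 2 * Real.sin (Real.pi * r) *
        ∑ m ∈ Finset.Ioc L n, Real.cos (2 * Real.pi * (m * r)) =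
        Real.sin (2 * Real.pi * ((n + 1 / 2) * r)) - Real.sin (2 * Real.pi * ((L + 1 / 2) * r)) := by
      induction n, hL using Nat.le_induction with
      | base => simp
      | succ k hk ih =>
        rw [Finset.sum_Ioc_succ_top (by omega), mul_add, ih]
        push_cast
        have e1 : 2 * Real.pi * ((k + 1 + 1 / 2) * r) =
          2 * Real.pi * ((k + 1) * r) + Real.pi * r := by ring
        have e2 : 2 * Real.pi * ((k + 1 / 2) * r) =
          2 * Real.pi * ((k + 1) * r) - Real.pi * r := by ring
        rw [e1, e2, Real.sin_add, Real.sin_sub]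
        ring
    have h1 : |2 * Real.sin (Real.pi * r) *
        ∑ m ∈ Finset.Ioc L n, Real.cos (2 * Real.pi * (m * r))| ≤ 2 := by
      rw [key]
      have := Real.abs_sin_le_one (2 * Real.pi * ((n + 1 / 2) * r))
      have := Real.abs_sin_le_one (2 * Real.pi * ((L + 1 / 2) * r))
      refine (abs_sub _ _).trans (by linarith)
    rw [abs_mul, abs_mul, abs_two] at h1
    rw [le_div_iff₀ (by positivity)]
    nlinarith [abs_nonneg (∑ m ∈ Finset.Ioc L n, Real.cos (2 * Real.pi * (m * r)))]
  · rw [Finset.Ioc_eq_empty_of_le hL]; simp; positivity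

theorem abs_sum_mul_cos_le {f : ℕ → ℝ} {L : ℕ}
    (hf0 : ∀ m, L < m → 0 ≤ f m) (hf : ∀ m n, L < m → m ≤ n → f n ≤ f m)
    {β δ : ℝ} (hδ : 0 < δ) (h : δ ≤ ‖(β : UnitAddCircle)‖) (R : ℕ) :
    |∑ m ∈ Finset.Ioc L R, f m * Real.cos (2 * Real.pi * (m * β))| ≤ f (L + 1) / (2 * δ) := by
  have := abs_sum_mul_le_of_antitone hf0 hf (abs_sum_cos_le hδ h L) R
  rwa [mul_one_div] at this

theorem cos_nonneg_of_mul_norm_le {β : ℝ} {m : ℕ} (h : m * ‖(β : UnitAddCircle)‖ ≤ 1 / 4) :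
    0 ≤ Real.cos (2 * Real.pi * (m * β)) := by
  rw [cos_mul_sub_round]
  rw [norm_coe_eq] at h
  have h1 : |2 * Real.pi * (m * (β - round β))| ≤ Real.pi / 2 := by
    rw [abs_mul (2 * Real.pi), abs_mul (m : ℝ), abs_of_pos (by positivity : 0 < 2 * Real.pi), Nat.abs_cast]
    nlinarith [Real.pi_pos]
  exact Real.cos_nonneg_of_mem_Icc ⟨by linarith [abs_le.1 h1], (abs_le.1 h1).2⟩

/-- One-sided bound with no assumption on `β`. -/
theorem neg_sum_mul_cos_div_le {ψ : ℕ → ℝ} {L : ℕ} {B : ℝ}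
    (hψ0 : ∀ m, L < m → 0 ≤ ψ m) (hψ : ∀ m n, L < m → m ≤ n → ψ n ≤ ψ m)
    (hB : ∀ m, L < m → ψ m ≤ B) (β : ℝ) (R : ℕ) :
    -∑ m ∈ Finset.Ioc L R, ψ m * Real.cos (2 * Real.pi * (m * β)) / m ≤ 2 * B := by
  have hB0 : 0 ≤ B := (hψ0 (L + 1) (by omega)).trans (hB _ (by omega))
  have anti : ∀ L', L ≤ L' → ∀ m n, L' < m → m ≤ n → ψ n / n ≤ ψ m / (m : ℝ) := by
    intro L' hL' m n hm hn
    have : (0 : ℝ) < m := by exact_mod_cast (by omega : 0 < m)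
    exact div_le_div₀ (hψ0 _ (by omega)) (hψ _ _ (by omega) hn) this (by exact_mod_cast hn)
  rcases (norm_nonneg (β : UnitAddCircle)).eq_or_lt with h0 | hpos
  · have : 0 ≤ ∑ m ∈ Finset.Ioc L R, ψ m * Real.cos (2 * Real.pi * (m * β)) / m := by
      refine Finset.sum_nonneg fun m hm => ?_
      have := cos_nonneg_of_mul_norm_le (β := β) (m := m) (by rw [← h0]; norm_num)
      exact div_nonneg (mul_nonneg (hψ0 _ (Finset.mem_Ioc.1 hm).1) this) (Nat.cast_nonneg _)
    linarith
  · set d := ‖(β : UnitAddCircle)‖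
    set K := max L ⌊1 / (4 * d)⌋₊ with hK
    have hsplit : ∑ m ∈ Finset.Ioc L R, ψ m * Real.cos (2 * Real.pi * (m * β)) / m =
        ∑ m ∈ (Finset.Ioc L R).filter (· ≤ K), ψ m * Real.cos (2 * Real.pi * (m * β)) / m +
        ∑ m ∈ Finset.Ioc K R, ψ m / m * Real.cos (2 * Real.pi * (m * β)) := by
      rw [← Finset.sum_filter_add_sum_filter_not (Finset.Ioc L R) (· ≤ K)]
      congr 1
      refine Finset.sum_congr ?_ fun m _ => by ring
      ext m
      simp only [Finset.mem_filter, Finset.mem_Ioc, not_le]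
      have : L ≤ K := le_max_left _ _
      omega
    have h1 : 0 ≤ ∑ m ∈ (Finset.Ioc L R).filter (· ≤ K),
        ψ m * Real.cos (2 * Real.pi * (m * β)) / m := by
      refine Finset.sum_nonneg fun m hm => ?_
      simp only [Finset.mem_filter, Finset.mem_Ioc] at hm
      have hm2 : m ≤ ⌊1 / (4 * d)⌋₊ := by
        rcases le_max_iff.1 hm.2 with h | h
        · omega
        · exact h
      have hm3 : (m : ℝ) ≤ 1 / (4 * d) := (Nat.le_floor_iff (by positivity)).1 hm2
      rw [le_div_iff₀ (by positivity)] at hm3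
      have := cos_nonneg_of_mul_norm_le (β := β) (m := m) (by change m * d ≤ _; linarith)
      exact div_nonneg (mul_nonneg (hψ0 _ hm.1.1) this) (Nat.cast_nonneg _)
    have hLK : L ≤ K := le_max_left _ _
    have h2 := abs_sum_mul_cos_le (f := fun m => ψ m / m) (L := K)
      (fun m hm => div_nonneg (hψ0 _ (by omega)) (Nat.cast_nonneg _)) (anti K hLK) hpos
      (le_refl _) R
    have h3 : ψ (K + 1) / ((K + 1 : ℕ) : ℝ) / (2 * d) ≤ 2 * B := by
      have hK1 : 1 / (4 * d) ≤ ((K + 1 : ℕ) : ℝ) := by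
        have := Nat.lt_floor_add_one (1 / (4 * d))
        have h' : (⌊1 / (4 * d)⌋₊ : ℝ) ≤ K := by exact_mod_cast le_max_right _ _
        push_cast; linarith
      rw [div_div, div_le_iff₀ (by positivity)]
      rw [div_le_iff₀ (by positivity)] at hK1
      have := hB (K + 1) (by omega)
      nlinarith
    rw [hsplit]
    have := neg_abs_le (∑ m ∈ Finset.Ioc K R, ψ m / m * Real.cos (2 * Real.pi * (m * β)))
    linarith

theorem neg_sum_mul_cos_div_le_of_norm {ψ : ℕ → ℝ} {L : ℕ} {B : ℝ}
    (hψ0 : ∀ m, L < m → 0 ≤ ψ m) (hψ : ∀ m n, L < m → m ≤ n → ψ n ≤ ψ m)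
    (hB : ∀ m, L < m → ψ m ≤ B) {β δ : ℝ} (hδ : 0 < δ) (h : δ ≤ ‖(β : UnitAddCircle)‖) (R : ℕ) :
    -∑ m ∈ Finset.Ioc L R, ψ m * Real.cos (2 * Real.pi * (m * β)) / m ≤
      B / ((L + 1) * δ) := by
  have hB0 : 0 ≤ B := (hψ0 (L + 1) (by omega)).trans (hB _ (by omega))
  have anti : ∀ m n, L < m → m ≤ n → ψ n / n ≤ ψ m / (m : ℝ) := by
    intro m n hm hn
    have : (0 : ℝ) < m := by exact_mod_cast (by omega : 0 < m)
    exact div_le_div₀ (hψ0 _ (by omega)) (hψ _ _ (by omega) hn) this (by exact_mod_cast hn)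
  have h2 := abs_sum_mul_cos_le (f := fun m => ψ m / m) (L := L)
    (fun m hm => div_nonneg (hψ0 _ (by omega)) (Nat.cast_nonneg _)) anti hδ h R
  have e : ∑ m ∈ Finset.Ioc L R, ψ m * Real.cos (2 * Real.pi * (m * β)) / m =
      ∑ m ∈ Finset.Ioc L R, ψ m / m * Real.cos (2 * Real.pi * (m * β)) :=
    Finset.sum_congr rfl fun m _ => by ring
  rw [e]
  have h3 : ψ (L + 1) / ((L + 1 : ℕ) : ℝ) / (2 * δ) ≤ B / ((L + 1) * δ) := by
    rw [div_div]
    push_cast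
    refine div_le_div₀ hB0 (hB _ (by omega)) (by positivity) ?_
    have : (0:ℝ) ≤ L := Nat.cast_nonneg _
    nlinarith [mul_nonneg this hδ.le]
  have := neg_abs_le (∑ m ∈ Finset.Ioc L R, ψ m / m * Real.cos (2 * Real.pi * (m * β)))
  linarith

theorem sum_vonMangoldt_mul_div (x : ℕ) :
    ∑ n ∈ Finset.Ioc 0 x, ArithmeticFunction.vonMangoldt n * ((x / n : ℕ) : ℝ) =
      Real.log (x.factorial) := by
  rw [← ArithmeticFunction.sum_Ioc_mul_zeta_eq_sum, ArithmeticFunction.vonMangoldt_mul_zeta]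
  induction x with
  | zero => simp
  | succ k ih =>
    rw [Finset.sum_Ioc_succ_top (by omega), ih, Nat.factorial_succ, Nat.cast_mul,
      Real.log_mul (by positivity) (by positivity), ArithmeticFunction.log_apply]
    ring

theorem sum_vonMangoldt_le (x : ℕ) :
    ∑ n ∈ Finset.Ioc 0 x, ArithmeticFunction.vonMangoldt n ≤ 6 * x := by
  have h := Chebyshev.psi_le_const_mul_self (x := x) (Nat.cast_nonneg _)
  rw [Chebyshev.psi, Nat.floor_natCast] at h
  have h4 : Real.log 4 ≤ 2 := by
    have : (4 : ℝ) = 2 ^ 2 := by norm_num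
    rw [this, Real.log_pow]
    have := Real.log_two_lt_d9
    push_cast; linarith
  have hx : (0 : ℝ) ≤ x := Nat.cast_nonneg _
  nlinarith

theorem sum_vonMangoldt_div_le {x : ℕ} (hx : 1 ≤ x) :
    ∑ n ∈ Finset.Ioc 0 x, ArithmeticFunction.vonMangoldt n / n ≤ Real.log x + 6 := by
  have hx0 : (0 : ℝ) < x := by exact_mod_cast hx
  have h1 : x * ∑ n ∈ Finset.Ioc 0 x, ArithmeticFunction.vonMangoldt n / n ≤
      ∑ n ∈ Finset.Ioc 0 x, ArithmeticFunction.vonMangoldt n * ((x / n : ℕ) : ℝ) +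
      ∑ n ∈ Finset.Ioc 0 x, ArithmeticFunction.vonMangoldt n := by
    rw [Finset.mul_sum, ← Finset.sum_add_distrib]
    refine Finset.sum_le_sum fun n hn => ?_
    have hn0 : (0 : ℝ) < n := by exact_mod_cast (Finset.mem_Ioc.1 hn).1
    have h2 : (x : ℝ) / n < ((x / n : ℕ) : ℝ) + 1 := by
      rw [← Nat.floor_div_eq_div (K := ℝ)]; exact Nat.lt_floor_add_one _
    have h3 : 0 ≤ ArithmeticFunction.vonMangoldt n := ArithmeticFunction.vonMangoldt_nonneg
    calc _ = ArithmeticFunction.vonMangoldt n * ((x : ℝ) / n) := by ring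
      _ ≤ ArithmeticFunction.vonMangoldt n * (((x / n : ℕ) : ℝ) + 1) := by gcongr
      _ = _ := by ring
  have h4 : Real.log (x.factorial) ≤ x * Real.log x := by
    rw [← Real.log_pow]
    refine Real.log_le_log (by positivity) ?_
    exact_mod_cast Nat.factorial_le_pow x
  rw [sum_vonMangoldt_mul_div] at h1
  have h5 := sum_vonMangoldt_le x
  nlinarith

theorem le_sum_vonMangoldt_div {x : ℕ} (hx : 1 ≤ x) :
    Real.log x - 1 ≤ ∑ n ∈ Finset.Ioc 0 x, ArithmeticFunction.vonMangoldt n / n := by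
  have hx0 : (0 : ℝ) < x := by exact_mod_cast hx
  have h1 : ∑ n ∈ Finset.Ioc 0 x, ArithmeticFunction.vonMangoldt n * ((x / n : ℕ) : ℝ) ≤
      x * ∑ n ∈ Finset.Ioc 0 x, ArithmeticFunction.vonMangoldt n / n := by
    rw [Finset.mul_sum]
    refine Finset.sum_le_sum fun n hn => ?_
    have hn0 : (0 : ℝ) < n := by exact_mod_cast (Finset.mem_Ioc.1 hn).1
    have h3 : 0 ≤ ArithmeticFunction.vonMangoldt n := ArithmeticFunction.vonMangoldt_nonneg
    calc _ ≤ ArithmeticFunction.vonMangoldt n * ((x : ℝ) / n) := by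
          gcongr; exact Nat.cast_div_le
      _ = _ := by ring
  have h2 := Stirling.le_log_factorial_stirling (n := x) (by omega)
  have h3 : 0 ≤ Real.log x := Real.log_nonneg (by exact_mod_cast hx)
  have h4 : 0 ≤ Real.log (2 * Real.pi) := Real.log_nonneg (by linarith [Real.pi_gt_three])
  rw [sum_vonMangoldt_mul_div] at h1
  nlinarith

theorem exists_sum_not_prime_le : ∃ C : ℝ, 0 ≤ C ∧ ∀ s : Finset ℕ,
    ∑ n ∈ s.filter (fun n => ¬ n.Prime), ArithmeticFunction.vonMangoldt n / n ≤ C := by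
  have h := ArithmeticFunction.vonMangoldt.summable_residueClass_non_primes_div (a := (0 : ZMod 1))
  have h0 : ∀ n : ℕ, 0 ≤ (if n.Prime then 0 else
      ArithmeticFunction.vonMangoldt.residueClass (0 : ZMod 1) n) / n := fun n => by
    have := ArithmeticFunction.vonMangoldt.residueClass_nonneg (0 : ZMod 1) n
    positivity
  refine ⟨∑' n : ℕ, (if n.Prime then 0 else
      ArithmeticFunction.vonMangoldt.residueClass (0 : ZMod 1) n) / n, tsum_nonneg h0, fun s => ?_⟩
  refine le_trans (le_of_eq ?_) (h.sum_le_tsum (s.filter (fun n => ¬ n.Prime)) fun n _ => h0 n)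
  refine Finset.sum_congr rfl fun n hn => ?_
  rw [if_neg (Finset.mem_filter.1 hn).2, ArithmeticFunction.vonMangoldt.residueClass,
    Set.indicator_of_mem]
  exact Subsingleton.elim _ _

theorem sum_inv_le_of_count_le {A : Finset ℕ} {ε : ℝ} (N : ℕ)
    (h : ∀ x ≤ N, ((A.filter (· ≤ x)).card : ℝ) ≤ ε * x) (hA : ∀ a ∈ A, 0 < a ∧ a ≤ N)
    (hε : 0 ≤ ε) :
    ∑ a ∈ A, (1 : ℝ) / a ≤ ε * (2 + Real.log N) := by
  have key : ∀ n : ℕ, ∑ a ∈ A.filter (· ≤ n), (1 : ℝ) / a =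
      ((A.filter (· ≤ n)).card : ℝ) / (n + 1) +
      ∑ x ∈ Finset.Ioc 0 n, ((A.filter (· ≤ x)).card : ℝ) / (x * (x + 1)) := by
    intro n
    induction n with
    | zero =>
      have : A.filter (· ≤ 0) = ∅ := by
        ext a; simp only [Finset.mem_filter, Finset.notMem_empty, iff_false]
        intro ha; have := (hA a ha.1).1; omega
      rw [this]; simp
    | succ n ih =>
      rw [Finset.sum_Ioc_succ_top (by omega)]
      have hn : (0:ℝ) ≤ n := Nat.cast_nonneg _
      by_cases hmem : n + 1 ∈ A
      · have e : A.filter (· ≤ n + 1) = insert (n + 1) (A.filter (· ≤ n)) := by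
          ext a; simp only [Finset.mem_filter, Finset.mem_insert]
          constructor
          · rintro ⟨h1, h2⟩
            rcases Nat.lt_or_ge n a with h3 | h3
            · left; omega
            · right; exact ⟨h1, h3⟩
          · rintro (rfl | h1)
            · exact ⟨hmem, le_refl _⟩
            · exact ⟨h1.1, by omega⟩
        have hnot : n + 1 ∉ A.filter (· ≤ n) := by simp
        rw [e, Finset.sum_insert hnot, ih, Finset.card_insert_of_notMem hnot]
        push_cast
        field_simp
        ring
      · have e : A.filter (· ≤ n + 1) = A.filter (· ≤ n) := by
          ext a; simp only [Finset.mem_filter]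
          constructor
          · rintro ⟨h1, h2⟩
            refine ⟨h1, ?_⟩
            rcases Nat.lt_or_ge n a with h3 | h3
            · exact absurd (by rwa [show n + 1 = a by omega]) hmem
            · exact h3
          · rintro ⟨h1, h2⟩; exact ⟨h1, by omega⟩
        rw [e, ih]
        push_cast
        field_simp
        ring
  have hAN : A.filter (· ≤ N) = A := Finset.filter_true_of_mem fun a ha => (hA a ha).2
  have h1 := key N
  have h0 := h N le_rfl
  rw [hAN] at h1 h0
  rw [h1]
  have hN0 : (0:ℝ) ≤ N := Nat.cast_nonneg _
  have h2 : (A.card : ℝ) / (N + 1) ≤ ε := by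
    rw [div_le_iff₀ (by positivity)]; nlinarith
  have h3 : ∑ x ∈ Finset.Ioc 0 N, ((A.filter (· ≤ x)).card : ℝ) / (x * (x + 1)) ≤
      ε * ∑ x ∈ Finset.Ioc 0 N, (1 : ℝ) / x := by
    rw [Finset.mul_sum]
    refine Finset.sum_le_sum fun x hx => ?_
    have hx0 : (0 : ℝ) < x := by exact_mod_cast (Finset.mem_Ioc.1 hx).1
    have := h x (Finset.mem_Ioc.1 hx).2
    rw [div_le_iff₀ (by positivity)]
    have e : ε * (1 / x) * (x * (x + 1)) = ε * x + ε := by field_simp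
    rw [e]; linarith
  have h4 : ∑ x ∈ Finset.Ioc 0 N, (1 : ℝ) / x ≤ 1 + Real.log N := by
    have := harmonic_le_one_add_log N
    rw [harmonic_eq_sum_Icc] at this
    push_cast at this
    refine le_trans (le_of_eq ?_) this
    refine Finset.sum_congr (by ext; simp [Nat.lt_iff_add_one_le]) fun x _ => by rw [one_div]
  nlinarith

theorem norm_coe_add_int (x : ℝ) (m : ℤ) :
    ‖((x + m : ℝ) : UnitAddCircle)‖ = ‖(x : UnitAddCircle)‖ := by
  rw [norm_coe_eq, norm_coe_eq, round_add_intCast]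
  push_cast
  congr 1
  ring

theorem norm_coe_le_abs (x : ℝ) : ‖(x : UnitAddCircle)‖ ≤ |x| := by
  rw [norm_coe_eq]
  simpa using round_le x 0

theorem norm_coe_eq_abs {x : ℝ} (h : |x| ≤ 1 / 2) : ‖(x : UnitAddCircle)‖ = |x| := by
  rw [AddCircle.norm_coe_eq_abs_iff 1 one_ne_zero]
  simpa using h

theorem norm_coe_sub_le (x y : ℝ) :
    ‖((x - y : ℝ) : UnitAddCircle)‖ ≤ ‖(x : UnitAddCircle)‖ + ‖(y : UnitAddCircle)‖ := by
  rw [AddCircle.coe_sub]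
  exact norm_sub_le _ _

theorem mul_card_le_of_shifts {A : Finset ℕ} {α η : ℝ} {x J t : ℕ}
    (hA : ∀ a ∈ A, 0 < a ∧ a ≤ x ∧ ‖((a * α : ℝ) : UnitAddCircle)‖ ≤ η)
    (h : ∀ k : ℕ, 0 < k → k < J → 2 * η < ‖(((k * t : ℕ) * α : ℝ) : UnitAddCircle)‖) :
    A.card * J ≤ x + J * t := by
  have hinj : Set.InjOn (fun q : ℕ × ℕ => q.1 + q.2 * t) (A ×ˢ Finset.range J : Finset _) := by
    have aux : ∀ a ∈ A, ∀ b ∈ A, ∀ i j : ℕ, j < J → i < j → a + i * t = b + j * t → False := by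
      intro a ha b hb i j hj hij hab
      obtain ⟨d, rfl⟩ := Nat.exists_eq_add_of_lt hij
      have h1 := h (d + 1) (by omega) (by omega)
      have h2 : (((d + 1) * t : ℕ) : ℝ) = a - b := by
        have : a = b + (d + 1) * t := by nlinarith
        rw [this]; push_cast; ring
      have h3 := norm_coe_sub_le (a * α) (b * α)
      rw [h2, sub_mul] at h1
      have := (hA a ha).2.2
      have := (hA b hb).2.2
      linarith
    rintro ⟨a, i⟩ hai ⟨b, j⟩ hbj hab
    simp only [Finset.coe_product, Set.mem_prod, Finset.mem_coe, Finset.mem_range] at hai hbj hab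
    rcases lt_trichotomy i j with hij | hij | hij
    · exact (aux a hai.1 b hbj.1 i j hbj.2 hij hab).elim
    · subst hij; simp at hab; simp [hab]
    · exact (aux b hbj.1 a hai.1 j i hai.2 hij hab.symm).elim
  have hc := Finset.card_le_card_of_injOn (s := A ×ˢ Finset.range J)
    (t := Finset.Ioc 0 (x + J * t)) _ (fun q hq => by
      simp only [Finset.coe_product, Set.mem_prod, Finset.mem_coe, Finset.mem_range] at hq
      have h1 := hA _ hq.1
      have h2 : q.2 * t ≤ J * t := Nat.mul_le_mul_right _ hq.2.le
      simp only [Finset.coe_Ioc, Set.mem_Ioc]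
      omega) hinj
  simpa using hc

set_option maxHeartbeats 800000 in
theorem exists_card_near_le {ℓ α : ℝ} (hℓ : 2 ≤ ℓ)
    (hα : (ℓ ^ 6)⁻¹ < ‖(α : UnitAddCircle)‖) :
    ∃ h : ℕ, h ≠ 1 ∧ ∀ (x : ℕ) (A : Finset ℕ),
      (∀ a ∈ A, 0 < a ∧ a ≤ x ∧ ‖((a * α : ℝ) : UnitAddCircle)‖ ≤ (ℓ ^ 6)⁻¹ ∧ ¬ h ∣ a) →
      (A.card : ℝ) ≤ 10 * (ℓ ^ 2)⁻¹ * x + ℓ ^ 2 := by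
  have hℓ0 : 0 < ℓ := by linarith
  set η₁ := (ℓ ^ 3)⁻¹ with hη₁
  set η₂ := (ℓ ^ 6)⁻¹ with hη₂
  have hη₁0 : 0 < η₁ := by positivity
  have hη₂0 : 0 < η₂ := by positivity
  have hsq : η₂ = η₁ * η₁ := by rw [hη₁, hη₂]; field_simp
  have h8 : η₁ ≤ 1 / 8 := by
    rw [hη₁, one_div]
    apply inv_anti₀ (by norm_num)
    nlinarith [sq_nonneg (ℓ - 2), mul_nonneg (sub_nonneg.2 hℓ) (sq_nonneg ℓ)]
  have h12 : η₂ ≤ η₁ := by rw [hsq]; nlinarith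
  have hη₁ℓ : η₁ ≤ (ℓ ^ 2)⁻¹ := by
    apply inv_anti₀ (by positivity); exact pow_le_pow_right₀ (by linarith) (by norm_num)
  by_cases hc : ∀ d : ℕ, 0 < d → (d : ℝ) < ℓ ^ 2 → 2 * η₁ < ‖((d * α : ℝ) : UnitAddCircle)‖
  · refine ⟨0, by norm_num, fun x A hA => ?_⟩
    have := mul_card_le_of_shifts (A := A) (α := α) (η := η₂) (x := x) (J := ⌈ℓ ^ 2⌉₊) (t := 1)
      (fun a ha => ⟨(hA a ha).1, (hA a ha).2.1, (hA a ha).2.2.1⟩) (fun k hk hkJ => by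
        have := hc k hk (Nat.lt_ceil.1 hkJ)
        rw [mul_one]; linarith)
    have h1 : (A.card : ℝ) * ⌈ℓ ^ 2⌉₊ ≤ x + ⌈ℓ ^ 2⌉₊ * 1 := by exact_mod_cast this
    have h2 : ℓ ^ 2 ≤ ⌈ℓ ^ 2⌉₊ := Nat.le_ceil _
    have hpos : (0 : ℝ) < ⌈ℓ ^ 2⌉₊ := lt_of_lt_of_le (by positivity) h2
    have h3 : (A.card : ℝ) ≤ x / ⌈ℓ ^ 2⌉₊ + 1 := by
      have e : (x : ℝ) / ⌈ℓ ^ 2⌉₊ + 1 = (x + ⌈ℓ ^ 2⌉₊ * 1) / ⌈ℓ ^ 2⌉₊ := by field_simp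
      rw [e, le_div_iff₀ hpos]; exact h1
    have h4 : (x : ℝ) / ⌈ℓ ^ 2⌉₊ ≤ x / ℓ ^ 2 :=
      div_le_div_of_nonneg_left (Nat.cast_nonneg _) (by positivity) h2
    have h5 : (x : ℝ) / ℓ ^ 2 ≤ 10 * (ℓ ^ 2)⁻¹ * x := by
      rw [div_eq_mul_inv]
      have : 0 ≤ (x : ℝ) * (ℓ ^ 2)⁻¹ := by positivity
      nlinarith
    nlinarith
  · push Not at hc
    let P : ℕ → Prop := fun d => 0 < d ∧ (d : ℝ) < ℓ ^ 2 ∧ ‖((d * α : ℝ) : UnitAddCircle)‖ ≤ 2 * η₁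
    have hex : ∃ d, P d := by
      obtain ⟨d, h1, h2, h3⟩ := hc; exact ⟨d, h1, h2, h3⟩
    obtain ⟨h0pos, h0lt, h0n⟩ := Nat.find_spec hex
    have hmin : ∀ m, m < Nat.find hex → ¬ P m := fun m hm => Nat.find_min hex hm
    set h₀ := Nat.find hex
    set δ : ℝ := h₀ * α - round (h₀ * α) with hδ
    have hδn : |δ| ≤ 2 * η₁ := by rw [norm_coe_eq] at h0n; exact h0n
    have hred : ∀ k : ℕ, ‖(((k * h₀ : ℕ) * α : ℝ) : UnitAddCircle)‖ =
        ‖((k * δ : ℝ) : UnitAddCircle)‖ := by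
      intro k
      have : ((k * h₀ : ℕ) : ℝ) * α = k * δ + ((k * round (h₀ * α) : ℤ) : ℝ) := by
        rw [hδ]; push_cast; ring
      rw [this, norm_coe_add_int]
    have hh₀ : (1 : ℝ) ≤ h₀ := by exact_mod_cast h0pos
    -- every admissible element is large compared with `h₀ / |δ|`
    have hlarge : ∀ a : ℕ, 0 < a → ‖((a * α : ℝ) : UnitAddCircle)‖ ≤ η₂ →
        ¬ (if h₀ = 1 then 0 else h₀) ∣ a → h₀ * η₁ ≤ a * |δ| := by
      intro a ha han hdvd
      by_cases h1 : h₀ = 1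
      · have e := hred a
        rw [h1, mul_one] at e
        rw [h1, Nat.cast_one, one_mul]
        by_contra hlt
        push Not at hlt
        have h2 : |(a : ℝ) * δ| = a * |δ| := by rw [abs_mul, Nat.abs_cast]
        rw [norm_coe_eq_abs (x := a * δ) (by rw [h2]; linarith), h2] at e
        have e1 := hred 1
        rw [h1] at e1
        simp only [Nat.cast_one, one_mul, mul_one] at e1
        have ha1 : (1 : ℝ) ≤ a := by exact_mod_cast ha
        have := norm_coe_le_abs δ
        nlinarith [abs_nonneg δ]
      · rw [if_neg h1] at hdvd
        have hj0 : 0 < a % h₀ := Nat.pos_of_ne_zero fun h => hdvd (Nat.dvd_of_mod_eq_zero h)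
        have hj1 : a % h₀ < h₀ := Nat.mod_lt _ h0pos
        have hnP := hmin _ hj1
        have h2 : 2 * η₁ < ‖(((a % h₀ : ℕ) * α : ℝ) : UnitAddCircle)‖ := by
          by_contra hle
          push Not at hle
          exact hnP ⟨hj0, lt_trans (by exact_mod_cast hj1) h0lt, hle⟩
        have e : (a : ℝ) = ((a / h₀ * h₀ : ℕ) : ℝ) + ((a % h₀ : ℕ) : ℝ) := by
          exact_mod_cast (Nat.div_add_mod' a h₀).symm
        have h3 := norm_coe_sub_le (a * α) (((a / h₀ * h₀ : ℕ) : ℝ) * α)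
        have e2 : a * α - ((a / h₀ * h₀ : ℕ) : ℝ) * α = ((a % h₀ : ℕ) : ℝ) * α := by
          rw [← sub_mul]; congr 1; linarith
        rw [e2, hred] at h3
        have h4 := norm_coe_le_abs (((a / h₀ : ℕ) : ℝ) * δ)
        rw [abs_mul, Nat.abs_cast] at h4
        have h5 : η₁ ≤ ((a / h₀ : ℕ) : ℝ) * |δ| := by linarith
        have h6 : (h₀ : ℝ) * ((a / h₀ : ℕ) : ℝ) ≤ a := by
          exact_mod_cast Nat.mul_div_le a h₀
        calc (h₀ : ℝ) * η₁ ≤ h₀ * (((a / h₀ : ℕ) : ℝ) * |δ|) := by gcongr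
          _ = (h₀ * ((a / h₀ : ℕ) : ℝ)) * |δ| := by ring
          _ ≤ a * |δ| := by gcongr
    refine ⟨if h₀ = 1 then 0 else h₀, by split_ifs <;> omega, fun x A hA => ?_⟩
    rcases A.eq_empty_or_nonempty with rfl | ⟨a, ha⟩
    · simp; positivity
    have hδa := hlarge a (hA a ha).1 (hA a ha).2.2.1 (hA a ha).2.2.2
    have hδpos : 0 < |δ| := by
      rcases (abs_nonneg δ).eq_or_lt with h | h
      · rw [← h, mul_zero] at hδa
        have : 0 < h₀ * η₁ := by positivity
        linarith
      · exact h
    have hδx : h₀ * η₁ ≤ x * |δ| := by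
      refine hδa.trans ?_
      have : (a : ℝ) ≤ x := by exact_mod_cast (hA a ha).2.1
      gcongr
    set t := ⌊2 * η₂ / |δ|⌋₊ + 1 with ht
    set J := ⌊1 / (8 * η₁)⌋₊ + 1 with hJ
    have ht1 : 2 * η₂ < t * |δ| := by
      rw [← div_lt_iff₀ hδpos, ht]; push_cast; exact Nat.lt_floor_add_one _
    have ht2 : (t : ℝ) ≤ 2 * η₂ / |δ| + 1 := by
      rw [ht]; push_cast
      have := Nat.floor_le (by positivity : 0 ≤ 2 * η₂ / |δ|)
      linarith
    have ht3 : t * |δ| ≤ 4 * η₁ := by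
      calc t * |δ| ≤ (2 * η₂ / |δ| + 1) * |δ| := by gcongr
        _ = 2 * η₂ + |δ| := by field_simp
        _ ≤ 4 * η₁ := by nlinarith
    have hJ1 : 1 / (8 * η₁) < J := by rw [hJ]; push_cast; exact Nat.lt_floor_add_one _
    have hJpos : (0 : ℝ) < J := by positivity
    have hcount := mul_card_le_of_shifts (A := A) (α := α) (η := η₂) (x := x) (J := J)
      (t := t * h₀) (fun a ha => ⟨(hA a ha).1, (hA a ha).2.1, (hA a ha).2.2.1⟩)
      (fun k hk hkJ => by
        rw [← mul_assoc, hred]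
        have hk1 : (1 : ℝ) ≤ k := by exact_mod_cast hk
        have hk2 : (k : ℝ) ≤ 1 / (8 * η₁) := by
          refine (Nat.le_floor_iff (by positivity)).1 ?_
          omega
        have e : |((k * t : ℕ) : ℝ) * δ| = k * (t * |δ|) := by
          rw [abs_mul, Nat.abs_cast]; push_cast; ring
        have hle : (k : ℝ) * (t * |δ|) ≤ 1 / 2 := by
          calc (k : ℝ) * (t * |δ|) ≤ 1 / (8 * η₁) * (4 * η₁) := by gcongr
            _ = 1 / 2 := by field_simp; norm_num
        rw [norm_coe_eq_abs (by rw [e]; exact hle), e]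
        nlinarith)
    have h1 : (A.card : ℝ) * J ≤ x + J * (t * h₀) := by exact_mod_cast hcount
    have h2 : (A.card : ℝ) ≤ x / J + t * h₀ := by
      have e : (x : ℝ) / J + t * h₀ = (x + J * (t * h₀)) / J := by field_simp
      rw [e, le_div_iff₀ hJpos]; exact h1
    have h3 : (x : ℝ) / J ≤ 8 * η₁ * x := by
      rw [div_le_iff₀ hJpos]
      rw [div_lt_iff₀ (by positivity)] at hJ1
      have : (0 : ℝ) ≤ x := Nat.cast_nonneg _
      nlinarith
    have h4 : (t : ℝ) * h₀ ≤ 2 * η₁ * x + h₀ := by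
      have h5 : 2 * η₂ / |δ| * h₀ ≤ 2 * η₁ * x := by
        rw [div_mul_eq_mul_div, div_le_iff₀ hδpos, hsq]
        calc 2 * (η₁ * η₁) * h₀ = 2 * η₁ * (h₀ * η₁) := by ring
          _ ≤ 2 * η₁ * (x * |δ|) := by gcongr
          _ = 2 * η₁ * x * |δ| := by ring
      calc (t : ℝ) * h₀ ≤ (2 * η₂ / |δ| + 1) * h₀ := by gcongr
        _ = 2 * η₂ / |δ| * h₀ + h₀ := by ring
        _ ≤ _ := by linarith
    have hx0 : (0 : ℝ) ≤ x := Nat.cast_nonneg _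
    have h6 : 10 * η₁ * x ≤ 10 * (ℓ ^ 2)⁻¹ * x := by gcongr
    linarith

/-- All prime factors of `n` are at most `N`. -/
def IsSmooth (N n : ℕ) : Prop := ∀ p : ℕ, p.Prime → p ∣ n → p ≤ N

theorem vonMangoldt_div_nonneg (a : ℕ) : 0 ≤ ArithmeticFunction.vonMangoldt a / (a : ℝ) :=
  div_nonneg ArithmeticFunction.vonMangoldt_nonneg (Nat.cast_nonneg _)

/-- Smooth prime powers beyond `N` contribute a bounded amount. -/
theorem exists_sum_smooth_le : ∃ C : ℝ, 0 ≤ C ∧ ∀ (N Z : ℕ) (g : ℕ → ℝ) (G : ℝ),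
    (∀ a, 0 < a → 0 ≤ g a) → (∀ a, N < a → g a ≤ G) →
    ∑ a ∈ (Finset.Ioc 0 Z).filter (IsSmooth N), ArithmeticFunction.vonMangoldt a / a * g a ≤
      ∑ a ∈ Finset.Ioc 0 N, ArithmeticFunction.vonMangoldt a / a * g a + C * G := by
  obtain ⟨C, hC0, hC⟩ := exists_sum_not_prime_le
  refine ⟨C, hC0, fun N Z g G hg hG => ?_⟩
  have hG0 : 0 ≤ G := (hg (N + 1) (by omega)).trans (hG (N + 1) (by omega))
  rw [← Finset.sum_filter_add_sum_filter_not _ (· ≤ N)]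
  refine add_le_add ?_ ?_
  · refine Finset.sum_le_sum_of_subset_of_nonneg ?_ fun a ha _ =>
      mul_nonneg (vonMangoldt_div_nonneg a) (hg a (Finset.mem_Ioc.1 ha).1)
    intro a ha
    simp only [Finset.mem_filter, Finset.mem_Ioc] at ha ⊢
    omega
  · have h1 := hC (((Finset.Ioc 0 Z).filter (IsSmooth N)).filter (fun a => ¬ a ≤ N))
    have h2 : (((Finset.Ioc 0 Z).filter (IsSmooth N)).filter (fun a => ¬ a ≤ N)).filter
        (fun n => ¬ n.Prime) = ((Finset.Ioc 0 Z).filter (IsSmooth N)).filter (fun a => ¬ a ≤ N) := by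
      refine Finset.filter_true_of_mem fun a ha hp => ?_
      simp only [Finset.mem_filter] at ha
      exact ha.2 (ha.1.2 a hp dvd_rfl)
    rw [h2] at h1
    calc _ ≤ ∑ a ∈ ((Finset.Ioc 0 Z).filter (IsSmooth N)).filter (fun a => ¬ a ≤ N),
          ArithmeticFunction.vonMangoldt a / a * G := by
          refine Finset.sum_le_sum fun a ha => ?_
          have := vonMangoldt_div_nonneg a
          have := hG a (not_le.1 (Finset.mem_filter.1 ha).2)
          gcongr
      _ = (∑ a ∈ ((Finset.Ioc 0 Z).filter (IsSmooth N)).filter (fun a => ¬ a ≤ N),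
          ArithmeticFunction.vonMangoldt a / a) * G := by rw [Finset.sum_mul]
      _ ≤ C * G := by gcongr

theorem log_pos_of_two_le {n : ℕ} (h : 2 ≤ n) : 0 < Real.log n :=
  Real.log_pos (by exact_mod_cast (by omega : 1 < n))

theorem exists_kappa_le : ∃ ℓ₀ : ℝ, ∀ N : ℕ, 2 ≤ N → ℓ₀ ≤ Real.log N → ∀ Z : ℕ,
    ∑ a ∈ (Finset.Ioc 0 Z).filter (IsSmooth N),
      ArithmeticFunction.vonMangoldt a / a * (1 / Real.log (a * N)) ≤ 9 / 10 := by
  obtain ⟨C, hC0, hC⟩ := exists_sum_smooth_le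
  refine ⟨15 * (6 + C), fun N hN hℓ Z => ?_⟩
  have hN0 : (0 : ℝ) < N := by positivity
  set ℓ := Real.log N with hℓdef
  have hℓ0 : 0 < ℓ := log_pos_of_two_le hN
  have hlog : ∀ a : ℕ, 0 < a → ℓ ≤ Real.log (a * N) := fun a ha => by
    refine Real.log_le_log hN0 ?_
    have : (1 : ℝ) ≤ a := by exact_mod_cast ha
    nlinarith
  have h1 := hC N Z (fun a => 1 / Real.log (a * N)) (1 / ℓ)
    (fun a ha => one_div_nonneg.2 (hℓ0.le.trans (hlog a ha)))
    (fun a ha => one_div_le_one_div_of_le hℓ0 (hlog a (by omega)))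
  set s := Nat.sqrt N with hs
  have hs1 : 1 ≤ s := Nat.sqrt_pos.2 (by omega)
  have hsN : s ≤ N := Nat.sqrt_le_self N
  have hsplit : ∀ f : ℕ → ℝ, ∑ a ∈ Finset.Ioc 0 N, f a =
      ∑ a ∈ Finset.Ioc 0 s, f a + ∑ a ∈ Finset.Ioc s N, f a := fun f =>
    (Finset.sum_Ioc_consecutive f (Nat.zero_le _) hsN).symm
  have hM := sum_vonMangoldt_div_le (x := N) (by omega)
  have hMs := sum_vonMangoldt_div_le hs1
  have hlogs : Real.log s ≤ ℓ / 2 := by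
    have h2 : (s : ℝ) ^ 2 ≤ N := by exact_mod_cast Nat.sqrt_le' N
    have h3 := Real.log_le_log (by positivity) h2
    rw [Real.log_pow] at h3
    push_cast at h3; linarith
  have h2 : ∑ a ∈ Finset.Ioc 0 s, ArithmeticFunction.vonMangoldt a / a * (1 / Real.log (a * N)) ≤
      (∑ a ∈ Finset.Ioc 0 s, ArithmeticFunction.vonMangoldt a / a) * (1 / ℓ) := by
    rw [Finset.sum_mul]
    refine Finset.sum_le_sum fun a ha => ?_
    have := vonMangoldt_div_nonneg a
    have := hlog a (Finset.mem_Ioc.1 ha).1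
    gcongr
  have h3 : ∑ a ∈ Finset.Ioc s N, ArithmeticFunction.vonMangoldt a / a * (1 / Real.log (a * N)) ≤
      (∑ a ∈ Finset.Ioc s N, ArithmeticFunction.vonMangoldt a / a) * (2 / (3 * ℓ)) := by
    rw [Finset.sum_mul]
    refine Finset.sum_le_sum fun a ha => ?_
    have h4 := vonMangoldt_div_nonneg a
    refine mul_le_mul_of_nonneg_left ?_ h4
    have ha0 : (0 : ℝ) < a := by exact_mod_cast (by have := (Finset.mem_Ioc.1 ha).1; omega : 0 < a)
    have h5 : (N : ℝ) ≤ (a : ℝ) ^ 2 := by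
      have := Nat.lt_succ_sqrt' N
      have h6 : (s + 1) ^ 2 ≤ a ^ 2 := Nat.pow_le_pow_left (Finset.mem_Ioc.1 ha).1 2
      exact_mod_cast (this.le.trans h6)
    have h6 := Real.log_le_log hN0 h5
    rw [Real.log_pow] at h6
    push_cast at h6
    rw [Real.log_mul ha0.ne' hN0.ne', div_le_div_iff₀ (by linarith) (by positivity)]
    linarith
  rw [hsplit] at h1 hM
  set A := ∑ a ∈ Finset.Ioc 0 s, ArithmeticFunction.vonMangoldt a / (a : ℝ)
  set B := ∑ a ∈ Finset.Ioc s N, ArithmeticFunction.vonMangoldt a / (a : ℝ)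
  have h7 : A * (1 / ℓ) + B * (2 / (3 * ℓ)) + C * (1 / ℓ) ≤ 9 / 10 := by
    have e : A * (1 / ℓ) + B * (2 / (3 * ℓ)) + C * (1 / ℓ) = (A / 3 + 2 / 3 * (A + B) + C) / ℓ := by
      field_simp; ring
    rw [e, div_le_iff₀ hℓ0]
    linarith
  linarith

theorem vonMangoldt_div_le_one {a : ℕ} (ha : 0 < a) : ArithmeticFunction.vonMangoldt a / (a : ℝ) ≤ 1 := by
  have ha0 : (0 : ℝ) < a := by exact_mod_cast ha
  rw [div_le_one ha0]
  exact ArithmeticFunction.vonMangoldt_le_log.trans (Real.log_le_self ha0.le)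

theorem exists_sum_near_le : ∃ C : ℝ, 0 ≤ C ∧ ∀ N : ℕ, 2 ≤ Real.log N → ∀ α : ℝ,
    (Real.log N ^ 6)⁻¹ < ‖(α : UnitAddCircle)‖ →
    ∑ a ∈ (Finset.Ioc 0 N).filter
        (fun a : ℕ => ‖((a * α : ℝ) : UnitAddCircle)‖ ≤ (Real.log N ^ 6)⁻¹),
      ArithmeticFunction.vonMangoldt a / a ≤ C * Real.log (Real.log N) := by
  obtain ⟨C, hC0, hC⟩ := exists_sum_not_prime_le
  refine ⟨6 + 2 * (40 + C), by positivity, fun N hℓ α hα => ?_⟩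
  set ℓ := Real.log N with hℓdef
  have hℓ0 : 0 < ℓ := by linarith
  obtain ⟨h, hh1, hcount⟩ := exists_card_near_le hℓ hα
  have hll : 1 / 2 ≤ Real.log ℓ := by
    have := Real.log_two_gt_d9
    have := Real.log_le_log (by norm_num) hℓ
    linarith
  set S := (Finset.Ioc 0 N).filter (fun a : ℕ => ‖((a * α : ℝ) : UnitAddCircle)‖ ≤ (ℓ ^ 6)⁻¹) with hS
  set T := ⌊ℓ ^ 6⌋₊ with hT
  have h64 : 1 ≤ ℓ ^ 6 := one_le_pow₀ (by linarith)
  have hT1 : 1 ≤ T := Nat.le_floor (by simpa using h64)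
  have hT2 : (T : ℝ) ≤ ℓ ^ 6 := Nat.floor_le (by positivity)
  set A := S.filter (fun a => ¬ a ≤ T ∧ a.Prime ∧ ¬ h ∣ a) with hA
  have hSmem : ∀ a : ℕ, a ∈ S ↔ (0 < a ∧ a ≤ N) ∧ ‖((a * α : ℝ) : UnitAddCircle)‖ ≤ (ℓ ^ 6)⁻¹ := by
    intro a; rw [hS, Finset.mem_filter, Finset.mem_Ioc]
  have hcov : S ⊆ (Finset.Ioc 0 T) ∪ (S.filter (fun a => ¬ a.Prime) ∪ (({h} : Finset ℕ).filter (0 < ·) ∪ A)) := by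
    intro a ha
    have ha' := (hSmem a).1 ha
    simp only [Finset.mem_union, Finset.mem_Ioc, Finset.mem_filter, Finset.mem_singleton, hA]
    by_cases h1 : a ≤ T
    · left; exact ⟨ha'.1.1, h1⟩
    by_cases h2 : a.Prime
    · by_cases h3 : h ∣ a
      · have : a = h := by
          rcases (Nat.dvd_prime h2).1 h3 with h4 | h4
          · exact absurd h4 hh1
          · exact h4.symm
        right; right; left
        exact ⟨this, ha'.1.1⟩
      · right; right; right; exact ⟨ha, h1, h2, h3⟩
    · right; left; exact ⟨ha, h2⟩
  have hun : ∀ (s t : Finset ℕ), ∑ a ∈ s ∪ t, ArithmeticFunction.vonMangoldt a / (a : ℝ) ≤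
      ∑ a ∈ s, ArithmeticFunction.vonMangoldt a / (a : ℝ) +
      ∑ a ∈ t, ArithmeticFunction.vonMangoldt a / (a : ℝ) := by
    intro s t
    rw [← Finset.sum_union_inter]
    have : 0 ≤ ∑ a ∈ s ∩ t, ArithmeticFunction.vonMangoldt a / (a : ℝ) :=
      Finset.sum_nonneg fun a _ => vonMangoldt_div_nonneg a
    linarith
  have h1 := Finset.sum_le_sum_of_subset_of_nonneg (f := fun a : ℕ =>
    ArithmeticFunction.vonMangoldt a / (a : ℝ)) hcov fun a _ _ => vonMangoldt_div_nonneg a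
  have h2 := hun (Finset.Ioc 0 T) (S.filter (fun a => ¬ a.Prime) ∪ (({h} : Finset ℕ).filter (0 < ·) ∪ A))
  have h3 := hun (S.filter (fun a => ¬ a.Prime)) (({h} : Finset ℕ).filter (0 < ·) ∪ A)
  have h4 := hun (({h} : Finset ℕ).filter (0 < ·)) A
  have b1 : ∑ a ∈ Finset.Ioc 0 T, ArithmeticFunction.vonMangoldt a / (a : ℝ) ≤ 6 * Real.log ℓ + 6 := by
    refine (sum_vonMangoldt_div_le hT1).trans ?_
    have := Real.log_le_log (by exact_mod_cast hT1) hT2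
    rw [Real.log_pow] at this
    push_cast at this; linarith
  have b2 := hC S
  have b3 : ∑ a ∈ ({h} : Finset ℕ).filter (0 < ·), ArithmeticFunction.vonMangoldt a / (a : ℝ) ≤ 1 := by
    rw [Finset.filter_singleton]
    split_ifs with hpos
    · rw [Finset.sum_singleton]; exact vonMangoldt_div_le_one hpos
    · simp
  have b4 : ∑ a ∈ A, ArithmeticFunction.vonMangoldt a / (a : ℝ) ≤ 33 := by
    have hAmem : ∀ a ∈ A, (0 < a ∧ a ≤ N) ∧ ‖((a * α : ℝ) : UnitAddCircle)‖ ≤ (ℓ ^ 6)⁻¹ ∧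
        T < a ∧ ¬ h ∣ a := by
      intro a ha
      have ha2 := Finset.mem_filter.1 ha
      have ha1 := (hSmem a).1 ha2.1
      exact ⟨ha1.1, ha1.2, not_le.1 ha2.2.1, ha2.2.2.2⟩
    have c1 := sum_inv_le_of_count_le (A := A) (ε := 11 * (ℓ ^ 2)⁻¹) N (fun x hx => by
      rcases (A.filter (· ≤ x)).eq_empty_or_nonempty with he | ⟨a, ha⟩
      · rw [he]; simp; positivity
      · have := hcount x (A.filter (· ≤ x)) (fun b hb => by
          have hb2 := Finset.mem_filter.1 hb
          have hb3 := hAmem b hb2.1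
          exact ⟨hb3.1.1, hb2.2, hb3.2.1, hb3.2.2.2⟩)
        have ha2 := Finset.mem_filter.1 ha
        have ha3 := (hAmem a ha2.1).2.2.1
        have hxT : ℓ ^ 6 ≤ x := by
          have : (a : ℝ) ≤ x := by exact_mod_cast ha2.2
          have := (Nat.floor_lt (by positivity)).1 ha3
          linarith
        have : ℓ ^ 2 ≤ (ℓ ^ 2)⁻¹ * x := by
          rw [← div_eq_inv_mul, le_div_iff₀ (by positivity)]
          calc ℓ ^ 2 * ℓ ^ 2 = ℓ ^ 4 := by ring
            _ ≤ ℓ ^ 6 := pow_le_pow_right₀ (by linarith) (by norm_num)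
            _ ≤ x := hxT
        linarith) (fun a ha => (hAmem a ha).1) (by positivity)
    calc _ ≤ ∑ a ∈ A, ℓ * ((1 : ℝ) / a) := by
          refine Finset.sum_le_sum fun a ha => ?_
          have ha1 := (hAmem a ha).1
          have ha0 : (0 : ℝ) < a := by exact_mod_cast ha1.1
          rw [div_eq_mul_one_div]
          refine mul_le_mul_of_nonneg_right ?_ (by positivity)
          exact ArithmeticFunction.vonMangoldt_le_log.trans
            (Real.log_le_log ha0 (by exact_mod_cast ha1.2))
      _ = ℓ * ∑ a ∈ A, (1 : ℝ) / a := by rw [Finset.mul_sum]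
      _ ≤ ℓ * (11 * (ℓ ^ 2)⁻¹ * (2 + ℓ)) := by gcongr
      _ = 11 * ((2 + ℓ) / ℓ) := by field_simp
      _ ≤ 11 * 3 := by
          gcongr
          rw [div_le_iff₀ hℓ0]; linarith
      _ = 33 := by norm_num
  have hgoal : 6 * Real.log ℓ + 6 + (C + (1 + 33)) ≤ (6 + 2 * (40 + C)) * Real.log ℓ := by
    have : (40 + C) * 1 ≤ (40 + C) * (2 * Real.log ℓ) := by gcongr; linarith
    linarith
  linarith

/-- The weight controlling the contribution of `a` to the recursion. -/
noncomputable def nearWeight (N : ℕ) (α : ℝ) (a : ℕ) : ℝ :=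
  if ‖((a * α : ℝ) : UnitAddCircle)‖ ≤ (Real.log N ^ 6)⁻¹ ∨ N * (Real.log N ^ 6)⁻¹ < a then 1
  else a / (N * (Real.log N ^ 6)⁻¹)

theorem exists_sum_nearWeight_le : ∃ C : ℝ, 0 ≤ C ∧ ∀ N : ℕ, 2 ≤ Real.log N →
    Real.log N ^ 6 ≤ N → ∀ α : ℝ, (Real.log N ^ 6)⁻¹ < ‖(α : UnitAddCircle)‖ → ∀ Z : ℕ,
    ∑ a ∈ (Finset.Ioc 0 Z).filter (IsSmooth N),
      ArithmeticFunction.vonMangoldt a / a * nearWeight N α a ≤ C * Real.log (Real.log N) := by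
  obtain ⟨C₁, hC₁0, hC₁⟩ := exists_sum_smooth_le
  obtain ⟨C₂, hC₂0, hC₂⟩ := exists_sum_near_le
  refine ⟨C₂ + 6 + 2 * (14 + C₁), by positivity, fun N hℓ hN α hα Z => ?_⟩
  set ℓ := Real.log N with hℓdef
  have hℓ0 : 0 < ℓ := by linarith
  have h64 : 0 < ℓ ^ 6 := by positivity
  have hN0 : (0 : ℝ) < N := lt_of_lt_of_le h64 hN
  have hll : 1 / 2 ≤ Real.log ℓ := by
    have := Real.log_two_gt_d9
    have := Real.log_le_log (by norm_num) hℓ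
    linarith
  have hw0 : ∀ a, 0 ≤ nearWeight N α a := fun a => by
    unfold nearWeight; split_ifs <;> positivity
  have hw1 : ∀ a, nearWeight N α a ≤ 1 := fun a => by
    unfold nearWeight; split_ifs with h
    · exact le_rfl
    · push Not at h
      rw [div_le_one (by positivity)]; exact h.2
  have h1 := hC₁ N Z (nearWeight N α) 1 (fun a _ => hw0 a) (fun a _ => hw1 a)
  set X := ⌊N * (ℓ ^ 6)⁻¹⌋₊ with hX
  have hX1 : 1 ≤ N * (ℓ ^ 6)⁻¹ := by
    rw [← div_eq_mul_inv, one_le_div h64]; exact hN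
  have hX1' : 1 ≤ X := Nat.le_floor (by simpa using hX1)
  have hX2 : (X : ℝ) ≤ N * (ℓ ^ 6)⁻¹ := Nat.floor_le (by positivity)
  have hX3 : N * (ℓ ^ 6)⁻¹ < X + 1 := Nat.lt_floor_add_one _
  have hXR : (1 : ℝ) ≤ X := by exact_mod_cast hX1'
  have hXN : X ≤ N := by
    have : (X : ℝ) ≤ N := hX2.trans (by
      have : (ℓ ^ 6)⁻¹ ≤ 1 := inv_le_one_of_one_le₀ (one_le_pow₀ (by linarith))
      nlinarith)
    exact_mod_cast this
  have hpt : ∀ a ∈ Finset.Ioc 0 N, ArithmeticFunction.vonMangoldt a / a * nearWeight N α a ≤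
      (if ‖((a * α : ℝ) : UnitAddCircle)‖ ≤ (ℓ ^ 6)⁻¹ then ArithmeticFunction.vonMangoldt a / a else 0) +
      ((if a ≤ X then 0 else ArithmeticFunction.vonMangoldt a / a) +
       (if a ≤ X then ArithmeticFunction.vonMangoldt a / (N * (ℓ ^ 6)⁻¹) else 0)) := by
    intro a ha
    have ha0 : (0 : ℝ) < a := by exact_mod_cast (Finset.mem_Ioc.1 ha).1
    have hv := vonMangoldt_div_nonneg a
    have hv2 : 0 ≤ ArithmeticFunction.vonMangoldt a / (N * (ℓ ^ 6)⁻¹) :=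
      div_nonneg ArithmeticFunction.vonMangoldt_nonneg (by positivity)
    have hle := mul_le_of_le_one_right hv (hw1 a)
    by_cases hb : ‖((a * α : ℝ) : UnitAddCircle)‖ ≤ (ℓ ^ 6)⁻¹
    · rw [if_pos hb]
      have : 0 ≤ (if a ≤ X then 0 else ArithmeticFunction.vonMangoldt a / (a : ℝ)) := by
        split_ifs <;> linarith
      have : 0 ≤ (if a ≤ X then ArithmeticFunction.vonMangoldt a / (N * (ℓ ^ 6)⁻¹) else 0) := by
        split_ifs <;> linarith
      linarith
    · rw [if_neg hb]
      by_cases hc : a ≤ X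
      · rw [if_pos hc, if_pos hc]
        have hc' : ¬ (N * (ℓ ^ 6)⁻¹ < a) := by
          rw [not_lt]
          exact le_trans (by exact_mod_cast hc) hX2
        rw [nearWeight, if_neg (by push Not; exact ⟨not_le.1 hb, not_lt.1 hc'⟩)]
        apply le_of_eq
        rw [zero_add, zero_add, div_mul_div_cancel₀ ha0.ne']
      · rw [if_neg hc, if_neg hc]; linarith
  have h2 := Finset.sum_le_sum hpt
  rw [Finset.sum_add_distrib, Finset.sum_add_distrib, ← Finset.sum_filter] at h2
  have h3 := hC₂ N hℓ α hα
  have hsplit : ∀ f : ℕ → ℝ, ∑ a ∈ Finset.Ioc 0 N, f a =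
      ∑ a ∈ Finset.Ioc 0 X, f a + ∑ a ∈ Finset.Ioc X N, f a := fun f =>
    (Finset.sum_Ioc_consecutive f (Nat.zero_le _) hXN).symm
  have h4 : ∑ a ∈ Finset.Ioc 0 N, (if a ≤ X then 0 else ArithmeticFunction.vonMangoldt a / (a : ℝ)) ≤
      8 + 6 * Real.log ℓ := by
    have hM := sum_vonMangoldt_div_le (x := N) (by omega)
    have hm := le_sum_vonMangoldt_div hX1'
    rw [hsplit] at hM ⊢
    have e1 : ∑ a ∈ Finset.Ioc 0 X, (if a ≤ X then 0 else ArithmeticFunction.vonMangoldt a / (a : ℝ)) = 0 :=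
      Finset.sum_eq_zero fun a ha => if_pos (Finset.mem_Ioc.1 ha).2
    have e2 : ∑ a ∈ Finset.Ioc X N, (if a ≤ X then 0 else ArithmeticFunction.vonMangoldt a / (a : ℝ)) =
        ∑ a ∈ Finset.Ioc X N, ArithmeticFunction.vonMangoldt a / (a : ℝ) :=
      Finset.sum_congr rfl fun a ha => if_neg (not_le.2 (Finset.mem_Ioc.1 ha).1)
    rw [e1, e2]
    have hlogX : ℓ ≤ Real.log X + Real.log 2 + 6 * Real.log ℓ := by
      have : (N : ℝ) ≤ X * 2 * ℓ ^ 6 := by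
        rw [← div_eq_mul_inv, div_lt_iff₀ h64] at hX3
        nlinarith
      have h5 := Real.log_le_log hN0 this
      rw [Real.log_mul (by positivity) (by positivity), Real.log_mul (by positivity) (by positivity),
        Real.log_pow] at h5
      push_cast at h5; exact h5
    have := Real.log_two_lt_d9
    linarith
  have h5 : ∑ a ∈ Finset.Ioc 0 N, (if a ≤ X then ArithmeticFunction.vonMangoldt a / (N * (ℓ ^ 6)⁻¹) else 0) ≤
      6 := by
    rw [hsplit]
    have e1 : ∑ a ∈ Finset.Ioc 0 X, (if a ≤ X then ArithmeticFunction.vonMangoldt a / (N * (ℓ ^ 6)⁻¹) else 0) =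
        (∑ a ∈ Finset.Ioc 0 X, ArithmeticFunction.vonMangoldt a) / (N * (ℓ ^ 6)⁻¹) := by
      rw [Finset.sum_div]
      exact Finset.sum_congr rfl fun a ha => if_pos (Finset.mem_Ioc.1 ha).2
    have e2 : ∑ a ∈ Finset.Ioc X N, (if a ≤ X then ArithmeticFunction.vonMangoldt a / (N * (ℓ ^ 6)⁻¹) else 0) = 0 :=
      Finset.sum_eq_zero fun a ha => if_neg (not_le.2 (Finset.mem_Ioc.1 ha).1)
    rw [e1, e2, add_zero, div_le_iff₀ (by positivity)]
    have := sum_vonMangoldt_le X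
    linarith
  have hgoal : C₂ * Real.log ℓ + (8 + 6 * Real.log ℓ + 6) + C₁ * 1 ≤
      (C₂ + 6 + 2 * (14 + C₁)) * Real.log ℓ := by
    have : (14 + C₁) * 1 ≤ (14 + C₁) * (2 * Real.log ℓ) := by gcongr; linarith
    linarith
  linarith

/-- Minus the weighted cosine sum over smooth integers in `(N, Z]`. -/
noncomputable def tailSum (N Z : ℕ) (φ : ℕ → ℝ) (α : ℝ) : ℝ :=
  -∑ n ∈ (Finset.Ioc N Z).filter (IsSmooth N), φ n * Real.cos (2 * Real.pi * (n * α)) / n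

theorem isSmooth_mul {N a m : ℕ} : IsSmooth N (a * m) ↔ IsSmooth N a ∧ IsSmooth N m := by
  constructor
  · intro h
    exact ⟨fun p hp hd => h p hp (hd.mul_right _), fun p hp hd => h p hp (hd.mul_left _)⟩
  · rintro ⟨h1, h2⟩ p hp hd
    rcases (Nat.Prime.dvd_mul hp).1 hd with h | h
    · exact h1 p hp h
    · exact h2 p hp h

theorem isSmooth_of_le {N m : ℕ} (h0 : 0 < m) (h : m ≤ N) : IsSmooth N m :=
  fun _ _ hd => (Nat.le_of_dvd h0 hd).trans h

theorem sum_smooth_divisors (N Z : ℕ) (F : ℕ → ℕ → ℝ) :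
    ∑ n ∈ (Finset.Ioc N Z).filter (IsSmooth N), ∑ a ∈ n.divisors, F n a =
      ∑ a ∈ (Finset.Ioc 0 Z).filter (IsSmooth N),
        ∑ m ∈ (Finset.Ioc (N / a) (Z / a)).filter (IsSmooth N), F (a * m) a := by
  rw [Finset.sum_comm' (t' := (Finset.Ioc 0 Z).filter (IsSmooth N))
    (s' := fun a => ((Finset.Ioc N Z).filter (IsSmooth N)).filter (a ∣ ·))]
  · refine Finset.sum_congr rfl fun a ha => ?_
    have ha0 : 0 < a := (Finset.mem_Ioc.1 (Finset.mem_filter.1 ha).1).1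
    have has : IsSmooth N a := (Finset.mem_filter.1 ha).2
    refine Finset.sum_nbij' (fun n => n / a) (fun m => a * m) ?_ ?_ ?_ ?_ ?_
    · intro n hn
      simp only [Finset.mem_filter, Finset.mem_Ioc] at hn ⊢
      obtain ⟨⟨⟨h1, h2⟩, h3⟩, m, rfl⟩ := hn
      rw [Nat.mul_div_cancel_left _ ha0]
      refine ⟨⟨?_, ?_⟩, (isSmooth_mul.1 h3).2⟩
      · rw [Nat.div_lt_iff_lt_mul ha0]; linarith
      · rw [Nat.le_div_iff_mul_le ha0]; linarith
    · intro m hm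
      simp only [Finset.mem_filter, Finset.mem_Ioc] at hm ⊢
      rw [Nat.div_lt_iff_lt_mul ha0, Nat.le_div_iff_mul_le ha0] at hm
      refine ⟨⟨⟨by linarith, by linarith⟩, isSmooth_mul.2 ⟨has, hm.2⟩⟩, dvd_mul_right _ _⟩
    · intro n hn
      exact Nat.mul_div_cancel' (Finset.mem_filter.1 hn).2
    · intro m hm
      exact Nat.mul_div_cancel_left _ ha0
    · intro n hn
      rw [Nat.mul_div_cancel' (Finset.mem_filter.1 hn).2]
  · intro n a
    simp only [Finset.mem_filter, Finset.mem_Ioc, Nat.mem_divisors]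
    constructor
    · rintro ⟨⟨⟨h1, h2⟩, h3⟩, h4, h5⟩
      refine ⟨⟨⟨⟨h1, h2⟩, h3⟩, h4⟩, ⟨Nat.pos_of_dvd_of_pos h4 (by omega),
        (Nat.le_of_dvd (by omega) h4).trans h2⟩, ?_⟩
      obtain ⟨m, rfl⟩ := h4
      exact (isSmooth_mul.1 h3).1
    · rintro ⟨⟨⟨⟨h1, h2⟩, h3⟩, h4⟩, -⟩
      exact ⟨⟨⟨h1, h2⟩, h3⟩, h4, by omega⟩

/-- The weight produced by one step of the recursion. -/
noncomputable def stepWeight (φ : ℕ → ℝ) (a m : ℕ) : ℝ := φ (a * m) / Real.log ((a * m : ℕ) : ℝ)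

theorem tailSum_eq {N : ℕ} (hN : 2 ≤ N) (Z : ℕ) (φ : ℕ → ℝ) (α : ℝ) :
    tailSum N Z φ α = ∑ a ∈ (Finset.Ioc 0 Z).filter (IsSmooth N),
      ArithmeticFunction.vonMangoldt a / a *
        (-∑ m ∈ Finset.Ioc (N / a) (min N (Z / a)),
          stepWeight φ a m * Real.cos (2 * Real.pi * (m * (a * α))) / m +
        tailSum N (Z / a) (stepWeight φ a) (a * α)) := by
  have h1 : tailSum N Z φ α = ∑ n ∈ (Finset.Ioc N Z).filter (IsSmooth N), ∑ a ∈ n.divisors,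
      -(ArithmeticFunction.vonMangoldt a * (φ n * Real.cos (2 * Real.pi * (n * α)) /
        (n * Real.log n))) := by
    rw [tailSum, ← Finset.sum_neg_distrib]
    refine Finset.sum_congr rfl fun n hn => ?_
    have hn1 := (Finset.mem_Ioc.1 (Finset.mem_filter.1 hn).1).1
    have hlog : Real.log n ≠ 0 := (log_pos_of_two_le (by omega)).ne'
    have hn0 : (n : ℝ) ≠ 0 := by exact_mod_cast (by omega : n ≠ 0)
    rw [Finset.sum_neg_distrib, ← Finset.sum_mul, ArithmeticFunction.vonMangoldt_sum]
    field_simp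
  rw [h1, sum_smooth_divisors N Z (fun n a => -(ArithmeticFunction.vonMangoldt a *
    (φ n * Real.cos (2 * Real.pi * (n * α)) / (n * Real.log n))))]
  refine Finset.sum_congr rfl fun a ha => ?_
  have ha0 : 0 < a := (Finset.mem_Ioc.1 (Finset.mem_filter.1 ha).1).1
  have ha0' : (a : ℝ) ≠ 0 := by exact_mod_cast ha0.ne'
  rw [← Finset.sum_filter_add_sum_filter_not _ (· ≤ N), tailSum, mul_add, mul_neg, mul_neg,
    Finset.mul_sum, Finset.mul_sum, ← Finset.sum_neg_distrib, ← Finset.sum_neg_distrib]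
  have hNa : N / a ≤ N := Nat.div_le_self _ _
  have hterm : ∀ m : ℕ, -(ArithmeticFunction.vonMangoldt a *
      (φ (a * m) * Real.cos (2 * Real.pi * ((a * m : ℕ) * α)) /
        ((a * m : ℕ) * Real.log (a * m : ℕ)))) =
      -(ArithmeticFunction.vonMangoldt a / a *
        (stepWeight φ a m * Real.cos (2 * Real.pi * (m * (a * α))) / m)) := by
    intro m
    rw [stepWeight]
    have : ((a * m : ℕ) : ℝ) * α = m * (a * α) := by push_cast; ring
    rw [this]
    push_cast
    congr 1
    simp only [div_eq_mul_inv, mul_inv]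
    ring
  congr 1
  · refine Finset.sum_congr ?_ fun m _ => hterm m
    ext m
    simp only [Finset.mem_filter, Finset.mem_Ioc, le_min_iff]
    constructor
    · rintro ⟨⟨⟨h1, h2⟩, -⟩, h3⟩; exact ⟨h1, h3, h2⟩
    · rintro ⟨h1, h2, h3⟩; exact ⟨⟨⟨h1, h3⟩, isSmooth_of_le (Nat.zero_lt_of_lt h1) h2⟩, h2⟩
  · refine Finset.sum_congr ?_ fun m _ => hterm m
    ext m
    simp only [Finset.mem_filter, Finset.mem_Ioc, not_le]
    constructor
    · rintro ⟨⟨⟨h1, h2⟩, h3⟩, h4⟩; exact ⟨⟨h4, h2⟩, h3⟩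
    · rintro ⟨⟨h1, h2⟩, h3⟩; exact ⟨⟨⟨lt_of_le_of_lt hNa h1, h2⟩, h3⟩, h1⟩

section stepWeight

variable {N : ℕ} {φ : ℕ → ℝ}

theorem stepWeight_nonneg (hφ0 : ∀ m, N ≤ m → 0 ≤ φ m) {a m : ℕ} (h : N ≤ a * m) :
    0 ≤ stepWeight φ a m :=
  div_nonneg (hφ0 _ h) (Real.log_natCast_nonneg _)

theorem stepWeight_anti (hN : 2 ≤ N) (hφ0 : ∀ m, N ≤ m → 0 ≤ φ m)
    (hφ : ∀ m n, N ≤ m → m ≤ n → φ n ≤ φ m) {a m n : ℕ} (h : N ≤ a * m) (hmn : m ≤ n) :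
    stepWeight φ a n ≤ stepWeight φ a m := by
  have h1 : a * m ≤ a * n := Nat.mul_le_mul_left _ hmn
  refine div_le_div₀ (hφ0 _ h) (hφ _ _ h h1) (log_pos_of_two_le (by omega)) ?_
  exact Real.log_le_log (by exact_mod_cast (by omega : 0 < a * m)) (by exact_mod_cast h1)

theorem stepWeight_le (hN : 2 ≤ N) (hφ0 : ∀ m, N ≤ m → 0 ≤ φ m)
    (hφ : ∀ m n, N ≤ m → m ≤ n → φ n ≤ φ m) {a m : ℕ} (h : N ≤ a * m) :
    stepWeight φ a m ≤ φ N / Real.log N := by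
  refine div_le_div₀ (hφ0 _ le_rfl) (hφ _ _ le_rfl h) (log_pos_of_two_le hN) ?_
  exact Real.log_le_log (by exact_mod_cast (by omega : 0 < N)) (by exact_mod_cast h)

theorem stepWeight_self_le (hφ : ∀ m n, N ≤ m → m ≤ n → φ n ≤ φ m) {a : ℕ}
    (ha : 0 < a) : stepWeight φ a N ≤ φ N * (1 / Real.log (a * N)) := by
  have h : N ≤ a * N := Nat.le_mul_of_pos_left _ ha
  rw [stepWeight, mul_one_div, Nat.cast_mul]
  have := Real.log_natCast_nonneg (a * N)
  push_cast at this
  exact div_le_div_of_nonneg_right (hφ _ _ le_rfl h) this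

end stepWeight

theorem exists_tailSum_le : ∃ C ℓ₀ : ℝ, 0 ≤ C ∧ ∀ N : ℕ, 2 ≤ N → ℓ₀ ≤ Real.log N →
    ∀ (Z : ℕ) (φ : ℕ → ℝ) (α : ℝ), (∀ m, N ≤ m → 0 ≤ φ m) →
      (∀ m n, N ≤ m → m ≤ n → φ n ≤ φ m) → tailSum N Z φ α ≤ C * φ N := by
  obtain ⟨C₁, hC₁0, hC₁⟩ := exists_sum_smooth_le
  obtain ⟨ℓ₁, hκ⟩ := exists_kappa_le
  refine ⟨20 * (7 + C₁), max 1 ℓ₁, by positivity, fun N hN hℓ Z => ?_⟩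
  set C := 20 * (7 + C₁) with hC
  have hCpos : 0 ≤ C := by positivity
  set ℓ := Real.log N with hℓdef
  have hℓ1 : 1 ≤ ℓ := (le_max_left _ _).trans hℓ
  have hκN := hκ N hN ((le_max_right _ _).trans hℓ)
  have hMN : ∀ Z, ∑ a ∈ (Finset.Ioc 0 Z).filter (IsSmooth N),
      ArithmeticFunction.vonMangoldt a / (a : ℝ) ≤ (7 + C₁) * ℓ := fun Z => by
    have h1 := hC₁ N Z (fun _ => 1) 1 (fun _ _ => zero_le_one) (fun _ _ => le_rfl)
    simp only [mul_one] at h1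
    have h2 := sum_vonMangoldt_div_le (x := N) (by omega)
    nlinarith
  induction Z using Nat.strong_induction_on with
  | _ Z ih =>
    intro φ α hφ0 hφ
    have hφN : 0 ≤ φ N := hφ0 N le_rfl
    rw [tailSum_eq hN]
    have hb : ∀ a ∈ (Finset.Ioc 0 Z).filter (IsSmooth N), ArithmeticFunction.vonMangoldt a / a *
        (-∑ m ∈ Finset.Ioc (N / a) (min N (Z / a)),
          stepWeight φ a m * Real.cos (2 * Real.pi * (m * (a * α))) / m +
        tailSum N (Z / a) (stepWeight φ a) (a * α)) ≤
        ArithmeticFunction.vonMangoldt a / a * (2 * (φ N / ℓ)) +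
        C * φ N * (ArithmeticFunction.vonMangoldt a / a * (1 / Real.log (a * N))) := by
      intro a ha
      have ha' := Finset.mem_Ioc.1 (Finset.mem_filter.1 ha).1
      rcases Nat.lt_or_ge 1 a with h1 | h1
      · have hlt : ∀ m, N / a < m → N ≤ a * m := fun m hm => by
          have := (Nat.div_lt_iff_lt_mul ha'.1).1 hm
          linarith
        have hge : ∀ m, N ≤ m → N ≤ a * m := fun m hm =>
          hm.trans (Nat.le_mul_of_pos_left _ ha'.1)
        have hI := neg_sum_mul_cos_div_le (ψ := stepWeight φ a) (L := N / a) (B := φ N / ℓ)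
          (fun m hm => stepWeight_nonneg hφ0 (hlt m hm))
          (fun m n hm hmn => stepWeight_anti hN hφ0 hφ (hlt m hm) hmn)
          (fun m hm => stepWeight_le hN hφ0 hφ (hlt m hm)) (a * α) (min N (Z / a))
        have hT := ih (Z / a) (Nat.div_lt_self (by omega) h1) (stepWeight φ a) (a * α)
          (fun m hm => stepWeight_nonneg hφ0 (hge m hm))
          (fun m n hm hmn => stepWeight_anti hN hφ0 hφ (hge m hm) hmn)
        have hs := stepWeight_self_le hφ ha'.1
        have hv := vonMangoldt_div_nonneg a
        have h3 : C * stepWeight φ a N ≤ C * (φ N * (1 / Real.log (a * N))) := by gcongr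
        calc _ ≤ ArithmeticFunction.vonMangoldt a / a *
              (2 * (φ N / ℓ) + C * (φ N * (1 / Real.log (a * N)))) := by
              gcongr; linarith
          _ = _ := by ring
      · have : a = 1 := by omega
        subst this
        simp
    refine (Finset.sum_le_sum hb).trans ?_
    rw [Finset.sum_add_distrib, ← Finset.sum_mul, ← Finset.mul_sum]
    have h1 : (∑ a ∈ (Finset.Ioc 0 Z).filter (IsSmooth N), ArithmeticFunction.vonMangoldt a / (a : ℝ)) *
        (2 * (φ N / ℓ)) ≤ (7 + C₁) * ℓ * (2 * (φ N / ℓ)) := by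
      gcongr
      exact hMN Z
    have h2 : (7 + C₁) * ℓ * (2 * (φ N / ℓ)) = 1 / 10 * (C * φ N) := by
      rw [hC]; field_simp; ring
    have h3 : C * φ N * ∑ a ∈ (Finset.Ioc 0 Z).filter (IsSmooth N),
        ArithmeticFunction.vonMangoldt a / a * (1 / Real.log (a * N)) ≤ C * φ N * (9 / 10) := by
      gcongr
      exact hκN Z
    linarith

theorem exists_tailSum_le_of_norm : ∃ C ℓ₀ : ℝ, 0 ≤ C ∧ ∀ N : ℕ, 2 ≤ N → ℓ₀ ≤ Real.log N →
    Real.log N ^ 6 ≤ N →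
    ∀ (Z : ℕ) (φ : ℕ → ℝ) (α : ℝ), (∀ m, N ≤ m → 0 ≤ φ m) →
      (∀ m n, N ≤ m → m ≤ n → φ n ≤ φ m) → (Real.log N ^ 6)⁻¹ < ‖(α : UnitAddCircle)‖ →
      tailSum N Z φ α ≤ C * (Real.log (Real.log N) / Real.log N) * φ N := by
  obtain ⟨C₁, hC₁0, hC₁⟩ := exists_sum_nearWeight_le
  obtain ⟨C₀, ℓ₂, hC₀0, hC₀⟩ := exists_tailSum_le
  obtain ⟨ℓ₁, hκ⟩ := exists_kappa_le
  refine ⟨10 * (2 + C₀) * C₁, max 2 (max ℓ₁ ℓ₂), by positivity, fun N hN hℓ hN6 Z => ?_⟩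
  set ℓ := Real.log N with hℓdef
  have hℓ1 : 2 ≤ ℓ := (le_max_left _ _).trans hℓ
  have hℓ0 : 0 < ℓ := by linarith
  have hll : 0 ≤ Real.log ℓ := Real.log_nonneg (by linarith)
  have hκN := hκ N hN ((le_max_left _ _).trans ((le_max_right _ _).trans hℓ))
  have hCN := hC₀ N hN ((le_max_right _ _).trans ((le_max_right _ _).trans hℓ))
  set ε := 10 * (2 + C₀) * C₁ * (Real.log ℓ / ℓ) with hε
  have hε0 : 0 ≤ ε := by positivity
  have hN0 : (0 : ℝ) < N := by positivity
  set η := (ℓ ^ 6)⁻¹ with hη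
  have hη0 : 0 < η := by positivity
  induction Z using Nat.strong_induction_on with
  | _ Z ih =>
    intro φ α hφ0 hφ hα
    have hφN : 0 ≤ φ N := hφ0 N le_rfl
    rw [tailSum_eq hN]
    have hb : ∀ a ∈ (Finset.Ioc 0 Z).filter (IsSmooth N), ArithmeticFunction.vonMangoldt a / a *
        (-∑ m ∈ Finset.Ioc (N / a) (min N (Z / a)),
          stepWeight φ a m * Real.cos (2 * Real.pi * (m * (a * α))) / m +
        tailSum N (Z / a) (stepWeight φ a) (a * α)) ≤
        (2 + C₀) * (φ N / ℓ) * (ArithmeticFunction.vonMangoldt a / a * nearWeight N α a) +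
        ε * φ N * (ArithmeticFunction.vonMangoldt a / a * (1 / Real.log (a * N))) := by
      intro a ha
      have ha' := Finset.mem_Ioc.1 (Finset.mem_filter.1 ha).1
      rcases Nat.lt_or_ge 1 a with h1 | h1
      · have hlt : ∀ m, N / a < m → N ≤ a * m := fun m hm => by
          have := (Nat.div_lt_iff_lt_mul ha'.1).1 hm
          linarith
        have hge : ∀ m, N ≤ m → N ≤ a * m := fun m hm =>
          hm.trans (Nat.le_mul_of_pos_left _ ha'.1)
        have ha0 : (0 : ℝ) < a := by exact_mod_cast ha'.1
        have hψ0 := fun m (hm : N / a < m) => stepWeight_nonneg hφ0 (hlt m hm)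
        have hψ := fun m n (hm : N / a < m) (hmn : m ≤ n) =>
          stepWeight_anti hN hφ0 hφ (hlt m hm) hmn
        have hψB := fun m (hm : N / a < m) => stepWeight_le hN hφ0 hφ (hlt m hm)
        have hI := neg_sum_mul_cos_div_le hψ0 hψ hψB (a * α) (min N (Z / a))
        have hs := stepWeight_self_le hφ ha'.1
        have hv := vonMangoldt_div_nonneg a
        have hBnn : 0 ≤ φ N / ℓ := by positivity
        have hlogaN : 0 ≤ 1 / Real.log (a * N) := by
          have := Real.log_natCast_nonneg (a * N)
          push_cast at this
          positivity
        suffices hmain : -∑ m ∈ Finset.Ioc (N / a) (min N (Z / a)),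
            stepWeight φ a m * Real.cos (2 * Real.pi * (m * (a * α))) / m +
            tailSum N (Z / a) (stepWeight φ a) (a * α) ≤
            (2 + C₀) * (φ N / ℓ) * nearWeight N α a + ε * φ N * (1 / Real.log (a * N)) by
          calc _ ≤ ArithmeticFunction.vonMangoldt a / a *
              ((2 + C₀) * (φ N / ℓ) * nearWeight N α a + ε * φ N * (1 / Real.log (a * N))) := by
                gcongr
            _ = _ := by ring
        by_cases hnear : ‖((a * α : ℝ) : UnitAddCircle)‖ ≤ η
        · have hw : nearWeight N α a = 1 := if_pos (Or.inl hnear)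
          have hT := hCN (Z / a) (stepWeight φ a) (a * α)
            (fun m hm => stepWeight_nonneg hφ0 (hge m hm))
            (fun m n hm hmn => stepWeight_anti hN hφ0 hφ (hge m hm) hmn)
          have h3 : C₀ * stepWeight φ a N ≤ C₀ * (φ N / ℓ) := by
            gcongr
            exact stepWeight_le hN hφ0 hφ (hge N le_rfl)
          have h4 : 0 ≤ ε * φ N * (1 / Real.log (a * N)) := by positivity
          rw [hw]
          linarith
        · have hT := ih (Z / a) (Nat.div_lt_self (by omega) h1) (stepWeight φ a) (a * α)
            (fun m hm => stepWeight_nonneg hφ0 (hge m hm))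
            (fun m n hm hmn => stepWeight_anti hN hφ0 hφ (hge m hm) hmn) (not_le.1 hnear)
          have h3 : ε * stepWeight φ a N ≤ ε * (φ N * (1 / Real.log (a * N))) := by gcongr
          by_cases hfar : N * η < a
          · have hw : nearWeight N α a = 1 := if_pos (Or.inr hfar)
            rw [hw]
            have : 0 ≤ C₀ * (φ N / ℓ) := by positivity
            linarith
          · have hw : nearWeight N α a = a / (N * η) :=
              if_neg (by push Not; exact ⟨not_le.1 hnear, not_lt.1 hfar⟩)
            have hI2 := neg_sum_mul_cos_div_le_of_norm hψ0 hψ hψB hη0 (not_le.1 hnear).le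
              (min N (Z / a))
            have h5 : φ N / ℓ / ((((N / a : ℕ) : ℝ) + 1) * η) ≤ φ N / ℓ * (a / (N * η)) := by
              rw [div_eq_mul_one_div]
              refine mul_le_mul_of_nonneg_left ?_ hBnn
              rw [div_le_div_iff₀ (by positivity) (by positivity)]
              have h6 : (N : ℝ) / a < ((N / a : ℕ) : ℝ) + 1 := by
                rw [← Nat.floor_div_eq_div (K := ℝ)]; exact Nat.lt_floor_add_one _
              rw [div_lt_iff₀ ha0] at h6
              calc 1 * (N * η) = N * η := one_mul _
                _ ≤ (((N / a : ℕ) : ℝ) + 1) * a * η := by gcongr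
                _ = _ := by ring
            rw [hw]
            have h7 : 0 ≤ (1 + C₀) * (φ N / ℓ * (a / (N * η))) := by positivity
            linarith
      · have : a = 1 := by omega
        subst this
        simp
    refine (Finset.sum_le_sum hb).trans ?_
    rw [Finset.sum_add_distrib, ← Finset.mul_sum, ← Finset.mul_sum]
    have h1 : (2 + C₀) * (φ N / ℓ) * ∑ a ∈ (Finset.Ioc 0 Z).filter (IsSmooth N),
        ArithmeticFunction.vonMangoldt a / (a : ℝ) * nearWeight N α a ≤
        (2 + C₀) * (φ N / ℓ) * (C₁ * Real.log ℓ) := by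
      gcongr
      exact hC₁ N hℓ1 hN6 α hα Z
    have h2 : (2 + C₀) * (φ N / ℓ) * (C₁ * Real.log ℓ) = 1 / 10 * (ε * φ N) := by
      rw [hε]; field_simp
    have h3 : ε * φ N * ∑ a ∈ (Finset.Ioc 0 Z).filter (IsSmooth N),
        ArithmeticFunction.vonMangoldt a / a * (1 / Real.log (a * N)) ≤ ε * φ N * (9 / 10) := by
      gcongr
      exact hκN Z
    linarith

theorem hasSum_pow_mul_cos_div {r : ℝ} (h0 : 0 ≤ r) (h1 : r < 1) (α : ℝ) :
    HasSum (fun n : ℕ => r ^ n * Real.cos (2 * Real.pi * (n * α)) / n)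
      (-Real.log ‖1 - r * Complex.exp (2 * Real.pi * α * Complex.I)‖) := by
  have hz : ‖(r : ℂ) * Complex.exp (2 * Real.pi * α * Complex.I)‖ < 1 := by
    have : (2 * Real.pi * α * Complex.I : ℂ) = ((2 * Real.pi * α : ℝ) : ℂ) * Complex.I := by
      push_cast; ring
    rw [norm_mul, this, Complex.norm_exp_ofReal_mul_I, mul_one, Complex.norm_real,
      Real.norm_eq_abs, abs_of_nonneg h0]
    exact h1
  have h := Complex.hasSum_re (Complex.hasSum_taylorSeries_neg_log hz)
  rw [Complex.neg_re, Complex.log_re] at h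
  convert h using 2 with n
  have : ((r : ℂ) * Complex.exp (2 * Real.pi * α * Complex.I)) ^ n / n =
      ((r ^ n / n : ℝ) : ℂ) * Complex.exp ((2 * Real.pi * (n * α) : ℝ) * Complex.I) := by
    rw [mul_pow, ← Complex.exp_nat_mul]
    push_cast
    rw [div_mul_eq_mul_div]
    congr 3
    ring
  rw [this, Complex.re_ofReal_mul, Complex.exp_ofReal_mul_I_re, div_mul_eq_mul_div]

theorem neg_sum_cos_div_le_log_two {α δ : ℝ} (hδ : 0 < δ) (h : δ ≤ ‖(α : UnitAddCircle)‖) (N : ℕ) :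
    -∑ n ∈ Finset.Ioc 0 N, Real.cos (2 * Real.pi * (n * α)) / n ≤
      Real.log 2 + 1 / ((N + 1) * (2 * δ)) := by
  have key : ∀ r : ℝ, 0 ≤ r → r < 1 →
      -∑ n ∈ Finset.Ioc 0 N, r ^ n * Real.cos (2 * Real.pi * (n * α)) / n ≤
      Real.log 2 + 1 / ((N + 1) * (2 * δ)) := by
    intro r h0 h1
    have hs := (hasSum_pow_mul_cos_div h0 h1 α).tendsto_sum_nat.comp (Filter.tendsto_add_atTop_nat 1)
    have hlog : Real.log ‖1 - r * Complex.exp (2 * Real.pi * α * Complex.I)‖ ≤ Real.log 2 := by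
      have hle : ‖1 - r * Complex.exp (2 * Real.pi * α * Complex.I)‖ ≤ 2 := by
        refine (norm_sub_le _ _).trans ?_
        have : (2 * Real.pi * α * Complex.I : ℂ) = ((2 * Real.pi * α : ℝ) : ℂ) * Complex.I := by
          push_cast; ring
        rw [norm_mul, this, Complex.norm_exp_ofReal_mul_I, mul_one, Complex.norm_real,
          Real.norm_eq_abs, abs_of_nonneg h0, norm_one]
        linarith
      rcases eq_or_lt_of_le (norm_nonneg (1 - r * Complex.exp (2 * Real.pi * α * Complex.I))) with h | h
      · rw [← h, Real.log_zero]; exact Real.log_nonneg (by norm_num)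
      · exact Real.log_le_log h hle
    have hle := le_of_tendsto (b := ∑ n ∈ Finset.Ioc 0 N, r ^ n * Real.cos (2 * Real.pi * (n * α)) / n
      + 1 / ((N + 1) * (2 * δ))) hs ?_
    · linarith
    · filter_upwards [Filter.eventually_ge_atTop N] with R hR
      have e1 : ∑ n ∈ Finset.range (R + 1), r ^ n * Real.cos (2 * Real.pi * (n * α)) / n =
          ∑ n ∈ Finset.Ioc 0 R, r ^ n * Real.cos (2 * Real.pi * (n * α)) / n := by
        refine (Finset.sum_subset ?_ ?_).symm
        · intro n hn
          rw [Finset.mem_Ioc] at hn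
          exact Finset.mem_range.2 (by omega)
        · intro n hn hn'
          have : n = 0 := by
            simp only [Finset.mem_range, Finset.mem_Ioc, not_and, not_le] at hn hn'
            by_contra h
            have := hn' (by omega)
            omega
          simp [this]
      have e2 := abs_sum_mul_cos_le (f := fun m => r ^ m / m) (L := N) ?_ ?_ hδ h R
      · simp only [Function.comp_apply]
        rw [e1, ← Finset.sum_Ioc_consecutive _ (Nat.zero_le N) hR]
        have e3 : (r ^ (N + 1) / ((N + 1 : ℕ) : ℝ)) / (2 * δ) ≤ 1 / ((N + 1) * (2 * δ)) := by
          rw [div_div]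
          push_cast
          gcongr
          exact pow_le_one₀ h0 h1.le
        have e4 := (abs_le.1 e2).2
        simp only [div_mul_eq_mul_div] at e4 e3
        linarith
      · intro m _; positivity
      · intro m n hm hn
        have : (0 : ℝ) < m := by exact_mod_cast (by omega : 0 < m)
        exact div_le_div₀ (by positivity) (pow_le_pow_of_le_one h0 h1.le hn) this (by exact_mod_cast hn)
  have hc : Filter.Tendsto (fun r : ℝ => -∑ n ∈ Finset.Ioc 0 N, r ^ n * Real.cos (2 * Real.pi * (n * α)) / n)
      (nhdsWithin 1 (Set.Iio 1)) (nhds (-∑ n ∈ Finset.Ioc 0 N, 1 ^ n * Real.cos (2 * Real.pi * (n * α)) / n)) := by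
    refine Filter.Tendsto.mono_left (Continuous.tendsto ?_ 1) nhdsWithin_le_nhds
    fun_prop
  simp only [one_pow, one_mul] at hc
  refine le_of_tendsto hc ?_
  filter_upwards [Ioo_mem_nhdsLT (show (0 : ℝ) < 1 by norm_num)] with r hr
  exact key r hr.1.le hr.2

theorem half_le_cos_of_mul_norm_le {β : ℝ} {m : ℕ} (h : m * ‖(β : UnitAddCircle)‖ ≤ 1 / 6) :
    1 / 2 ≤ Real.cos (2 * Real.pi * (m * β)) := by
  rw [cos_mul_sub_round, ← Real.cos_abs]
  rw [norm_coe_eq] at h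
  have h1 : |2 * Real.pi * (m * (β - round β))| ≤ Real.pi / 3 := by
    rw [abs_mul (2 * Real.pi), abs_mul (m : ℝ), abs_of_pos (by positivity : 0 < 2 * Real.pi), Nat.abs_cast]
    nlinarith [Real.pi_pos]
  rw [← Real.cos_pi_div_three]
  exact Real.cos_le_cos_of_nonneg_of_le_pi (abs_nonneg _) (by linarith [Real.pi_pos]) h1

theorem neg_sum_cos_div_le_of_norm_le {α : ℝ} {K N : ℕ} (hKN : K ≤ N)
    (h : K * ‖(α : UnitAddCircle)‖ ≤ 1 / 6) :
    -∑ n ∈ Finset.Ioc 0 N, Real.cos (2 * Real.pi * (n * α)) / n ≤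
      2 - 1 / 2 * Real.log (K + 1) := by
  rw [← Finset.sum_Ioc_consecutive _ (Nat.zero_le K) hKN]
  have h1 := neg_sum_mul_cos_div_le (ψ := fun _ => 1) (L := K) (B := 1) (fun _ _ => zero_le_one)
    (fun _ _ _ _ => le_rfl) (fun _ _ => le_rfl) α N
  simp only [one_mul] at h1
  have h2 : 1 / 2 * Real.log (K + 1) ≤ ∑ n ∈ Finset.Ioc 0 K, Real.cos (2 * Real.pi * (n * α)) / n := by
    have h3 := log_add_one_le_harmonic K
    have h4 : ((harmonic K : ℚ) : ℝ) = ∑ n ∈ Finset.Ioc 0 K, 1 / (n : ℝ) := by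
      rw [harmonic_eq_sum_Icc]; push_cast
      refine Finset.sum_congr ?_ fun n _ => (one_div _).symm
      ext; simp; omega
    rw [h4] at h3
    push_cast at h3
    refine (mul_le_mul_of_nonneg_left h3 (by norm_num)).trans ?_
    rw [Finset.mul_sum]
    refine Finset.sum_le_sum fun n hn => ?_
    rw [Finset.mem_Ioc] at hn
    have : 1 / 2 ≤ Real.cos (2 * Real.pi * (n * α)) := by
      refine half_le_cos_of_mul_norm_le (le_trans ?_ h)
      have : (n : ℝ) ≤ K := by exact_mod_cast hn.2
      gcongr
    rw [mul_one_div]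
    gcongr
  linarith

theorem exists_neg_sum_smooth_cos_le : ∃ (C : ℝ) (N₀ : ℕ), 0 ≤ C ∧ ∀ N Z : ℕ, N₀ ≤ N → N ≤ Z → ∀ α : ℝ,
    -∑ n ∈ (Finset.Ioc 0 Z).filter (IsSmooth N), Real.cos (2 * Real.pi * (n * α)) / n ≤
      Real.log 2 + C * (Real.log (Real.log N) / Real.log N) := by
  obtain ⟨C₀, ℓ₀, hC₀, H₀⟩ := exists_tailSum_le
  obtain ⟨C₁, ℓ₁, hC₁, H₁⟩ := exists_tailSum_le_of_norm
  have hlogN : Filter.Tendsto (fun N : ℕ => Real.log N) Filter.atTop Filter.atTop :=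
    Real.tendsto_log_atTop.comp tendsto_natCast_atTop_atTop
  have hev : ∀ᶠ N : ℕ in Filter.atTop, 2 ≤ N ∧ ℓ₀ ≤ Real.log N ∧ ℓ₁ ≤ Real.log N ∧
      Real.exp 1 ≤ Real.log N ∧ Real.log N ^ 7 ≤ N ∧ 6 * Real.exp (2 * (2 + C₀)) ≤ Real.log N := by
    have h7 : ∀ᶠ N : ℕ in Filter.atTop, Real.log N ^ 7 ≤ N := by
      have := (isLittleO_pow_log_id_atTop (n := 7)).bound (c := 1) one_pos
      filter_upwards [tendsto_natCast_atTop_atTop.eventually this] with N hN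
      simp only [id, Real.norm_eq_abs, one_mul, Nat.abs_cast] at hN
      exact (le_abs_self _).trans hN
    filter_upwards [Filter.eventually_ge_atTop 2, hlogN.eventually_ge_atTop ℓ₀,
      hlogN.eventually_ge_atTop ℓ₁, hlogN.eventually_ge_atTop (Real.exp 1), h7,
      hlogN.eventually_ge_atTop (6 * Real.exp (2 * (2 + C₀)))] with N h1 h2 h3 h4 h5 h6
    exact ⟨h1, h2, h3, h4, h5, h6⟩
  obtain ⟨N₀, hN₀⟩ := Filter.eventually_atTop.1 hev
  refine ⟨C₁ + 1, N₀, by positivity, fun N Z hN hZ α => ?_⟩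
  obtain ⟨h2, hℓ₀, hℓ₁, hℓe, h7, hℓ6⟩ := hN₀ N hN
  set ℓ := Real.log N with hℓ
  have hℓ1 : 1 ≤ ℓ := (Real.one_le_exp zero_le_one).trans hℓe
  have hll : 1 ≤ Real.log ℓ := by
    rw [Real.le_log_iff_exp_le (by linarith)]; exact hℓe
  have hsplit : -∑ n ∈ (Finset.Ioc 0 Z).filter (IsSmooth N), Real.cos (2 * Real.pi * (n * α)) / n =
      -∑ n ∈ Finset.Ioc 0 N, Real.cos (2 * Real.pi * (n * α)) / n + tailSum N Z (fun _ => 1) α := by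
    have hf : (Finset.Ioc 0 N).filter (IsSmooth N) = Finset.Ioc 0 N := by
      rw [Finset.filter_eq_self]
      intro n hn
      rw [Finset.mem_Ioc] at hn
      exact isSmooth_of_le hn.1 hn.2
    simp only [tailSum, one_mul]
    rw [← neg_add, Finset.sum_filter, ← Finset.sum_Ioc_consecutive _ (Nat.zero_le N) hZ,
      ← Finset.sum_filter, ← Finset.sum_filter, hf]
  rw [hsplit]
  by_cases hα : (ℓ ^ 6)⁻¹ < ‖(α : UnitAddCircle)‖
  · have h6 : ℓ ^ 6 ≤ N := (pow_le_pow_right₀ hℓ1 (by norm_num)).trans h7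
    have t1 := H₁ N h2 hℓ₁ h6 Z (fun _ => 1) α (fun _ _ => zero_le_one) (fun _ _ _ _ => le_rfl) hα
    have t2 := neg_sum_cos_div_le_log_two (by positivity) hα.le N
    have t3 : 1 / ((N + 1) * (2 * (ℓ ^ 6)⁻¹)) ≤ Real.log ℓ / ℓ := by
      have : (1 : ℝ) / ((N + 1) * (2 * (ℓ ^ 6)⁻¹)) ≤ 1 / ℓ := by
        refine one_div_le_one_div_of_le (by linarith) ?_
        rw [← mul_assoc, ← div_eq_mul_inv, le_div_iff₀ (by positivity)]
        nlinarith
      exact this.trans (by gcongr)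
    rw [← hℓ] at t1
    linarith
  · push Not at hα
    have t1 := H₀ N h2 hℓ₀ Z (fun _ => 1) α (fun _ _ => zero_le_one) (fun _ _ _ _ => le_rfl)
    have hK : (⌊ℓ ^ 6 / 6⌋₊ : ℝ) ≤ ℓ ^ 6 / 6 := Nat.floor_le (by positivity)
    have hK' : ℓ ^ 6 / 6 < (⌊ℓ ^ 6 / 6⌋₊ : ℝ) + 1 := Nat.lt_floor_add_one _
    have t2 := neg_sum_cos_div_le_of_norm_le (α := α) (K := ⌊ℓ ^ 6 / 6⌋₊) (N := N) ?_ ?_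
    · have : 2 * (2 + C₀) ≤ Real.log (⌊ℓ ^ 6 / 6⌋₊ + 1) := by
        rw [Real.le_log_iff_exp_le (by positivity)]
        have : ℓ ≤ ℓ ^ 6 := le_self_pow₀ hℓ1 (by norm_num)
        linarith
      have h3 : 0 ≤ (C₁ + 1) * (Real.log ℓ / ℓ) := by positivity
      have h4 : 0 ≤ Real.log 2 := Real.log_nonneg (by norm_num)
      linarith
    · have h6 : ℓ ^ 6 ≤ N := (pow_le_pow_right₀ hℓ1 (by norm_num)).trans h7
      have h8 : 0 ≤ ℓ ^ 6 := by positivity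
      exact_mod_cast (by linarith : (⌊ℓ ^ 6 / 6⌋₊ : ℝ) ≤ N)
    · calc _ ≤ (ℓ ^ 6 / 6) * (ℓ ^ 6)⁻¹ := by gcongr
        _ = 1 / 6 := by field_simp

/-- The Euler-Maclaurin remainder terms for `(s - 1) ζ(s)`. -/
noncomputable def zetaTerm (n : ℕ) (s : ℂ) : ℂ :=
  (s - 1) * ((n + 1 : ℝ) : ℂ) ^ (-s) + ((n + 1 : ℝ) : ℂ) ^ (1 - s) - ((n : ℝ) : ℂ) ^ (1 - s)

theorem norm_cpow_neg_sub_le {a b : ℝ} (ha : 0 < a) (hab : a ≤ b) {s : ℂ} (hs : -1 ≤ s.re) :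
    ‖(b : ℂ) ^ (-s) - (a : ℂ) ^ (-s)‖ ≤ ‖s‖ * a ^ (-s.re - 1) * (b - a) := by
  rcases eq_or_ne s 0 with rfl | hs0
  · simp
  have hd : ∀ x ∈ Set.Icc a b, HasDerivWithinAt (fun x : ℝ => (x : ℂ) ^ (-s))
      (-s * (x : ℂ) ^ (-s - 1)) (Set.Icc a b) x := by
    intro x hx
    have hx0 : x ≠ 0 := (ha.trans_le hx.1).ne'
    exact (hasDerivAt_ofReal_cpow_const hx0 (neg_ne_zero.2 hs0)).hasDerivWithinAt
  have := (convex_Icc a b).norm_image_sub_le_of_norm_hasDerivWithin_le (f := fun x : ℝ => (x : ℂ) ^ (-s))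
    (C := ‖s‖ * a ^ (-s.re - 1)) hd ?_ (Set.left_mem_Icc.2 hab) (Set.right_mem_Icc.2 hab)
  · rwa [Real.norm_eq_abs, abs_of_nonneg (sub_nonneg.2 hab)] at this
  · intro x hx
    have hx0 : 0 < x := ha.trans_le hx.1
    rw [norm_mul, norm_neg, Complex.norm_cpow_eq_rpow_re_of_pos hx0]
    gcongr
    simp only [sub_re, neg_re, one_re]
    exact Real.rpow_le_rpow_of_nonpos ha hx.1 (by linarith)

theorem norm_zetaTerm_le {n : ℕ} (hn : 0 < n) {s : ℂ} (hs : -1 ≤ s.re) :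
    ‖zetaTerm n s‖ ≤ ‖s - 1‖ * ‖s‖ * (n : ℝ) ^ (-s.re - 1) := by
  have hn' : (0 : ℝ) < n := by exact_mod_cast hn
  rcases eq_or_ne s 1 with rfl | hs1
  · simp [zetaTerm]
  have hd : ∀ x ∈ Set.Icc (n : ℝ) (n + 1), HasDerivWithinAt
      (fun x : ℝ => (s - 1) * ((n + 1 : ℝ) : ℂ) ^ (-s) * x + (x : ℂ) ^ (1 - s))
      ((s - 1) * (((n + 1 : ℝ) : ℂ) ^ (-s) - (x : ℂ) ^ (-s))) (Set.Icc (n : ℝ) (n + 1)) x := by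
    intro x hx
    have hx0 : x ≠ 0 := (hn'.trans_le hx.1).ne'
    have h := hasDerivAt_ofReal_cpow_const hx0 (sub_ne_zero.2 hs1.symm)
    have h4 := ((Complex.ofRealCLM.hasDerivAt (x := x)).const_mul
      ((s - 1) * ((n + 1 : ℝ) : ℂ) ^ (-s))).add h
    refine h4.hasDerivWithinAt.congr_deriv ?_
    rw [Complex.ofRealCLM_apply, Complex.ofReal_one, show 1 - s - 1 = -s by ring]
    ring
  have := (convex_Icc (n : ℝ) (n + 1)).norm_image_sub_le_of_norm_hasDerivWithin_le
    (C := ‖s - 1‖ * ‖s‖ * (n : ℝ) ^ (-s.re - 1)) hd ?_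
    (Set.left_mem_Icc.2 (by linarith)) (Set.right_mem_Icc.2 (by linarith))
  · rw [add_sub_cancel_left, norm_one, mul_one] at this
    refine le_trans (le_of_eq (congrArg _ ?_)) this
    unfold zetaTerm
    push_cast; ring
  · intro x hx
    rw [norm_mul, mul_assoc]
    gcongr
    have hx0 : 0 < x := hn'.trans_le hx.1
    refine (norm_cpow_neg_sub_le hx0 hx.2 hs).trans ?_
    have h1 : x ^ (-s.re - 1) ≤ (n : ℝ) ^ (-s.re - 1) :=
      Real.rpow_le_rpow_of_nonpos hn' hx.1 (by linarith)
    have h2 : (n : ℝ) + 1 - x ≤ 1 := by linarith [hx.1]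
    have h3 : 0 ≤ ‖s‖ * x ^ (-s.re - 1) := by positivity
    have h4 : ‖s‖ * x ^ (-s.re - 1) ≤ ‖s‖ * (n : ℝ) ^ (-s.re - 1) := by gcongr
    nlinarith

theorem differentiable_zetaTerm {n : ℕ} (hn : 0 < n) : Differentiable ℂ (zetaTerm n) := by
  have h1 : (((n : ℝ) : ℂ)) ≠ 0 := by simpa using hn.ne'
  have h2 : (((n + 1 : ℝ) : ℂ)) ≠ 0 := by
    have : (n : ℝ) + 1 ≠ 0 := by positivity
    exact_mod_cast this
  intro s
  unfold zetaTerm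
  refine DifferentiableAt.sub (DifferentiableAt.add ?_ ?_) ?_
  · exact DifferentiableAt.mul (by fun_prop) (DifferentiableAt.const_cpow (by fun_prop) (Or.inl h2))
  · exact DifferentiableAt.const_cpow (by fun_prop) (Or.inl h2)
  · exact DifferentiableAt.const_cpow (by fun_prop) (Or.inl h1)

theorem summable_nat_add_rpow {M : ℕ} {a : ℝ} (ha : a < -1) :
    Summable fun n : ℕ => ((n + M : ℕ) : ℝ) ^ a :=
  (summable_nat_add_iff M).2 (Real.summable_nat_rpow.2 ha)

theorem norm_zetaTerm_le_of_mem {R : ℝ} {n : ℕ} (hn : 0 < n) {s : ℂ} (h1 : 1 / 2 < s.re) (h2 : ‖s‖ < R) :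
    ‖zetaTerm n s‖ ≤ (R + 1) * R * (n : ℝ) ^ (-(3 / 2) : ℝ) := by
  refine (norm_zetaTerm_le hn (by linarith)).trans ?_
  have hR : 0 ≤ R := (norm_nonneg _).trans h2.le
  have h3 : ‖s - 1‖ ≤ R + 1 := (norm_sub_le _ _).trans (by simp; linarith)
  gcongr
  · exact_mod_cast hn
  · linarith

theorem summable_zetaTerm {M : ℕ} (hM : 0 < M) {s : ℂ} (h1 : 1 / 2 < s.re) :
    Summable fun n : ℕ => zetaTerm (n + M) s := by
  refine Summable.of_norm_bounded (g := fun n : ℕ => (‖s‖ + 1 + 1) * (‖s‖ + 1) * ((n + M : ℕ) : ℝ) ^ (-(3 / 2) : ℝ))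
    ((summable_nat_add_rpow (by norm_num)).mul_left _) fun n => ?_
  exact norm_zetaTerm_le_of_mem (by omega) h1 (by linarith)

theorem riemannZeta₁_eq_of_one_lt_re {M : ℕ} (hM : 0 < M) {s : ℂ} (hs : 1 < s.re) :
    riemannZeta₁ s = (s - 1) * ∑ n ∈ Finset.range M, ((n + 1 : ℝ) : ℂ) ^ (-s) +
      ((M : ℝ) : ℂ) ^ (1 - s) + ∑' n : ℕ, zetaTerm (n + M) s := by
  have hs1 : s ≠ 1 := by rintro rfl; simp at hs
  have hz : riemannZeta₁ s = (s - 1) * riemannZeta s := by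
    rw [riemannZeta_eq_inv_sub_mul hs1, mul_inv_cancel_left₀ (sub_ne_zero.2 hs1)]
  have hterm : ∀ n : ℕ, (1 : ℂ) / ((n : ℂ) + 1) ^ s = ((n + 1 : ℝ) : ℂ) ^ (-s) := by
    intro n; rw [Complex.cpow_neg]; push_cast; rw [one_div]
  have hsum : HasSum (fun n : ℕ => ((n + 1 : ℝ) : ℂ) ^ (-s)) (riemannZeta s) := by
    rw [zeta_eq_tsum_one_div_nat_add_one_cpow hs]
    simp_rw [hterm]
    refine Summable.hasSum ?_
    have := (summable_nat_add_iff 1).2 (Complex.summable_one_div_nat_cpow.2 hs)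
    refine this.congr fun n => ?_
    rw [← hterm]; push_cast; rfl
  have hpart : ∀ K : ℕ, ∑ n ∈ Finset.range K, zetaTerm (n + M) s =
      (s - 1) * (∑ n ∈ Finset.range (K + M), ((n + 1 : ℝ) : ℂ) ^ (-s) -
        ∑ n ∈ Finset.range M, ((n + 1 : ℝ) : ℂ) ^ (-s)) +
      (((K + M : ℕ) : ℝ) : ℂ) ^ (1 - s) - ((M : ℝ) : ℂ) ^ (1 - s) := by
    intro K
    induction K with
    | zero => simp
    | succ K ih =>
      rw [Finset.sum_range_succ, ih, show K + 1 + M = K + M + 1 by ring, Finset.sum_range_succ, zetaTerm]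
      push_cast
      ring
  have hlim0 : Filter.Tendsto (fun K : ℕ => (((K + M : ℕ) : ℝ) : ℂ) ^ (1 - s)) Filter.atTop (nhds 0) := by
    rw [tendsto_zero_iff_norm_tendsto_zero]
    have h1 : Filter.Tendsto (fun K : ℕ => ((K + M : ℕ) : ℝ) ^ (-(s.re - 1))) Filter.atTop (nhds 0) :=
      (tendsto_rpow_neg_atTop (by linarith)).comp
        (tendsto_natCast_atTop_atTop.comp (Filter.tendsto_add_atTop_nat M))
    refine h1.congr fun K => ?_
    rw [Complex.norm_cpow_eq_rpow_re_of_pos (by exact_mod_cast (by omega : 0 < K + M))]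
    simp
  have hlim := (summable_zetaTerm hM (by linarith : 1 / 2 < s.re)).hasSum.tendsto_sum_nat
  simp_rw [hpart] at hlim
  have hlim' := (((((hsum.tendsto_sum_nat.comp (Filter.tendsto_add_atTop_nat M)).sub_const
    (∑ n ∈ Finset.range M, ((n + 1 : ℝ) : ℂ) ^ (-s))).const_mul (s - 1)).add hlim0).sub_const
    (((M : ℝ) : ℂ) ^ (1 - s)))
  have := tendsto_nhds_unique hlim hlim'
  rw [hz, this]
  ring

theorem riemannZeta₁_eq {M : ℕ} (hM : 0 < M) {s : ℂ} (hs : 1 / 2 < s.re) :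
    riemannZeta₁ s = (s - 1) * ∑ n ∈ Finset.range M, ((n + 1 : ℝ) : ℂ) ^ (-s) +
      ((M : ℝ) : ℂ) ^ (1 - s) + ∑' n : ℕ, zetaTerm (n + M) s := by
  set R : ℝ := ‖s‖ + 3
  set U : Set ℂ := {w | 1 / 2 < w.re} ∩ Metric.ball 0 R
  have hUo : IsOpen U := (isOpen_lt continuous_const Complex.continuous_re).inter Metric.isOpen_ball
  have hUc : IsPreconnected U :=
    ((convex_halfSpace_re_gt _).inter (convex_ball _ _)).isPreconnected
  have hM0 : ((M : ℝ) : ℂ) ≠ 0 := by simpa using hM.ne'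
  have hd : DifferentiableOn ℂ (fun s => (s - 1) * ∑ n ∈ Finset.range M, ((n + 1 : ℝ) : ℂ) ^ (-s) +
      ((M : ℝ) : ℂ) ^ (1 - s) + ∑' n : ℕ, zetaTerm (n + M) s) U := by
    refine DifferentiableOn.add (Differentiable.differentiableOn
      (Differentiable.add (Differentiable.mul (by fun_prop) ?_) ?_)) ?_
    · refine Differentiable.fun_sum fun n _ => ?_
      have h2 : (((n + 1 : ℝ) : ℂ)) ≠ 0 := by
        have : (n : ℝ) + 1 ≠ 0 := by positivity
        exact_mod_cast this
      exact fun s => DifferentiableAt.const_cpow (by fun_prop) (Or.inl h2)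
    · exact fun s => DifferentiableAt.const_cpow (by fun_prop) (Or.inl hM0)
    · refine Complex.differentiableOn_tsum_of_summable_norm
        (u := fun n : ℕ => (R + 1) * R * ((n + M : ℕ) : ℝ) ^ (-(3 / 2) : ℝ))
        ((summable_nat_add_rpow (by norm_num)).mul_left _)
        (fun n => (differentiable_zetaTerm (by omega)).differentiableOn) hUo fun n w hw => ?_
      exact norm_zetaTerm_le_of_mem (by omega) hw.1 (by simpa using hw.2)
  refine AnalyticOnNhd.eqOn_of_preconnected_of_eventuallyEq
    (differentiable_riemannZeta₁.differentiableOn.analyticOnNhd hUo)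
    (hd.analyticOnNhd hUo) hUc (z₀ := 2) ?_ ?_ ?_
  · refine ⟨by norm_num, ?_⟩
    simp only [Metric.mem_ball, dist_zero_right, R]
    norm_num
    linarith [norm_nonneg s]
  · filter_upwards [(isOpen_lt continuous_const Complex.continuous_re).mem_nhds
      (show (1 : ℝ) < (2 : ℂ).re by norm_num)] with w hw
    exact riemannZeta₁_eq_of_one_lt_re hM hw
  · exact ⟨hs, by simp [R]⟩

theorem exists_norm_riemannZeta_le : ∃ C : ℝ, 1 ≤ C ∧ ∀ s : ℂ, 99 / 100 ≤ s.re → s.re ≤ 4 →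
    1 / 2 ≤ |s.im| → ‖riemannZeta s‖ ≤ C * |s.im| ^ (1 / 50 : ℝ) := by
  set S : ℝ := ∑' n : ℕ, (n : ℝ) ^ (-(101 / 100) : ℝ) with hS
  have hsumm : Summable fun n : ℕ => (n : ℝ) ^ (-(101 / 100) : ℝ) :=
    Real.summable_nat_rpow.2 (by norm_num)
  have hS0 : 0 ≤ S := tsum_nonneg fun n => by positivity
  refine ⟨3 * (10 * S + 2), by linarith, fun s h1 h2 h3 => ?_⟩
  set τ := |s.im| with hτ
  have hτ0 : 0 < τ := by linarith
  set M := ⌈τ⌉₊ with hMdef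
  have hM : 0 < M := Nat.ceil_pos.2 hτ0
  have hM' : (0 : ℝ) < M := by exact_mod_cast hM
  have hM1 : (1 : ℝ) ≤ M := by exact_mod_cast hM
  have hMτ : τ ≤ M := Nat.le_ceil _
  have hMτ' : (M : ℝ) ≤ 3 * τ := by linarith [Nat.ceil_lt_add_one hτ0.le]
  have hs1 : s ≠ 1 := by rintro rfl; simp at hτ; linarith
  have hsub : τ ≤ ‖s - 1‖ := by
    have := Complex.abs_im_le_norm (s - 1)
    simpa using this
  have hnorm : ‖s‖ ≤ 9 * τ := by
    have := Complex.norm_le_abs_re_add_abs_im s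
    rw [abs_of_nonneg (by linarith : 0 ≤ s.re)] at this
    linarith
  have b1 : ‖∑ n ∈ Finset.range M, ((n + 1 : ℝ) : ℂ) ^ (-s)‖ ≤ S * (M : ℝ) ^ (1 / 50 : ℝ) := by
    refine (norm_sum_le _ _).trans ?_
    calc _ ≤ ∑ n ∈ Finset.range M, ((n + 1 : ℕ) : ℝ) ^ (-(101 / 100) : ℝ) * (M : ℝ) ^ (1 / 50 : ℝ) := by
          refine Finset.sum_le_sum fun n hn => ?_
          have hn1 : (0 : ℝ) < n + 1 := by positivity
          have hn2 : ((n : ℝ) + 1) ≤ M := by exact_mod_cast Finset.mem_range.1 hn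
          rw [Complex.norm_cpow_eq_rpow_re_of_pos hn1]
          calc ((n : ℝ) + 1) ^ (-s).re ≤ ((n : ℝ) + 1) ^ (-(101 / 100) + 1 / 50 : ℝ) := by
                refine Real.rpow_le_rpow_of_exponent_le (by linarith) ?_
                rw [neg_re]; linarith
            _ = ((n : ℝ) + 1) ^ (-(101 / 100) : ℝ) * ((n : ℝ) + 1) ^ (1 / 50 : ℝ) :=
                Real.rpow_add hn1 _ _
            _ ≤ _ := by push_cast; gcongr
      _ ≤ _ := by
          rw [← Finset.sum_mul]
          gcongr
          have := hsumm.sum_le_tsum ((Finset.range M).map ⟨(· + 1), add_left_injective 1⟩)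
            (fun _ _ => by positivity)
          simpa using this
  have b2 : ‖((M : ℝ) : ℂ) ^ (1 - s)‖ ≤ (M : ℝ) ^ (1 / 50 : ℝ) := by
    rw [Complex.norm_cpow_eq_rpow_re_of_pos hM']
    refine Real.rpow_le_rpow_of_exponent_le hM1 ?_
    simp only [sub_re, one_re]; linarith
  have b3 : ‖∑' n : ℕ, zetaTerm (n + M) s‖ ≤
      ‖s - 1‖ * (9 * S) * (M : ℝ) ^ (1 / 50 : ℝ) := by
    have hb : ∀ n : ℕ, ‖zetaTerm (n + M) s‖ ≤
        ‖s - 1‖ * (9 * (M : ℝ) ^ (1 / 50 : ℝ)) * ((n + M : ℕ) : ℝ) ^ (-(101 / 100) : ℝ) := by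
      intro n
      refine (norm_zetaTerm_le (by omega) (by linarith)).trans ?_
      have hn : (0 : ℝ) < ((n + M : ℕ) : ℝ) := by exact_mod_cast (by omega : 0 < n + M)
      have hn1 : (1 : ℝ) ≤ ((n + M : ℕ) : ℝ) := by exact_mod_cast (by omega : 1 ≤ n + M)
      have hnM : (M : ℝ) ≤ ((n + M : ℕ) : ℝ) := by exact_mod_cast (by omega : M ≤ n + M)
      rw [mul_assoc, mul_assoc]
      refine mul_le_mul_of_nonneg_left ?_ (norm_nonneg _)
      calc ‖s‖ * ((n + M : ℕ) : ℝ) ^ (-s.re - 1)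
          ≤ 9 * M * ((n + M : ℕ) : ℝ) ^ ((1 / 50 - 1) + -(101 / 100) : ℝ) := by
            gcongr
            · linarith
            · linarith
        _ = 9 * M * (((n + M : ℕ) : ℝ) ^ (1 / 50 - 1 : ℝ) * ((n + M : ℕ) : ℝ) ^ (-(101 / 100) : ℝ)) := by
            rw [Real.rpow_add hn]
        _ ≤ 9 * M * ((M : ℝ) ^ (1 / 50 - 1 : ℝ) * ((n + M : ℕ) : ℝ) ^ (-(101 / 100) : ℝ)) := by
            gcongr ?_ * (?_ * _)
            exact Real.rpow_le_rpow_of_nonpos hM' hnM (by norm_num)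
        _ = _ := by
            rw [Real.rpow_sub hM', Real.rpow_one]
            field_simp
    have hsM := (summable_nat_add_rpow (M := M) (a := -(101 / 100)) (by norm_num))
    refine (tsum_of_norm_bounded ((hsM.mul_left _).hasSum) hb).trans ?_
    rw [tsum_mul_left]
    have : ∑' n : ℕ, ((n + M : ℕ) : ℝ) ^ (-(101 / 100) : ℝ) ≤ S := by
      rw [hS, ← hsumm.sum_add_tsum_nat_add M]
      have : 0 ≤ ∑ n ∈ Finset.range M, (n : ℝ) ^ (-(101 / 100) : ℝ) :=
        Finset.sum_nonneg fun _ _ => by positivity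
      linarith
    calc _ ≤ ‖s - 1‖ * (9 * (M : ℝ) ^ (1 / 50 : ℝ)) * S := by gcongr
      _ = _ := by ring
  have hz : ‖riemannZeta s‖ ≤ (10 * S + 2) * (M : ℝ) ^ (1 / 50 : ℝ) := by
    rw [riemannZeta_eq_inv_sub_mul hs1, riemannZeta₁_eq hM (by linarith), norm_mul, norm_inv]
    rw [inv_mul_le_iff₀ (by linarith)]
    have h5 : ‖(s - 1) * ∑ n ∈ Finset.range M, ((n + 1 : ℝ) : ℂ) ^ (-s)‖ ≤
        ‖s - 1‖ * (S * (M : ℝ) ^ (1 / 50 : ℝ)) := by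
      rw [norm_mul]; gcongr
    have h6 : (M : ℝ) ^ (1 / 50 : ℝ) ≤ ‖s - 1‖ * 2 * (M : ℝ) ^ (1 / 50 : ℝ) := by
      have : (0 : ℝ) ≤ (M : ℝ) ^ (1 / 50 : ℝ) := by positivity
      nlinarith
    refine (norm_add_le _ _).trans ?_
    have := norm_add_le ((s - 1) * ∑ n ∈ Finset.range M, ((n + 1 : ℝ) : ℂ) ^ (-s)) (((M : ℝ) : ℂ) ^ (1 - s))
    linarith
  refine hz.trans ?_
  have : (M : ℝ) ^ (1 / 50 : ℝ) ≤ 3 * τ ^ (1 / 50 : ℝ) := by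
    calc (M : ℝ) ^ (1 / 50 : ℝ) ≤ (3 * τ) ^ (1 / 50 : ℝ) := by gcongr
      _ = 3 ^ (1 / 50 : ℝ) * τ ^ (1 / 50 : ℝ) := Real.mul_rpow (by norm_num) hτ0.le
      _ ≤ 3 ^ (1 : ℝ) * τ ^ (1 / 50 : ℝ) := by
        gcongr
        · norm_num
        · norm_num
      _ = _ := by rw [Real.rpow_one]
  calc _ ≤ (10 * S + 2) * (3 * τ ^ (1 / 50 : ℝ)) := by gcongr
    _ = _ := by ring

theorem exists_norm_deriv_riemannZeta_le : ∃ C : ℝ, 1 ≤ C ∧ ∀ s : ℂ, 199 / 200 ≤ s.re → s.re ≤ 3 →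
    3 / 4 ≤ |s.im| → ‖deriv riemannZeta s‖ ≤ C * |s.im| ^ (1 / 50 : ℝ) := by
  obtain ⟨C, hC1, hC⟩ := exists_norm_riemannZeta_le
  refine ⟨400 * C, by linarith, fun s h1 h2 h3 => ?_⟩
  have key : ∀ w ∈ Metric.closedBall s (1 / 200), 99 / 100 ≤ w.re ∧ w.re ≤ 4 ∧ 1 / 2 ≤ |w.im| ∧
      |w.im| ≤ 2 * |s.im| := by
    intro w hw
    rw [mem_closedBall_iff_norm] at hw
    have e1 := (Complex.abs_re_le_norm (w - s)).trans hw
    have e2 := (Complex.abs_im_le_norm (w - s)).trans hw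
    rw [sub_re, abs_le] at e1
    rw [sub_im] at e2
    have e3 := abs_sub_abs_le_abs_sub s.im w.im
    have e4 := abs_sub_abs_le_abs_sub w.im s.im
    rw [abs_sub_comm] at e3
    refine ⟨by linarith, by linarith, by linarith, by linarith⟩
  have hd : DiffContOnCl ℂ riemannZeta (Metric.ball s (1 / 200)) := by
    refine DifferentiableOn.diffContOnCl ?_
    rw [closure_ball _ (by norm_num)]
    intro w hw
    refine (differentiableAt_riemannZeta ?_).differentiableWithinAt
    rintro rfl
    have := (key 1 hw).2.2.1
    norm_num at this
  have := Complex.norm_deriv_le_of_forall_mem_sphere_norm_le (c := s) (R := 1 / 200)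
    (C := 2 * (C * |s.im| ^ (1 / 50 : ℝ))) (by norm_num) hd ?_
  · refine this.trans (le_of_eq ?_)
    ring
  · intro w hw
    obtain ⟨k1, k2, k3, k4⟩ := key w (Metric.sphere_subset_closedBall hw)
    refine (hC w k1 k2 k3).trans ?_
    calc C * |w.im| ^ (1 / 50 : ℝ) ≤ C * (2 * |s.im|) ^ (1 / 50 : ℝ) := by gcongr
      _ = C * (2 ^ (1 / 50 : ℝ) * |s.im| ^ (1 / 50 : ℝ)) := by
        rw [Real.mul_rpow (by norm_num) (abs_nonneg _)]
      _ ≤ C * (2 ^ (1 : ℝ) * |s.im| ^ (1 / 50 : ℝ)) := by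
        gcongr
        · norm_num
        · norm_num
      _ = _ := by rw [Real.rpow_one]; ring

theorem exists_norm_riemannZeta_ofReal_le : ∃ C : ℝ, 1 ≤ C ∧ ∀ x : ℝ, 0 < x → x ≤ 2 →
    ‖riemannZeta (1 + x)‖ ≤ C / x := by
  have hc : ContinuousOn (fun x : ℝ => riemannZeta₁ (1 + x)) (Set.Icc 0 2) := by
    refine Continuous.continuousOn ?_
    exact differentiable_riemannZeta₁.continuous.comp (by fun_prop)
  obtain ⟨C, hC⟩ := isCompact_Icc.exists_bound_of_continuousOn hc
  refine ⟨max 1 C, le_max_left _ _, fun x h0 h2 => ?_⟩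
  have hx : (1 + x : ℂ) ≠ 1 := by
    simpa using h0.ne'
  rw [riemannZeta_eq_inv_sub_mul hx, norm_mul, norm_inv, add_sub_cancel_left, Complex.norm_real,
    Real.norm_eq_abs, abs_of_pos h0, inv_mul_eq_div]
  gcongr
  exact (hC x ⟨h0.le, h2⟩).trans (le_max_right _ _)

theorem one_le_riemannZeta_product {x : ℝ} (hx : 0 < x) (t : ℝ) :
    1 ≤ ‖riemannZeta (1 + x)‖ ^ 3 * ‖riemannZeta (1 + x + t * I)‖ ^ 4 *
      ‖riemannZeta (1 + x + 2 * t * I)‖ := by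
  have := DirichletCharacter.norm_LFunction_product_ge_one (N := 1) 1 hx t
  rw [DirichletCharacter.LFunctionTrivChar, DirichletCharacter.LFunction_modOne_eq,
    DirichletCharacter.LFunction_modOne_eq, norm_mul, norm_mul, norm_pow, norm_pow] at this
  rw [show (2 : ℂ) * t * I = 2 * I * t by ring, mul_comm (t : ℂ) I]
  exact this

theorem exists_le_norm_riemannZeta : ∃ c : ℝ, 0 < c ∧ c ≤ 1 ∧ ∀ σ t : ℝ, 1 < σ → σ ≤ 2 → 1 ≤ |t| →
    c / (|t| ^ (1 / 50 : ℝ)) ^ 4 ≤ ‖riemannZeta (σ + t * I)‖ := by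
  obtain ⟨A, hA1, hA⟩ := exists_norm_riemannZeta_ofReal_le
  obtain ⟨B, hB1, hB⟩ := exists_norm_riemannZeta_le
  obtain ⟨D, hD1, hD⟩ := exists_norm_deriv_riemannZeta_le
  -- the quality of the bound at abscissa `1 + d` is `a * d^(3/4)`
  set a : ℝ := 1 / (2 * A * B) with ha
  have ha0 : 0 < a := by positivity
  have ha1 : a ≤ 1 := by
    rw [ha, div_le_one (by positivity)]; nlinarith
  set l : ℝ := a / (2 * D) with hl
  have hl0 : 0 < l := by positivity
  have hl1 : l ≤ 1 := by
    rw [hl, div_le_one (by positivity)]; linarith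
  refine ⟨a * l ^ 3 / 2, by positivity, ?_, fun σ t h1 h2 ht => ?_⟩
  · have : l ^ 3 ≤ 1 := pow_le_one₀ hl0.le hl1
    nlinarith
  set T := |t| ^ (1 / 50 : ℝ) with hT
  have hT1 : 1 ≤ T := Real.one_le_rpow ht (by norm_num)
  set d := l ^ 4 / T ^ 5 with hd
  have hd0 : 0 < d := by positivity
  have hd1 : d ≤ 1 := by
    rw [hd, div_le_one (by positivity)]
    exact (pow_le_one₀ hl0.le hl1).trans (one_le_pow₀ hT1)
  have key : ∀ x : ℝ, d ≤ x → x ≤ 1 → a * l ^ 3 / T ^ 4 ≤ ‖riemannZeta (1 + x + t * I)‖ := by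
    intro x hdx hx1
    have hx0 : 0 < x := hd0.trans_le hdx
    have p := one_le_riemannZeta_product hx0 t
    have q1 : ‖riemannZeta (1 + x)‖ ≤ A / d := (hA x hx0 (by linarith)).trans (by gcongr)
    have q2 : ‖riemannZeta (1 + x + 2 * t * I)‖ ≤ 2 * B * T := by
      have := hB (1 + x + 2 * t * I) (by simp; linarith) (by simp; linarith)
        (by simp [abs_mul]; linarith)
      refine this.trans ?_
      have e : |((1 + x + 2 * t * I : ℂ)).im| = 2 * |t| := by simp [abs_mul]
      rw [e, Real.mul_rpow (by norm_num) (abs_nonneg _)]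
      have : (2 : ℝ) ^ (1 / 50 : ℝ) ≤ 2 ^ (1 : ℝ) :=
        Real.rpow_le_rpow_of_exponent_le (by norm_num) (by norm_num)
      rw [Real.rpow_one] at this
      calc B * (2 ^ (1 / 50 : ℝ) * |t| ^ (1 / 50 : ℝ)) ≤ B * (2 * |t| ^ (1 / 50 : ℝ)) := by gcongr
        _ = _ := by ring
    set X := ‖riemannZeta (1 + x + t * I)‖
    have p' : 1 ≤ (A / d) ^ 3 * X ^ 4 * (2 * B * T) := by
      refine p.trans ?_
      gcongr
    by_contra hX
    push Not at hX
    have hX4 : X ^ 4 < (a * l ^ 3 / T ^ 4) ^ 4 :=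
      pow_lt_pow_left₀ hX (norm_nonneg _) (by norm_num)
    have : (A / d) ^ 3 * X ^ 4 * (2 * B * T) < (A / d) ^ 3 * (a * l ^ 3 / T ^ 4) ^ 4 * (2 * B * T) := by
      gcongr
    have e : (A / d) ^ 3 * (a * l ^ 3 / T ^ 4) ^ 4 * (2 * B * T) = (A ^ 3 * a ^ 4) * (2 * B) := by
      rw [hd]
      field_simp
    rw [e] at this
    have hAa : A * a * (2 * B) = 1 := by rw [ha]; field_simp
    have hAa1 : A * a ≤ 1 := by
      nlinarith [mul_pos (lt_of_lt_of_le one_pos hA1) ha0]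
    have : A ^ 3 * a ^ 4 * (2 * B) ≤ 1 := by
      calc A ^ 3 * a ^ 4 * (2 * B) = (A * a) ^ 2 * a * (A * a * (2 * B)) := by ring
        _ = (A * a) ^ 2 * a := by rw [hAa, mul_one]
        _ ≤ 1 * 1 := by
          gcongr
          exact pow_le_one₀ (by positivity) hAa1
        _ = 1 := one_mul 1
    linarith
  have hT0 : 0 < T := by linarith
  by_cases hσ : d ≤ σ - 1
  · have := key (σ - 1) hσ (by linarith)
    rw [show (1 : ℂ) + ((σ - 1 : ℝ) : ℂ) = σ by push_cast; ring] at this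
    refine le_trans ?_ this
    gcongr
    linarith [show 0 ≤ a * l ^ 3 by positivity]
  · push Not at hσ
    have hk := key d le_rfl hd1
    have hseg : ‖riemannZeta (1 + d + t * I) - riemannZeta (σ + t * I)‖ ≤ D * T * ‖(1 + d + t * I : ℂ) - (σ + t * I)‖ := by
      have hmem : ∀ w ∈ segment ℝ (σ + t * I : ℂ) (1 + d + t * I), 1 ≤ w.re ∧ w.re ≤ 3 ∧ w.im = t := by
        rintro w ⟨u, v, hu, hv, huv, rfl⟩
        have hu' : u = 1 - v := by linarith
        subst hu'
        refine ⟨?_, ?_, ?_⟩ <;> simp <;> nlinarith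
      refine Convex.norm_image_sub_le_of_norm_deriv_le (s := segment ℝ (σ + t * I : ℂ) (1 + d + t * I))
        ?_ ?_ (convex_segment _ _) (left_mem_segment _ _ _) (right_mem_segment _ _ _)
      · intro w hw
        refine differentiableAt_riemannZeta ?_
        rintro rfl
        have := (hmem 1 hw).2.2
        simp at this
        rw [← this] at ht
        norm_num at ht
      · intro w hw
        obtain ⟨m1, m2, m3⟩ := hmem w hw
        have := hD w (by linarith) m2 (by rw [m3]; linarith)
        rwa [m3] at this
    have hdiff : ‖(1 + d + t * I : ℂ) - (σ + t * I)‖ ≤ d := by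
      rw [show (1 + d + t * I : ℂ) - (σ + t * I) = ((1 + d - σ : ℝ) : ℂ) by push_cast; ring,
        Complex.norm_real, Real.norm_eq_abs, abs_of_nonneg (by linarith)]
      linarith
    have hDT : D * T * d ≤ a * l ^ 3 / 2 / T ^ 4 := by
      have : D * T * d = D * l * l ^ 3 / T ^ 4 := by rw [hd]; field_simp
      rw [this]
      have : D * l = a / 2 := by rw [hl]; field_simp
      rw [this]
      apply le_of_eq; ring
    have h3 := norm_sub_norm_le (riemannZeta (1 + d + t * I)) (riemannZeta (σ + t * I))
    have h4 : D * T * ‖(1 + d + t * I : ℂ) - (σ + t * I)‖ ≤ D * T * d := by gcongr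
    have h5 : a * l ^ 3 / T ^ 4 = a * l ^ 3 / 2 / T ^ 4 + a * l ^ 3 / 2 / T ^ 4 := by ring
    linarith

/-- The regular part of the negative logarithmic derivative of `ζ` at `s = 1`. -/
noncomputable def zetaReg (s : ℂ) : ℂ := -(deriv riemannZeta₁ s / riemannZeta₁ s)

theorem riemannZeta₁_ne_zero {s : ℂ} (h : s = 1 ∨ riemannZeta s ≠ 0) : riemannZeta₁ s ≠ 0 := by
  by_cases hs : s = 1
  · rw [hs, riemannZeta₁_one]; exact one_ne_zero
  · have := h.resolve_left hs
    rw [riemannZeta_eq_inv_sub_mul hs] at this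
    exact right_ne_zero_of_mul this

theorem analyticAt_zetaReg {s : ℂ} (h : s = 1 ∨ riemannZeta s ≠ 0) : AnalyticAt ℂ zetaReg s := by
  have h1 : AnalyticAt ℂ riemannZeta₁ s := differentiable_riemannZeta₁.analyticAt s
  exact (h1.deriv.div h1 (riemannZeta₁_ne_zero h)).neg

theorem zetaReg_eq {s : ℂ} (hs : s ≠ 1) (h : riemannZeta s ≠ 0) :
    zetaReg s = -deriv riemannZeta s / riemannZeta s - (s - 1)⁻¹ := by
  have h1 := riemannZeta₁_ne_zero (Or.inr h)
  have h2 := sub_ne_zero.2 hs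
  rw [zetaReg, deriv_riemannZeta_eq_neg_inv_sub_sq_mul_add hs, riemannZeta_eq_inv_sub_mul hs]
  field_simp
  ring

theorem exists_norm_iteratedDeriv_zetaReg_le : ∃ C : ℝ, 0 ≤ C ∧ ∀ σ t : ℝ, 1 < σ → σ ≤ 2 →
    ‖iteratedDeriv 4 zetaReg (σ + t * I)‖ ≤ C * (1 + |t|) := by
  obtain ⟨c, hc0, hc1, hc⟩ := exists_le_norm_riemannZeta
  obtain ⟨D, hD1, hD⟩ := exists_norm_deriv_riemannZeta_le
  have hcont : ContinuousOn (iteratedDeriv 4 zetaReg) (Set.Icc 1 2 ×ℂ Set.Icc (-1) 1) := by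
    intro s hs
    have h1 : AnalyticAt ℂ zetaReg s := by
      refine analyticAt_zetaReg ?_
      by_cases h : s = 1
      · exact Or.inl h
      · exact Or.inr (riemannZeta_ne_zero_of_one_le_re hs.1.1)
    have h2 := h1.iterated_deriv 4
    rw [← iteratedDeriv_eq_iterate] at h2
    exact h2.continuousAt.continuousWithinAt
  obtain ⟨C₀, hC₀⟩ := (isCompact_Icc.reProdIm isCompact_Icc).exists_bound_of_continuousOn hcont
  set C₁ : ℝ := 24 * (4 * D / c + 2) / (c / (200 * D)) ^ 4 with hC₁
  have hC₁0 : 0 ≤ C₁ := by positivity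
  refine ⟨max C₁ C₀, hC₁0.trans (le_max_left _ _), fun σ t h1 h2 => ?_⟩
  by_cases ht : |t| ≤ 1
  · have : ‖iteratedDeriv 4 zetaReg (σ + t * I)‖ ≤ C₀ := by
      refine hC₀ _ ⟨?_, ?_⟩
      · simpa using ⟨h1.le, h2⟩
      · simpa using abs_le.1 ht
    refine this.trans ((le_max_right C₁ C₀).trans ?_)
    have h3 : 0 ≤ max C₁ C₀ := hC₁0.trans (le_max_left _ _)
    nlinarith [abs_nonneg t]
  push Not at ht
  set T := |t| ^ (1 / 50 : ℝ) with hT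
  have hT1 : 1 ≤ T := Real.one_le_rpow ht.le (by norm_num)
  set r := c / (200 * D) / T ^ 5 with hr
  have hr0 : 0 < r := by positivity
  have hr1 : r ≤ 1 / 200 := by
    have : (1 : ℝ) ≤ T ^ 5 := one_le_pow₀ hT1
    rw [hr, div_div, div_le_div_iff₀ (by positivity) (by norm_num)]
    nlinarith
  set s₀ : ℂ := σ + t * I with hs₀
  have key : ∀ w ∈ Metric.closedBall s₀ r, 199 / 200 ≤ w.re ∧ w.re ≤ 3 ∧ 3 / 4 ≤ |w.im| ∧
      |w.im| ≤ 2 * |t| := by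
    intro w hw
    rw [mem_closedBall_iff_norm] at hw
    have e1 := (Complex.abs_re_le_norm (w - s₀)).trans hw
    have e2 := (Complex.abs_im_le_norm (w - s₀)).trans hw
    have i1 : s₀.re = σ := by simp [hs₀]
    have i2 : s₀.im = t := by simp [hs₀]
    rw [sub_re, abs_le, i1] at e1
    rw [sub_im, i2] at e2
    have e3 := abs_sub_abs_le_abs_sub t w.im
    have e4 := abs_sub_abs_le_abs_sub w.im t
    rw [abs_sub_comm] at e3
    refine ⟨by linarith, by linarith, by linarith, by linarith⟩
  have hne1 : ∀ w ∈ Metric.closedBall s₀ r, w ≠ 1 := by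
    rintro w hw rfl
    have := (key 1 hw).2.2.1
    norm_num at this
  have hder : ∀ w ∈ Metric.closedBall s₀ r, ‖deriv riemannZeta w‖ ≤ 2 * D * T := by
    intro w hw
    obtain ⟨k1, k2, k3, k4⟩ := key w hw
    refine (hD w k1 k2 k3).trans ?_
    calc D * |w.im| ^ (1 / 50 : ℝ) ≤ D * (2 * |t|) ^ (1 / 50 : ℝ) := by gcongr
      _ = D * (2 ^ (1 / 50 : ℝ) * T) := by
        rw [Real.mul_rpow (by norm_num) (abs_nonneg _)]
      _ ≤ D * (2 ^ (1 : ℝ) * T) := by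
        gcongr
        · norm_num
        · norm_num
      _ = _ := by rw [Real.rpow_one]; ring
  have hlow : ∀ w ∈ Metric.closedBall s₀ r, c / 2 / T ^ 4 ≤ ‖riemannZeta w‖ := by
    intro w hw
    have h3 := Convex.norm_image_sub_le_of_norm_deriv_le
      (fun x hx => differentiableAt_riemannZeta (hne1 x hx)) hder (convex_closedBall s₀ r)
      (Metric.mem_closedBall_self hr0.le) hw
    rw [mem_closedBall_iff_norm] at hw
    have h4 : 2 * D * T * ‖w - s₀‖ ≤ c / 2 / T ^ 4 := by
      calc 2 * D * T * ‖w - s₀‖ ≤ 2 * D * T * r := by gcongr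
        _ = c / 100 / T ^ 4 := by rw [hr]; field_simp; norm_num
        _ ≤ _ := by gcongr; norm_num
    have h5 := hc σ t h1 h2 ht.le
    have h6 := norm_sub_norm_le (riemannZeta s₀) (riemannZeta w)
    rw [norm_sub_rev] at h6
    have h7 : c / T ^ 4 = c / 2 / T ^ 4 + c / 2 / T ^ 4 := by ring
    linarith
  have hnz : ∀ w ∈ Metric.closedBall s₀ r, riemannZeta w ≠ 0 := by
    intro w hw h0
    have := hlow w hw
    rw [h0, norm_zero] at this
    have h8 : 0 < c / 2 / T ^ 4 := by positivity
    linarith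
  have hdiff : DiffContOnCl ℂ zetaReg (Metric.ball s₀ r) := by
    refine DifferentiableOn.diffContOnCl ?_
    rw [closure_ball _ hr0.ne']
    intro w hw
    exact (analyticAt_zetaReg (Or.inr (hnz w hw))).differentiableAt.differentiableWithinAt
  have hcauchy := Complex.norm_iteratedDeriv_le_of_forall_mem_sphere_norm_le (c := s₀) (R := r) 4
    (C := (4 * D / c + 2) * T ^ 5) hr0 hdiff ?_
  · refine hcauchy.trans ?_
    have e1 : ((Nat.factorial 4 : ℕ) : ℝ) * ((4 * D / c + 2) * T ^ 5) / r ^ 4 = C₁ * T ^ 25 := by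
      rw [hC₁, hr, show Nat.factorial 4 = 24 by rfl]
      field_simp
      norm_num
    rw [e1]
    have e2 : T ^ 25 ≤ 1 + |t| := by
      rw [hT, ← Real.rpow_natCast, ← Real.rpow_mul (abs_nonneg _)]
      calc |t| ^ ((1 / 50 : ℝ) * (25 : ℕ)) ≤ |t| ^ (1 : ℝ) :=
            Real.rpow_le_rpow_of_exponent_le ht.le (by norm_num)
        _ ≤ _ := by rw [Real.rpow_one]; linarith
    gcongr
    exact le_max_left _ _
  · intro w hw'
    have hw := Metric.sphere_subset_closedBall hw'
    rw [zetaReg_eq (hne1 w hw) (hnz w hw)]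
    refine (norm_sub_le _ _).trans ?_
    rw [norm_div, norm_neg, norm_inv]
    have e1 : ‖deriv riemannZeta w‖ / ‖riemannZeta w‖ ≤ 4 * D / c * T ^ 5 := by
      calc _ ≤ 2 * D * T / (c / 2 / T ^ 4) := by
            gcongr
            · exact hder w hw
            · exact hlow w hw
        _ = _ := by field_simp; norm_num
    have e2 : ‖w - 1‖⁻¹ ≤ 2 * T ^ 5 := by
      have e3 : 3 / 4 ≤ ‖w - 1‖ := by
        have := Complex.abs_im_le_norm (w - 1)
        simp only [sub_im, one_im, sub_zero] at this
        exact (key w hw).2.2.1.trans this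
      have : (1 : ℝ) ≤ T ^ 5 := one_le_pow₀ hT1
      calc ‖w - 1‖⁻¹ ≤ (3 / 4)⁻¹ := by gcongr
        _ ≤ 2 * T ^ 5 := by norm_num; linarith
    linarith

theorem iteratedDeriv_four_inv_sub {s : ℂ} :
    iteratedDeriv 4 (fun z : ℂ => (z - 1)⁻¹) s = 24 / (s - 1) ^ 5 := by
  have := congrFun (iter_deriv_inv_linear_sub (𝕜 := ℂ) 4 1 1) s
  rw [iteratedDeriv_eq_iterate]
  simp only [one_mul] at this
  rw [this]
  simp [Nat.factorial, zpow_neg, div_eq_mul_inv]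
  norm_num

open scoped ArithmeticFunction.vonMangoldt in
theorem hasSum_vonMangoldt_log_pow {s : ℂ} (hs : 1 < s.re) :
    HasSum (fun n : ℕ => ((Λ n * Real.log n ^ 4 : ℝ) : ℂ) / (n : ℂ) ^ s)
      (24 / (s - 1) ^ 5 + iteratedDeriv 4 zetaReg s) := by
  have habs : LSeries.abscissaOfAbsConv (fun n : ℕ => (Λ n : ℂ)) < s.re := by
    refine lt_of_le_of_lt (LSeries.abscissaOfAbsConv_le_of_forall_lt_LSeriesSummable (x := 1) ?_)
      (by exact_mod_cast hs)
    intro y hy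
    exact ArithmeticFunction.LSeriesSummable_vonMangoldt (by simpa using hy)
  have h4 := LSeries_iteratedDeriv 4 habs
  have heq : iteratedDeriv 4 (LSeries (fun n : ℕ => (Λ n : ℂ))) s = 24 / (s - 1) ^ 5 + iteratedDeriv 4 zetaReg s := by
    have hs1 : s ≠ 1 := by rintro rfl; simp at hs
    have hev : LSeries (fun n : ℕ => (Λ n : ℂ)) =ᶠ[nhds s] (fun z : ℂ => (z - 1)⁻¹) + zetaReg := by
      filter_upwards [(isOpen_lt continuous_const Complex.continuous_re).mem_nhds hs] with w hw
      have hw1 : w ≠ 1 := by rintro rfl; simp at hw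
      rw [ArithmeticFunction.LSeries_vonMangoldt_eq_deriv_riemannZeta_div hw, Pi.add_apply,
        zetaReg_eq hw1 (riemannZeta_ne_zero_of_one_lt_re hw)]
      ring
    rw [hev.iteratedDeriv_eq, iteratedDeriv_add, iteratedDeriv_four_inv_sub]
    · refine ContDiffAt.inv (by fun_prop) (sub_ne_zero.2 hs1)
    · exact (analyticAt_zetaReg (Or.inr (riemannZeta_ne_zero_of_one_lt_re hs))).contDiffAt
  rw [heq] at h4
  have hsum : LSeriesSummable (LSeries.logMul^[4] (fun n : ℕ => (Λ n : ℂ))) s :=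
    LSeriesSummable_of_abscissaOfAbsConv_lt_re (by rwa [LSeries.absicssaOfAbsConv_logPowMul])
  have h5 : HasSum (LSeries.term (LSeries.logMul^[4] (fun n : ℕ => (Λ n : ℂ))) s)
      (LSeries (LSeries.logMul^[4] (fun n : ℕ => (Λ n : ℂ))) s) :=
    hsum.LSeriesHasSum
  rw [h4]
  convert h5 using 1
  · funext n
    rcases eq_or_ne n 0 with rfl | hn
    · simp
    · rw [LSeries.term_of_ne_zero hn]
      simp only [Function.iterate_succ, Function.iterate_zero, Function.comp_apply, id, LSeries.logMul]
      push_cast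
      ring
  · norm_num

open FourierTransform SchwartzMap in
theorem exists_bump : ∃ (η : ℝ → ℝ) (F : ℝ → ℂ), (∀ x, 0 ≤ η x) ∧ Continuous η ∧
    (∀ x, x ∉ Set.Ioo (0 : ℝ) 1 → η x = 0) ∧ (∫ x, η x = 1) ∧ Integrable F ∧
    Integrable (fun v => |v| * ‖F v‖) ∧
    ∀ x : ℝ, (η x : ℂ) = ∫ v : ℝ, F v * Complex.exp (2 * π * v * x * I) := by
  let f : ContDiffBump (1 / 2 : ℝ) := ⟨1 / 4, 1 / 2, by norm_num, by norm_num⟩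
  let η : ℝ → ℝ := f.normed volume
  have hη : ContDiff ℝ (⊤ : ℕ∞) (fun x => ((η x : ℝ) : ℂ)) :=
    Complex.ofRealCLM.contDiff.comp (f.contDiff_normed (n := ⊤))
  have hc : HasCompactSupport (fun x => ((η x : ℝ) : ℂ)) :=
    (f.hasCompactSupport_normed (μ := volume)).comp_left (g := ((↑) : ℝ → ℂ)) (by simp)
  let S : 𝓢(ℝ, ℂ) := hc.toSchwartzMap hη
  have hS : ∀ x, S x = η x := fun x => rfl
  refine ⟨η, ⇑(𝓕 S : 𝓢(ℝ, ℂ)), f.nonneg_normed, f.continuous_normed, ?_, f.integral_normed,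
    (𝓕 S : 𝓢(ℝ, ℂ)).integrable, ?_, ?_⟩
  · intro x hx
    have h := f.support_normed_eq (μ := volume)
    have : x ∉ Function.support (f.normed volume) := by
      rw [h, Real.ball_eq_Ioo]
      convert hx using 2
      norm_num
    simpa using this
  · simpa using (𝓕 S : 𝓢(ℝ, ℂ)).integrable_pow_mul volume 1
  · intro x
    have h := S.continuous.fourierInv_fourier_eq S.integrable
      (by rw [← SchwartzMap.fourier_coe]; exact (𝓕 S : 𝓢(ℝ, ℂ)).integrable)
    have h2 := congrFun h x
    rw [Real.fourierInv_eq', hS] at h2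
    rw [← h2]
    refine integral_congr_ae (Filter.Eventually.of_forall fun v => ?_)
    simp only [smul_eq_mul, SchwartzMap.fourier_coe]
    rw [mul_comm]
    congr 2
    simp
    ring

theorem integrable_swap_aux {X : Type*} [MeasurableSpace X] {ν : Measure X} [SFinite ν]
    {F : ℝ → ℂ} (hF : Integrable F) {w : X → ℂ} (hw : Integrable w ν) {L : X → ℝ}
    (hL : Measurable L) (a b : ℝ) :
    Integrable (Function.uncurry fun (x : X) (v : ℝ) =>
      w x * (F v * Complex.exp (2 * π * v * (a * L x + b : ℝ) * I))) (ν.prod volume) := by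
  have h := hw.mul_prod hF
  have hm : Measurable fun p : X × ℝ => Complex.exp (2 * π * p.2 * (a * L p.1 + b : ℝ) * I) := by
    fun_prop
  refine (h.mul_bdd (c := 1) hm.aestronglyMeasurable ?_).congr ?_
  · refine Filter.Eventually.of_forall fun p => ?_
    have : (2 * π * p.2 * (a * L p.1 + b : ℝ) * I : ℂ)
      = ((2 * π * p.2 * (a * L p.1 + b) : ℝ) : ℂ) * I := by push_cast; ring
    rw [this, Complex.norm_exp_ofReal_mul_I]
  · refine Filter.Eventually.of_forall fun p => ?_
    simp only [Function.uncurry]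
    ring

theorem integral_mul_fourier {X : Type*} [MeasurableSpace X] {ν : Measure X} [SFinite ν]
    {F : ℝ → ℂ} (hF : Integrable F) {w : X → ℂ} (hw : Integrable w ν) {L : X → ℝ}
    (hL : Measurable L) (a b : ℝ) :
    Integrable (fun v : ℝ => F v * Complex.exp (2 * π * v * b * I) *
        ∫ x, w x * Complex.exp (2 * π * v * a * L x * I) ∂ν) ∧
    ∫ x, w x * (∫ v, F v * Complex.exp (2 * π * v * (a * L x + b : ℝ) * I)) ∂ν =
      ∫ v : ℝ, F v * Complex.exp (2 * π * v * b * I) *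
        ∫ x, w x * Complex.exp (2 * π * v * a * L x * I) ∂ν := by
  have h := integrable_swap_aux hF hw hL a b
  have key : ∀ v : ℝ, ∫ x, w x * (F v * Complex.exp (2 * π * v * (a * L x + b : ℝ) * I)) ∂ν =
      F v * Complex.exp (2 * π * v * b * I) *
        ∫ x, w x * Complex.exp (2 * π * v * a * L x * I) ∂ν := by
    intro v
    rw [← integral_const_mul]
    congr 1; ext x
    have : (2 * π * v * (a * L x + b : ℝ) * I : ℂ)
      = 2 * π * v * b * I + 2 * π * v * a * L x * I := by push_cast; ring
    rw [this, Complex.exp_add]; ring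
  constructor
  · refine h.integral_prod_right.congr (Filter.Eventually.of_forall fun v => ?_)
    exact key v
  · simp_rw [← key, ← integral_const_mul]
    exact integral_integral_swap h

theorem norm_exp_neg_mul_ofReal (r : ℂ) (x : ℝ) :
    ‖Complex.exp (-(r * x))‖ = Real.exp (-(r.re * x)) := by
  rw [Complex.norm_exp]; simp

theorem tendsto_pow_mul_cexp_neg {r : ℂ} (hr : 0 < r.re) (k : ℕ) :
    Filter.Tendsto (fun x : ℝ => (x : ℂ) ^ k * Complex.exp (-(r * x))) Filter.atTop (nhds 0) := by
  rw [tendsto_zero_iff_norm_tendsto_zero]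
  have h := tendsto_rpow_mul_exp_neg_mul_atTop_nhds_zero (k : ℝ) r.re hr
  refine h.congr' ?_
  filter_upwards [Filter.eventually_ge_atTop 0] with x hx
  rw [norm_mul, norm_exp_neg_mul_ofReal, norm_pow, Complex.norm_real, Real.norm_of_nonneg hx,
    Real.rpow_natCast, neg_mul]

theorem integrableOn_pow_mul_exp_neg {s : ℝ} (hs : 0 < s) (k : ℕ) :
    IntegrableOn (fun x : ℝ => x ^ k * Real.exp (-(s * x))) (Set.Ioi 0) := by
  have h := integrableOn_rpow_mul_exp_neg_mul_rpow (p := 1) (s := k) (b := s)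
    (by have : (0 : ℝ) ≤ k := by positivity
        linarith) one_pos hs
  refine h.congr_fun (fun x hx => ?_) measurableSet_Ioi
  simp

theorem integrableOn_pow_mul_cexp_neg {r : ℂ} (hr : 0 < r.re) (k : ℕ) :
    IntegrableOn (fun x : ℝ => (x : ℂ) ^ k * Complex.exp (-(r * x))) (Set.Ioi 0) := by
  refine (integrableOn_pow_mul_exp_neg hr k).mono' ?_ ?_
  · exact Continuous.aestronglyMeasurable (by fun_prop)
  · filter_upwards [ae_restrict_mem measurableSet_Ioi] with x hx
    rw [norm_mul, norm_exp_neg_mul_ofReal, norm_pow, Complex.norm_real,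
      Real.norm_of_nonneg (le_of_lt hx)]

theorem integral_pow_four_mul_cexp_neg {r : ℂ} (hr : 0 < r.re) :
    ∫ x : ℝ in Set.Ioi 0, (x : ℂ) ^ 4 * Complex.exp (-(r * x)) = 24 / r ^ 5 := by
  have hr0 : r ≠ 0 := by rintro rfl; simp at hr
  let G : ℝ → ℂ := fun x => -(((x : ℂ) ^ 4 * Complex.exp (-(r * x))) * (1 / r)
    + ((x : ℂ) ^ 3 * Complex.exp (-(r * x))) * (4 / r ^ 2)
    + ((x : ℂ) ^ 2 * Complex.exp (-(r * x))) * (12 / r ^ 3)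
    + ((x : ℂ) ^ 1 * Complex.exp (-(r * x))) * (24 / r ^ 4)
    + ((x : ℂ) ^ 0 * Complex.exp (-(r * x))) * (24 / r ^ 5))
  have hG : ∀ x : ℝ, HasDerivAt G ((x : ℂ) ^ 4 * Complex.exp (-(r * x))) x := by
    intro x
    have hid : HasDerivAt (fun x : ℝ => (x : ℂ)) 1 x := Complex.ofRealCLM.hasDerivAt
    have hexp : HasDerivAt (fun x : ℝ => Complex.exp (-(r * x)))
        (Complex.exp (-(r * x)) * (-(r * 1))) x := ((hid.const_mul r).neg).cexp
    have hk : ∀ k : ℕ, HasDerivAt (fun x : ℝ => (x : ℂ) ^ k) (k * (x : ℂ) ^ (k - 1) * 1) x :=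
      fun k => hid.pow k
    have := ((((((hk 4).mul hexp).mul_const (1 / r)).add
      (((hk 3).mul hexp).mul_const (4 / r ^ 2))).add
      (((hk 2).mul hexp).mul_const (12 / r ^ 3))).add
      (((hk 1).mul hexp).mul_const (24 / r ^ 4))).add
      (((hk 0).mul hexp).mul_const (24 / r ^ 5)) |>.neg
    convert! this using 1
    push_cast
    field_simp
    ring
  have hlim : Filter.Tendsto G Filter.atTop (nhds 0) := by
    have h := fun k => tendsto_pow_mul_cexp_neg hr k
    have := (((((h 4).mul_const (1 / r)).add ((h 3).mul_const (4 / r ^ 2))).add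
      ((h 2).mul_const (12 / r ^ 3))).add ((h 1).mul_const (24 / r ^ 4))).add
      ((h 0).mul_const (24 / r ^ 5)) |>.neg
    simpa only [zero_mul, add_zero, neg_zero] using this
  rw [integral_Ioi_of_hasDerivAt_of_tendsto (hG 0).continuousAt.continuousWithinAt
    (fun x _ => hG x) (integrableOn_pow_mul_cexp_neg hr 4) hlim]
  simp [G]

open scoped ArithmeticFunction.vonMangoldt in
theorem vonMangoldt_cpow_mul_exp (σ : ℝ) (t : ℝ) (n : ℕ) :
    ((Λ n * Real.log n ^ 4 : ℝ) : ℂ) / (n : ℂ) ^ (σ : ℂ) * Complex.exp (t * Real.log n * I) =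
      ((Λ n * Real.log n ^ 4 : ℝ) : ℂ) / (n : ℂ) ^ ((σ : ℂ) + (-t : ℝ) * I) := by
  rcases Nat.eq_zero_or_pos n with rfl | hn
  · simp
  have hn' : (n : ℂ) ≠ 0 := by exact_mod_cast hn.ne'
  rw [Complex.cpow_add _ _ hn', Complex.cpow_def_of_ne_zero hn' ((-t : ℝ) * I),
    Complex.natCast_log.symm, div_mul_eq_div_div, div_eq_mul_inv (_ / _) (Complex.exp _),
    ← Complex.exp_neg]
  congr 2
  push_cast; ring

open scoped ArithmeticFunction.vonMangoldt in
theorem exists_abs_smoothed_sub_le {η : ℝ → ℝ} {F : ℝ → ℂ} (hF : Integrable F)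
    (hF1 : Integrable (fun v => |v| * ‖F v‖))
    (hη : ∀ x : ℝ, (η x : ℂ) = ∫ v : ℝ, F v * Complex.exp (2 * π * v * x * I)) :
    ∃ C : ℝ, 0 ≤ C ∧ ∀ s h c : ℝ, 0 < s → s ≤ 1 → 0 < h → h ≤ 1 →
      |∑' n : ℕ, Λ n * Real.log n ^ 4 / (n : ℝ) ^ (1 + s) * η ((Real.log n - c) / h)
        - ∫ x in Set.Ioi 0, x ^ 4 * Real.exp (-(s * x)) * η ((x - c) / h)| ≤ C / h := by
  obtain ⟨C, hC0, hC⟩ := exists_norm_iteratedDeriv_zetaReg_le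
  refine ⟨∫ v, C * (‖F v‖ + 2 * π * (|v| * ‖F v‖)), ?_, ?_⟩
  · exact integral_nonneg fun v => by positivity
  intro s h c hs hs1 hh hh1
  have hσ : (1 : ℝ) < 1 + s := by linarith
  let w : ℕ → ℂ := fun n => ((Λ n * Real.log n ^ 4 : ℝ) : ℂ) / (n : ℂ) ^ ((1 + s : ℝ) : ℂ)
  have hwval : ∀ n, w n = ((Λ n * Real.log n ^ 4 / (n : ℝ) ^ (1 + s) : ℝ) : ℂ) := by
    intro n
    simp only [w]
    rw [Complex.ofReal_div, Complex.ofReal_cpow (Nat.cast_nonneg n)]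
    simp
  have hw : Integrable w Measure.count := by
    rw [integrable_count_iff]
    have := (hasSum_vonMangoldt_log_pow (s := ((1 + s : ℝ) : ℂ)) (by simpa using hσ)).summable
    exact this.norm
  have harg : ∀ x : ℝ, (x - c) / h = h⁻¹ * x + -c / h := fun x => by field_simp; ring
  obtain ⟨hI1, hE1⟩ := integral_mul_fourier hF hw (L := fun n : ℕ => Real.log n)
    (measurable_of_countable _) h⁻¹ (-c / h)
  let w' : ℝ → ℂ := fun x => (x : ℂ) ^ 4 * Complex.exp (-((s : ℂ) * x))
  have hw' : Integrable w' (volume.restrict (Set.Ioi 0)) :=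
    integrableOn_pow_mul_cexp_neg (r := (s : ℂ)) (by simpa using hs) 4
  obtain ⟨hI2, hE2⟩ := integral_mul_fourier hF hw' (L := fun x : ℝ => x) measurable_id h⁻¹ (-c / h)
  have hS1 : ∀ v : ℝ, ∫ n, w n * Complex.exp (2 * π * v * (h⁻¹ : ℝ) * (Real.log n : ℝ) * I)
      ∂Measure.count = 24 / ((s : ℂ) + (-(2 * π * v * h⁻¹) : ℝ) * I) ^ 5 +
        iteratedDeriv 4 zetaReg ((1 + s : ℝ) + (-(2 * π * v * h⁻¹) : ℝ) * I) := by
    intro v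
    have hterm : ∀ n : ℕ, w n * Complex.exp (2 * π * v * (h⁻¹ : ℝ) * (Real.log n : ℝ) * I) =
        ((Λ n * Real.log n ^ 4 : ℝ) : ℂ) /
          (n : ℂ) ^ (((1 + s : ℝ) : ℂ) + (-(2 * π * v * h⁻¹) : ℝ) * I) := by
      intro n
      rw [← vonMangoldt_cpow_mul_exp]
      simp only [w]
      push_cast
      rfl
    have hsum := hasSum_vonMangoldt_log_pow
      (s := ((1 + s : ℝ) : ℂ) + (-(2 * π * v * h⁻¹) : ℝ) * I) (by simp; linarith)
    simp_rw [hterm]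
    rw [integral_countable]
    · simp only [measureReal_def, Measure.count_singleton, ENNReal.toReal_one, one_smul]
      rw [hsum.tsum_eq]
      congr 3
      push_cast; ring
    · rw [integrable_count_iff]; exact hsum.summable.norm
  have hS2 : ∀ v : ℝ, ∫ x in Set.Ioi (0 : ℝ), w' x *
      Complex.exp (2 * π * v * (h⁻¹ : ℝ) * (x : ℝ) * I) =
        24 / ((s : ℂ) + (-(2 * π * v * h⁻¹) : ℝ) * I) ^ 5 := by
    intro v
    rw [← integral_pow_four_mul_cexp_neg (by simpa using hs)]
    congr 1; ext x
    simp only [w']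
    rw [mul_assoc, ← Complex.exp_add]
    congr 2
    push_cast; ring
  have hsumη : ((∑' n : ℕ, Λ n * Real.log n ^ 4 / (n : ℝ) ^ (1 + s) *
      η ((Real.log n - c) / h) : ℝ) : ℂ) =
      ∫ n, w n * (∫ v, F v * Complex.exp (2 * π * v * (h⁻¹ * Real.log n + -c / h : ℝ) * I))
        ∂Measure.count := by
    rw [integral_countable]
    · simp only [measureReal_def, Measure.count_singleton, ENNReal.toReal_one, one_smul]
      rw [Complex.ofReal_tsum]
      congr 1; ext n
      rw [← hη, hwval, harg]
      push_cast; ring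
    · have := (integrable_swap_aux hF hw (L := fun n : ℕ => Real.log n)
        (measurable_of_countable _) h⁻¹ (-c / h)).integral_prod_left
      refine this.congr (Filter.Eventually.of_forall fun n => ?_)
      simp only [Function.uncurry]
      rw [integral_const_mul]
  have hintη : ((∫ x in Set.Ioi 0, x ^ 4 * Real.exp (-(s * x)) * η ((x - c) / h) : ℝ) : ℂ) =
      ∫ x in Set.Ioi (0 : ℝ), w' x *
        (∫ v, F v * Complex.exp (2 * π * v * (h⁻¹ * x + -c / h : ℝ) * I)) := by
    rw [← integral_complex_ofReal]
    congr 1; ext x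
    rw [← hη, harg]
    simp only [w']
    push_cast; ring
  rw [← Real.norm_eq_abs, ← Complex.norm_real, Complex.ofReal_sub, hsumη, hintη, hE1, hE2,
    ← integral_sub hI1 hI2]
  rw [div_eq_inv_mul (∫ v, C * (‖F v‖ + 2 * π * (|v| * ‖F v‖))), ← integral_const_mul]
  refine norm_integral_le_of_norm_le ?_ (Filter.Eventually.of_forall fun v => ?_)
  · exact ((hF.norm.add (hF1.const_mul (2 * π))).const_mul C).const_mul _
  · rw [hS1, hS2, ← mul_sub, add_sub_cancel_left, norm_mul, norm_mul]
    have : (2 * π * v * (-c / h : ℝ) * I : ℂ) = ((2 * π * v * (-c / h) : ℝ) : ℂ) * I := by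
      push_cast; ring
    rw [this, Complex.norm_exp_ofReal_mul_I, mul_one]
    have h1 := hC (1 + s) (-(2 * π * v * h⁻¹)) hσ (by linarith)
    have h2 : 1 + |(-(2 * π * v * h⁻¹))| ≤ h⁻¹ * (1 + 2 * π * |v|) := by
      rw [abs_neg, abs_mul, abs_mul, abs_of_pos (by positivity : (0 : ℝ) < 2 * π),
        abs_of_pos (by positivity : (0 : ℝ) < h⁻¹)]
      have := (one_le_inv₀ hh).2 hh1
      nlinarith
    calc _ ≤ ‖F v‖ * (C * (h⁻¹ * (1 + 2 * π * |v|))) := by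
          refine mul_le_mul_of_nonneg_left (h1.trans ?_) (norm_nonneg _)
          exact mul_le_mul_of_nonneg_left h2 hC0
      _ = _ := by ring

theorem integrable_tsum_of_summable_integral_norm {α : Type*} [MeasurableSpace α] {μ : Measure α}
    [SFinite μ] {F : ℕ → α → ℝ} (hm : ∀ n, Measurable (F n)) (hi : ∀ n, Integrable (F n) μ)
    (hs : Summable fun n => ∫ a, ‖F n a‖ ∂μ) : Integrable (fun a => ∑' n, F n a) μ := by
  have hmeas : Measurable (fun p : α × ℕ => F p.2 p.1) :=
    measurable_from_prod_countable_left fun n => hm n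
  have h : Integrable (fun p : α × ℕ => F p.2 p.1) (μ.prod Measure.count) := by
    rw [integrable_prod_iff' hmeas.aestronglyMeasurable]
    refine ⟨Filter.Eventually.of_forall hi, ?_⟩
    rw [integrable_count_iff]
    exact hs.norm
  refine h.integral_prod_left.congr ?_
  filter_upwards [h.prod_right_ae] with a ha
  rw [integral_countable ha]
  simp [measureReal_def]

theorem integral_bump_shift {η : ℝ → ℝ} (hη1 : ∫ x, η x = 1) {h : ℝ} (hh : 0 < h) (c : ℝ) :
    ∫ x, η ((x - c) / h) = h := by
  rw [integral_sub_right_eq_self (fun x => η (x / h)) c, Measure.integral_comp_div, hη1]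
  simp [abs_of_pos hh]

theorem integral_bump_reflect {η : ℝ → ℝ} (hη1 : ∫ x, η x = 1) {h : ℝ} (hh : 0 < h) (x : ℝ) :
    ∫ c, η ((x - c) / h) = h := by
  rw [integral_sub_left_eq_self (fun x => η (x / h)) volume x, Measure.integral_comp_div, hη1]
  simp [abs_of_pos hh]

theorem integrable_mul_bump {η : ℝ → ℝ} (hηc : Continuous η)
    (hηs : ∀ x, x ∉ Set.Ioo (0 : ℝ) 1 → η x = 0) {g : ℝ → ℝ} (hg : Continuous g)
    {h : ℝ} (hh : 0 < h) (c : ℝ) : Integrable (fun x => g x * η ((x - c) / h)) := by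
  refine Continuous.integrable_of_hasCompactSupport (by fun_prop) ?_
  refine HasCompactSupport.intro (K := Set.Icc c (c + h)) isCompact_Icc fun x hx => ?_
  rw [hηs, mul_zero]
  intro h2
  apply hx
  have h3 := (div_lt_one hh).1 h2.2
  have h4 := (div_pos_iff_of_pos_right hh).1 h2.1
  exact ⟨by linarith, by linarith⟩

theorem integrable_bump_reflect {η : ℝ → ℝ} (hηc : Continuous η)
    (hηs : ∀ x, x ∉ Set.Ioo (0 : ℝ) 1 → η x = 0) {h : ℝ} (hh : 0 < h) (x : ℝ) :
    Integrable (fun c => η ((x - c) / h)) := by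
  refine Continuous.integrable_of_hasCompactSupport (by fun_prop) ?_
  refine HasCompactSupport.intro (K := Set.Icc (x - h) x) isCompact_Icc fun c hx => ?_
  rw [hηs]
  intro h2
  apply hx
  have h3 := (div_lt_one hh).1 h2.2
  have h4 := (div_pos_iff_of_pos_right hh).1 h2.1
  exact ⟨by linarith, by linarith⟩

theorem le_integral_pow_four_mul_bump {η : ℝ → ℝ} (hη0 : ∀ x, 0 ≤ η x) (hηc : Continuous η)
    (hηs : ∀ x, x ∉ Set.Ioo (0 : ℝ) 1 → η x = 0) (hη1 : ∫ x, η x = 1) {s h c : ℝ} (hs : 0 < s)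
    (hh : 0 < h) (hc : 0 < c) :
    h * (c ^ 4 * Real.exp (-(s * (c + h)))) ≤
      ∫ x in Set.Ioi 0, x ^ 4 * Real.exp (-(s * x)) * η ((x - c) / h) := by
  rw [setIntegral_eq_integral_of_forall_compl_eq_zero]
  · rw [← integral_bump_shift hη1 hh c, mul_comm, ← integral_const_mul,
      integral_bump_shift hη1 hh c]
    refine integral_mono ?_ ?_ fun x => ?_
    · exact integrable_mul_bump hηc hηs (continuous_const) hh c
    · exact integrable_mul_bump hηc hηs (by fun_prop) hh c
    · by_cases hx : (x - c) / h ∈ Set.Ioo (0 : ℝ) 1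
      · have h3 := (div_lt_one hh).1 hx.2
        have h4 := (div_pos_iff_of_pos_right hh).1 hx.1
        refine mul_le_mul_of_nonneg_right ?_ (hη0 _)
        gcongr <;> linarith
      · simp [hηs _ hx]
  · intro x hx
    rw [hηs, mul_zero]
    intro h2
    have h4 := (div_pos_iff_of_pos_right hh).1 h2.1
    simp at hx
    linarith

/-- The kernel obtained by averaging the bump against `(c + h)⁻⁵`. -/
theorem integral_kernel_le {η : ℝ → ℝ} (hη0 : ∀ x, 0 ≤ η x) (hηc : Continuous η)
    (hηs : ∀ x, x ∉ Set.Ioo (0 : ℝ) 1 → η x = 0) (hη1 : ∫ x, η x = 1) {h u : ℝ}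
    (hh : 0 < h) (hu : 0 < u) (x : ℝ) :
    IntegrableOn (fun c => ((c + h) ^ 5)⁻¹ * h⁻¹ * η ((x - c) / h)) (Set.Ioi u) ∧
    ∫ c in Set.Ioi u, ((c + h) ^ 5)⁻¹ * h⁻¹ * η ((x - c) / h) ≤
      if u < x then (x ^ 5)⁻¹ else 0 := by
  have hle : ∀ c ∈ Set.Ioi u, ((c + h) ^ 5)⁻¹ * h⁻¹ * η ((x - c) / h) ≤
      (if u < x then (x ^ 5)⁻¹ else 0) * h⁻¹ * η ((x - c) / h) := by
    intro c hc
    have hc' : u < c := hc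
    by_cases hx : (x - c) / h ∈ Set.Ioo (0 : ℝ) 1
    · have h3 := (div_lt_one hh).1 hx.2
      have h4 := (div_pos_iff_of_pos_right hh).1 hx.1
      refine mul_le_mul_of_nonneg_right ?_ (hη0 _)
      rw [if_pos (by linarith)]
      have : 0 < x := by linarith
      gcongr
      linarith
    · simp [hηs _ hx]
  have hintg := (integrable_bump_reflect hηc hηs hh x).const_mul
    ((if u < x then (x ^ 5)⁻¹ else 0) * h⁻¹)
  have hI : IntegrableOn (fun c => ((c + h) ^ 5)⁻¹ * h⁻¹ * η ((x - c) / h)) (Set.Ioi u) := by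
    refine hintg.integrableOn.mono' ?_ ?_
    · exact Measurable.aestronglyMeasurable (by fun_prop)
    · filter_upwards [ae_restrict_mem measurableSet_Ioi] with c hc
      have hc' : u < c := hc
      have : 0 < c + h := by linarith
      rw [Real.norm_of_nonneg (mul_nonneg (by positivity) (hη0 _))]
      exact hle c hc
  refine ⟨hI, ?_⟩
  have hnn : 0 ≤ (if u < x then (x ^ 5)⁻¹ else 0) := by
    split_ifs with hx
    · have : 0 < x := by linarith
      positivity
    · exact le_rfl
  calc _ ≤ ∫ c in Set.Ioi u, (if u < x then (x ^ 5)⁻¹ else 0) * h⁻¹ * η ((x - c) / h) :=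
        setIntegral_mono_on hI hintg.integrableOn measurableSet_Ioi hle
    _ ≤ ∫ c, (if u < x then (x ^ 5)⁻¹ else 0) * h⁻¹ * η ((x - c) / h) :=
        setIntegral_le_integral hintg
          (Filter.Eventually.of_forall fun c => mul_nonneg (mul_nonneg hnn (by positivity)) (hη0 _))
    _ = _ := by
        rw [integral_const_mul, integral_bump_reflect hη1 hh]
        field_simp

open scoped ArithmeticFunction.vonMangoldt in
theorem summable_vonMangoldt_log_pow {s : ℝ} (hs : 0 < s) :
    Summable fun n : ℕ => Λ n * Real.log n ^ 4 / (n : ℝ) ^ (1 + s) := by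
  have h := (hasSum_vonMangoldt_log_pow (s := ((1 + s : ℝ) : ℂ)) (by simpa using hs)).summable.norm
  refine h.congr fun n => ?_
  rw [norm_div, Complex.norm_real, ← Complex.ofReal_natCast,
    ← Complex.ofReal_cpow (Nat.cast_nonneg n), Complex.norm_real, Real.norm_of_nonneg,
    Real.norm_of_nonneg]
  · positivity
  · exact mul_nonneg ArithmeticFunction.vonMangoldt_nonneg
      (pow_nonneg (Real.log_natCast_nonneg n) 4)

theorem exp_div_sub_le {s h c u : ℝ} (hs : 0 < s) (hh : 0 < h) (hu : 0 < u) (hc : u < c) :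
    Real.exp (-(s * c)) / c - 5 * h * (c ^ 2)⁻¹ - s * h / u * Real.exp (-(s * c)) ≤
      ((c + h) ^ 5)⁻¹ * (c ^ 4 * Real.exp (-(s * (c + h)))) := by
  have hc0 : 0 < c := by linarith
  set A := (c / (c + h)) ^ 5 with hA
  set B := Real.exp (-(s * h)) with hB
  set E := Real.exp (-(s * c)) with hE
  have hE0 : 0 < E := Real.exp_pos _
  have hE1 : E ≤ 1 := Real.exp_le_one_iff.2 (by nlinarith)
  have hB1 : B ≤ 1 := Real.exp_le_one_iff.2 (by nlinarith)
  have hB2 : 1 - s * h ≤ B := by have := Real.add_one_le_exp (-(s * h)); linarith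
  have hr : c / (c + h) ≤ 1 := (div_le_one (by linarith)).2 (by linarith)
  have hA1 : A ≤ 1 := pow_le_one₀ (by positivity) hr
  have hA2 : 1 - 5 * (h / c) ≤ A := by
    have h1 := one_add_mul_le_pow (a := c / (c + h) - 1)
      (by have : 0 ≤ c / (c + h) := by positivity
          linarith) 5
    have h2 : c / (c + h) - 1 = - (h / (c + h)) := by field_simp; ring
    have h3 : h / (c + h) ≤ h / c := by gcongr; linarith
    rw [add_sub_cancel, h2] at h1
    push_cast at h1
    linarith
  have hAB : 1 - 5 * (h / c) - s * h ≤ A * B := by nlinarith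
  have hrhs : ((c + h) ^ 5)⁻¹ * (c ^ 4 * Real.exp (-(s * (c + h)))) = E / c * (A * B) := by
    rw [show -(s * (c + h)) = -(s * c) + -(s * h) by ring, Real.exp_add, ← hB, ← hE, hA, div_pow]
    field_simp
  rw [hrhs]
  have h4 : E / c * (1 - 5 * (h / c) - s * h) ≤ E / c * (A * B) :=
    mul_le_mul_of_nonneg_left hAB (by positivity)
  have h5 : E * (5 * h * (c ^ 2)⁻¹) ≤ 1 * (5 * h * (c ^ 2)⁻¹) := by gcongr
  have h6 : s * h / c * E ≤ s * h / u * E := by gcongr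
  have h7 : E / c * (1 - 5 * (h / c) - s * h) = E / c - E * (5 * h * (c ^ 2)⁻¹) - s * h / c * E := by
    field_simp
  linarith

theorem integrableOn_exp_div {s u : ℝ} (hs : 0 < s) (hu : 0 < u) :
    IntegrableOn (fun c => Real.exp (-(s * c)) / c) (Set.Ioi u) := by
  have h := (integrableOn_exp_mul_Ioi (a := -s) (by linarith) u).const_mul u⁻¹
  refine Integrable.mono' h (Measurable.aestronglyMeasurable (by fun_prop)) ?_
  filter_upwards [ae_restrict_mem measurableSet_Ioi] with c hc
  have hc' : u < c := hc
  have : 0 < c := by linarith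
  rw [Real.norm_of_nonneg (by positivity), div_eq_inv_mul, neg_mul]
  gcongr

theorem integrableOn_inv_sq {u : ℝ} (hu : 0 < u) :
    IntegrableOn (fun c : ℝ => (c ^ 2)⁻¹) (Set.Ioi u) ∧ ∫ c in Set.Ioi u, (c ^ 2)⁻¹ = u⁻¹ := by
  have he : Set.EqOn (fun c : ℝ => c ^ (-2 : ℝ)) (fun c : ℝ => (c ^ 2)⁻¹) (Set.Ioi u) := by
    intro c hc
    have hc' : u < c := hc
    simp only
    rw [Real.rpow_neg (by linarith)]
    norm_cast
  constructor
  · exact (integrableOn_Ioi_rpow_of_lt (by norm_num) hu).congr_fun he measurableSet_Ioi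
  · rw [← setIntegral_congr_fun measurableSet_Ioi he, integral_Ioi_rpow_of_lt (by norm_num) hu]
    norm_num
    rw [Real.rpow_neg_one]

open scoped ArithmeticFunction.vonMangoldt in
theorem exists_le_tail_sum : ∃ C : ℝ, 0 ≤ C ∧ ∀ s u : ℝ, 0 < s → s ≤ 1 → 1 ≤ u →
    (∫ c in Set.Ioi u, Real.exp (-(s * c)) / c) - C / u ^ 2 ≤
      ∑' n : ℕ, if u < Real.log n then Λ n / ((n : ℝ) ^ (1 + s) * Real.log n) else 0 := by
  obtain ⟨η, F, hη0, hηc, hηs, hη1, hF, hF1, hηF⟩ := exists_bump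
  obtain ⟨C, hC0, hC⟩ := exists_abs_smoothed_sub_le hF hF1 hηF
  refine ⟨6 + C, by linarith, fun s u hs hs1 hu => ?_⟩
  have hu0 : 0 < u := by linarith
  set h := u⁻¹ with hh_def
  have hh : 0 < h := inv_pos.2 hu0
  have hh1 : h ≤ 1 := inv_le_one_of_one_le₀ hu
  let a : ℕ → ℝ := fun n => Λ n * Real.log n ^ 4 / (n : ℝ) ^ (1 + s)
  have ha0 : ∀ n, 0 ≤ a n := fun n => div_nonneg (mul_nonneg ArithmeticFunction.vonMangoldt_nonneg
      (pow_nonneg (Real.log_natCast_nonneg n) 4)) (by positivity)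
  have hasum : Summable a := summable_vonMangoldt_log_pow hs
  let G : ℕ → ℝ → ℝ := fun n c =>
    a n * (((c + h) ^ 5)⁻¹ * h⁻¹ * η ((Real.log n - c) / h))
  have hGm : ∀ n, Measurable (G n) := fun n => by fun_prop
  have hK := fun n : ℕ => integral_kernel_le hη0 hηc hηs hη1 hh hu0 (Real.log n)
  have hGi : ∀ n, Integrable (G n) (volume.restrict (Set.Ioi u)) := fun n =>
    (hK n).1.const_mul (a n)
  have hGnorm : ∀ n, ∫ c in Set.Ioi u, ‖G n c‖ = ∫ c in Set.Ioi u, G n c := by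
    intro n
    refine setIntegral_congr_fun measurableSet_Ioi fun c hc => ?_
    have hc' : u < c := hc
    have : 0 < c + h := by linarith
    exact Real.norm_of_nonneg (mul_nonneg (ha0 n) (mul_nonneg (by positivity) (hη0 _)))
  have hGint0 : ∀ n, 0 ≤ ∫ c in Set.Ioi u, G n c := fun n => by
    rw [← hGnorm]; exact integral_nonneg fun c => norm_nonneg _
  have hGle : ∀ n : ℕ, ∫ c in Set.Ioi u, G n c ≤
      if u < Real.log n then Λ n / ((n : ℝ) ^ (1 + s) * Real.log n) else 0 := by
    intro n
    have h1 : ∫ c in Set.Ioi u, G n c ≤ a n * (if u < Real.log n then (Real.log n ^ 5)⁻¹ else 0) := by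
      simp only [G]
      rw [integral_const_mul]
      exact mul_le_mul_of_nonneg_left (hK n).2 (ha0 n)
    refine h1.trans (le_of_eq ?_)
    split_ifs with hn
    · have : 0 < Real.log n := by linarith
      simp only [a]
      field_simp
    · simp
  have htail : ∀ n : ℕ, (if u < Real.log n then Λ n / ((n : ℝ) ^ (1 + s) * Real.log n) else 0) ≤
      a n := by
    intro n
    split_ifs with hn
    · have hl : 1 < Real.log n := by linarith
      simp only [a]
      rw [div_mul_eq_div_div, mul_div_right_comm]
      have h0 : 0 ≤ Λ n / (n : ℝ) ^ (1 + s) :=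
        div_nonneg ArithmeticFunction.vonMangoldt_nonneg (by positivity)
      calc _ ≤ Λ n / (n : ℝ) ^ (1 + s) := div_le_self h0 hl.le
        _ ≤ _ := le_mul_of_one_le_right h0 (one_le_pow₀ hl.le)
    · exact ha0 n
  have htail0 : ∀ n : ℕ,
      0 ≤ (if u < Real.log n then Λ n / ((n : ℝ) ^ (1 + s) * Real.log n) else 0) := by
    intro n
    exact (hGint0 n).trans (hGle n)
  have hTs : Summable fun n : ℕ =>
      if u < Real.log n then Λ n / ((n : ℝ) ^ (1 + s) * Real.log n) else 0 :=
    Summable.of_nonneg_of_le htail0 htail hasum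
  have hGs : Summable fun n => ∫ c in Set.Ioi u, ‖G n c‖ := by
    simp_rw [hGnorm]
    exact Summable.of_nonneg_of_le hGint0 hGle hTs
  have hsum := hasSum_integral_of_summable_integral_norm hGi hGs
  have hintg := integrable_tsum_of_summable_integral_norm hGm hGi hGs
  have hle : ∫ c in Set.Ioi u, ∑' n, G n c ≤
      ∑' n : ℕ, if u < Real.log n then Λ n / ((n : ℝ) ^ (1 + s) * Real.log n) else 0 := by
    rw [← hsum.tsum_eq]
    exact Summable.tsum_le_tsum hGle hsum.summable hTs
  refine le_trans ?_ hle
  obtain ⟨hsqI, hsqE⟩ := integrableOn_inv_sq hu0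
  have hexpI := integrableOn_exp_mul_Ioi (a := -s) (by linarith) u
  have hexpE := integral_exp_mul_Ioi (a := -s) (by linarith) u
  have hEI := integrableOn_exp_div hs hu0
  have hlow : ∀ c ∈ Set.Ioi u, Real.exp (-(s * c)) / c - (5 + C) / u * (c ^ 2)⁻¹
      - s / u ^ 2 * Real.exp (-s * c) ≤ ∑' n, G n c := by
    intro c hc
    have hc' : u < c := hc
    have hc0 : 0 < c := by linarith
    have h1 := (abs_le.1 (hC s h c hs hs1 hh hh1)).1
    have h2 := le_integral_pow_four_mul_bump hη0 hηc hηs hη1 hs hh hc0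
    have h3 := exp_div_sub_le hs hh hu0 hc'
    have h4 : ∑' n, G n c = ((c + h) ^ 5)⁻¹ * h⁻¹ *
        ∑' n : ℕ, Λ n * Real.log n ^ 4 / (n : ℝ) ^ (1 + s) * η ((Real.log n - c) / h) := by
      rw [← tsum_mul_left]
      congr 1; ext n
      simp only [G, a]; ring
    rw [h4]
    have h5 : ((c + h) ^ 5)⁻¹ * h⁻¹ * (h * (c ^ 4 * Real.exp (-(s * (c + h)))) - C / h) ≤
        ((c + h) ^ 5)⁻¹ * h⁻¹ *
        ∑' n : ℕ, Λ n * Real.log n ^ 4 / (n : ℝ) ^ (1 + s) * η ((Real.log n - c) / h) := by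
      refine mul_le_mul_of_nonneg_left (by linarith) (by positivity)
    refine le_trans ?_ h5
    have h6 : ((c + h) ^ 5)⁻¹ * h⁻¹ * (h * (c ^ 4 * Real.exp (-(s * (c + h)))) - C / h) =
        ((c + h) ^ 5)⁻¹ * (c ^ 4 * Real.exp (-(s * (c + h)))) - C * u ^ 2 * ((c + h) ^ 5)⁻¹ := by
      rw [hh_def]; field_simp
    have h7 : ((c + h) ^ 5)⁻¹ ≤ (u ^ 3)⁻¹ * (c ^ 2)⁻¹ := by
      rw [← mul_inv]
      refine inv_anti₀ (by positivity) ?_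
      calc u ^ 3 * c ^ 2 ≤ c ^ 3 * c ^ 2 := by gcongr
        _ = c ^ 5 := by ring
        _ ≤ _ := by gcongr; linarith
    have h8 : C * u ^ 2 * ((c + h) ^ 5)⁻¹ ≤ C / u * (c ^ 2)⁻¹ := by
      calc _ ≤ C * u ^ 2 * ((u ^ 3)⁻¹ * (c ^ 2)⁻¹) := by gcongr
        _ = _ := by field_simp
    rw [h6]
    have h9 : s * h / u = s / u ^ 2 := by rw [hh_def]; field_simp
    rw [h9] at h3
    rw [neg_mul]
    have h10 : (5 + C) / u * (c ^ 2)⁻¹ = 5 * h * (c ^ 2)⁻¹ + C / u * (c ^ 2)⁻¹ := by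
      rw [hh_def]; ring
    rw [h10]
    linarith
  have hI12 : Integrable (fun c => Real.exp (-(s * c)) / c - (5 + C) / u * (c ^ 2)⁻¹)
      (volume.restrict (Set.Ioi u)) := hEI.sub (hsqI.const_mul ((5 + C) / u))
  have hmono := setIntegral_mono_on (hI12.sub
    (hexpI.const_mul (s / u ^ 2))) hintg measurableSet_Ioi hlow
  refine le_trans ?_ hmono
  have hval : ∫ c in Set.Ioi u, (Real.exp (-(s * c)) / c - (5 + C) / u * (c ^ 2)⁻¹
      - s / u ^ 2 * Real.exp (-s * c)) = (∫ c in Set.Ioi u, Real.exp (-(s * c)) / c)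
      - (5 + C) / u * u⁻¹ - s / u ^ 2 * (-Real.exp (-s * u) / -s) := by
    rw [integral_sub hI12 (hexpI.const_mul (s / u ^ 2)),
      integral_sub hEI (hsqI.const_mul ((5 + C) / u)), integral_const_mul, integral_const_mul,
      hsqE, hexpE]
  refine le_trans ?_ hval.ge
  have h1 : s / u ^ 2 * (-Real.exp (-s * u) / -s) ≤ 1 / u ^ 2 := by
    have : Real.exp (-s * u) ≤ 1 := Real.exp_le_one_iff.2 (by nlinarith)
    calc _ = Real.exp (-s * u) / u ^ 2 := by field_simp
      _ ≤ _ := by gcongr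
  have h2 : (6 + C) / u ^ 2 = (5 + C) / u * u⁻¹ + 1 / u ^ 2 := by field_simp; ring
  linarith

theorem integral_log_mul_exp_neg :
    ∫ x : ℝ in Set.Ioi 0, Real.log x * Real.exp (-x) = -Real.eulerMascheroniConstant := by
  have h1 := Complex.hasDerivAt_GammaIntegral (s := 1) (by simp)
  have h2 : HasDerivAt Complex.Gamma
      (∫ t : ℝ in Set.Ioi 0, (t : ℂ) ^ ((1 : ℂ) - 1) * (Real.log t * Real.exp (-t))) 1 := by
    refine h1.congr_of_eventuallyEq ?_
    have : IsOpen {s : ℂ | 0 < s.re} := isOpen_lt continuous_const Complex.continuous_re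
    filter_upwards [this.mem_nhds (by simp : (0 : ℝ) < (1 : ℂ).re)] with a ha
    exact Complex.Gamma_eq_integral ha
  have h3 := h2.unique Complex.hasDerivAt_Gamma_one
  simp only [sub_self, Complex.cpow_zero, one_mul] at h3
  have h4 : ∫ t : ℝ in Set.Ioi 0, ((Real.log t * Real.exp (-t) : ℝ) : ℂ) =
      ((-Real.eulerMascheroniConstant : ℝ) : ℂ) := by
    push_cast at h3 ⊢
    exact h3
  rw [integral_complex_ofReal] at h4
  exact_mod_cast h4

theorem integrableOn_log_mul_exp_neg :
    IntegrableOn (fun x : ℝ => Real.log x * Real.exp (-x)) (Set.Ioi 0) := by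
  by_contra h
  have h1 := integral_undef h
  rw [integral_log_mul_exp_neg] at h1
  linarith [Real.one_half_lt_eulerMascheroniConstant]

theorem le_integral_exp_neg_div {z : ℝ} (hz : 0 < z) (hz1 : z ≤ 1) :
    -Real.log z + z * Real.log z - Real.eulerMascheroniConstant ≤
      ∫ x in Set.Ioi z, Real.exp (-x) / x := by
  have hI := integrableOn_log_mul_exp_neg.mono_set (Set.Ioi_subset_Ioi hz.le)
  have hE : IntegrableOn (fun c => Real.exp (-c) / c) (Set.Ioi z) := by
    simpa using integrableOn_exp_div one_pos hz
  have hder : ∀ x ∈ Set.Ici z, HasDerivAt (fun x => Real.log x * Real.exp (-x))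
      (Real.exp (-x) / x - Real.log x * Real.exp (-x)) x := by
    intro x hx
    have hx0 : 0 < x := lt_of_lt_of_le hz hx
    convert! (Real.hasDerivAt_log hx0.ne').mul ((hasDerivAt_id x).neg.exp) using 1
    simp
    ring
  have hlim : Filter.Tendsto (fun x => Real.log x * Real.exp (-x)) Filter.atTop (nhds 0) := by
    have h1 := Real.tendsto_pow_mul_exp_neg_atTop_nhds_zero 1
    refine tendsto_of_tendsto_of_tendsto_of_le_of_le' tendsto_const_nhds h1 ?_ ?_
    · filter_upwards [Filter.eventually_ge_atTop 1] with x hx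
      exact mul_nonneg (Real.log_nonneg hx) (Real.exp_pos _).le
    · filter_upwards [Filter.eventually_ge_atTop 1] with x hx
      rw [pow_one]
      have := Real.log_le_sub_one_of_pos (by linarith : 0 < x)
      exact mul_le_mul_of_nonneg_right (by linarith) (Real.exp_pos _).le
  have hF := integral_Ioi_of_hasDerivAt_of_tendsto' hder (hE.sub hI) hlim
  have hF' : (∫ x in Set.Ioi z, Real.exp (-x) / x) -
      ∫ x in Set.Ioi z, Real.log x * Real.exp (-x) = 0 - Real.log z * Real.exp (-z) := by
    rw [← hF, ← integral_sub hE hI]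
  have hsplit : ∫ x in Set.Ioi (0 : ℝ), Real.log x * Real.exp (-x) =
      (∫ x in Set.Ioc 0 z, Real.log x * Real.exp (-x)) +
        ∫ x in Set.Ioi z, Real.log x * Real.exp (-x) := by
    rw [← setIntegral_union Set.Ioc_disjoint_Ioi_same measurableSet_Ioi
      (integrableOn_log_mul_exp_neg.mono_set Set.Ioc_subset_Ioi_self) hI,
      Set.Ioc_union_Ioi_eq_Ioi hz.le]
  have hneg : ∫ x in Set.Ioc 0 z, Real.log x * Real.exp (-x) ≤ 0 := by
    refine setIntegral_nonpos measurableSet_Ioc fun x hx => ?_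
    exact mul_nonpos_of_nonpos_of_nonneg (Real.log_nonpos hx.1.le (hx.2.trans hz1))
      (Real.exp_pos _).le
  rw [integral_log_mul_exp_neg] at hsplit
  have hlz := Real.log_nonpos hz.le hz1
  have hez := Real.add_one_le_exp (-z)
  nlinarith

theorem le_integral_exp_neg_mul_div {s u : ℝ} (hs : 0 < s) (hu : 0 < u) (hsu : s * u ≤ 1) :
    -Real.log (s * u) + s * u * Real.log (s * u) - Real.eulerMascheroniConstant ≤
      ∫ c in Set.Ioi u, Real.exp (-(s * c)) / c := by
  refine (le_integral_exp_neg_div (mul_pos hs hu) hsu).trans (le_of_eq ?_)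
  rw [← integral_comp_mul_left_Ioi' (fun x => Real.exp (-x) / x) u hs, smul_eq_mul,
    ← integral_const_mul]
  refine setIntegral_congr_fun measurableSet_Ioi fun c hc => ?_
  have hc' : u < c := hc
  have : 0 < c := by linarith
  field_simp

open scoped ArithmeticFunction.vonMangoldt in
theorem summable_vonMangoldt_div_log {s : ℝ} (hs : 0 < s) :
    Summable fun n : ℕ => Λ n / ((n : ℝ) ^ (1 + s) * Real.log n) := by
  have h := Real.summable_one_div_nat_rpow.2 (by linarith : 1 < 1 + s)
  refine Summable.of_nonneg_of_le (fun n => ?_) (fun n => ?_) h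
  · exact div_nonneg ArithmeticFunction.vonMangoldt_nonneg
      (mul_nonneg (by positivity) (Real.log_natCast_nonneg n))
  · have h1 : Λ n / Real.log n ≤ 1 :=
      div_le_one_of_le₀ ArithmeticFunction.vonMangoldt_le_log (Real.log_natCast_nonneg n)
    calc _ = 1 / (n : ℝ) ^ (1 + s) * (Λ n / Real.log n) := by
          rw [div_mul_div_comm, one_mul]
      _ ≤ _ := mul_le_of_le_one_right (by positivity) h1

open scoped ArithmeticFunction.vonMangoldt in
theorem exists_sum_vonMangoldt_div_log_le : ∃ C : ℝ, 0 ≤ C ∧ ∀ N : ℕ, 3 ≤ N →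
    ∑ n ∈ Finset.range (N + 1), Λ n / (n * Real.log n) ≤
      Real.log (Real.log N) + Real.eulerMascheroniConstant + C / Real.log N ^ 2 := by
  obtain ⟨C, hC0, hC⟩ := exists_le_tail_sum
  refine ⟨C, hC0, fun N hN => ?_⟩
  have hN' : (3 : ℝ) ≤ N := by exact_mod_cast hN
  set u := Real.log N with hu_def
  have hu : 1 ≤ u := by
    rw [Real.le_log_iff_exp_le (by linarith)]
    linarith [Real.exp_one_lt_d9]
  have hu0 : 0 < u := by linarith
  let R : ℝ → ℝ := fun s => (Real.log (riemannZeta ((1 + s : ℝ) : ℂ)).re + Real.log s)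
    - s * u * Real.log (s * u) + (Real.log u + Real.eulerMascheroniConstant + C / u ^ 2)
  have key : ∀ s : ℝ, 0 < s → s ≤ u⁻¹ →
      ∑ n ∈ Finset.range (N + 1), Λ n / ((n : ℝ) ^ (1 + s) * Real.log n) ≤ R s := by
    intro s hs hsu
    have hs1 : s ≤ 1 := hsu.trans (inv_le_one_of_one_le₀ hu)
    have hsu' : s * u ≤ 1 := by
      calc s * u ≤ u⁻¹ * u := by gcongr
        _ = 1 := inv_mul_cancel₀ hu0.ne'
    have h1 := hC s u hs hs1 hu
    have h2 := le_integral_exp_neg_mul_div hs hu0 hsu'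
    have h3 := log_riemannZeta_eq (s := 1 + s) (by linarith)
    have hsm := summable_vonMangoldt_div_log hs
    have h4 := hsm.sum_add_tsum_compl (s := Finset.range (N + 1))
    have h5 : ∑' n : ℕ, (if u < Real.log n then Λ n / ((n : ℝ) ^ (1 + s) * Real.log n) else 0) =
        ∑' n : ((Finset.range (N + 1) : Set ℕ)ᶜ : Set ℕ),
          Λ n / (((n : ℕ) : ℝ) ^ (1 + s) * Real.log n) := by
      rw [tsum_subtype ((Finset.range (N + 1) : Set ℕ)ᶜ)
        (fun n : ℕ => Λ n / ((n : ℝ) ^ (1 + s) * Real.log n))]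
      congr 1; ext n
      simp only [Set.indicator]
      congr 1
      simp only [Finset.coe_range, Set.mem_compl_iff, Set.mem_Iio, not_lt, eq_iff_iff]
      constructor
      · intro h
        by_contra hn
        push Not at hn
        rcases Nat.eq_zero_or_pos n with rfl | hn0
        · simp at h; linarith
        have : Real.log n ≤ u := Real.log_le_log (by exact_mod_cast hn0)
          (by exact_mod_cast Nat.lt_succ_iff.1 hn)
        linarith
      · intro h
        exact Real.log_lt_log (by linarith) (by exact_mod_cast h)
    rw [h5] at h1
    rw [← h3] at h4
    simp only [R]
    have h6 := Real.log_mul hs.ne' hu0.ne'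
    linarith
  have hlim1 : Filter.Tendsto (fun s : ℝ =>
      ∑ n ∈ Finset.range (N + 1), Λ n / ((n : ℝ) ^ (1 + s) * Real.log n))
      (nhdsWithin 0 (Set.Ioi 0)) (nhds (∑ n ∈ Finset.range (N + 1), Λ n / (n * Real.log n))) := by
    refine tendsto_finsetSum _ fun n _ => ?_
    by_cases hl : Real.log n = 0
    · simp [hl]
    have hn : (n : ℝ) ≠ 0 := fun h => hl (by rw [h]; simp)
    have hcont : ContinuousAt (fun s : ℝ => Λ n / ((n : ℝ) ^ (1 + s) * Real.log n)) 0 := by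
      refine continuousAt_const.div ?_ (by simp [hl, hn])
      refine ContinuousAt.mul ?_ continuousAt_const
      exact (Real.continuousAt_const_rpow hn).comp (by fun_prop)
    have := hcont.tendsto.mono_left (nhdsWithin_le_nhds (s := Set.Ioi (0 : ℝ)))
    simpa using this
  have hlim2 : Filter.Tendsto R (nhdsWithin 0 (Set.Ioi 0))
      (nhds (0 - 0 + (Real.log u + Real.eulerMascheroniConstant + C / u ^ 2))) := by
    refine Filter.Tendsto.add (Filter.Tendsto.sub ?_ ?_) tendsto_const_nhds
    · have h := (Asymptotics.isLittleO_one_iff ℝ).1 log_riemannZeta_add_log_sub_isLittleO_ofReal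
      have hshift : Filter.Tendsto (fun s : ℝ => 1 + s) (nhdsWithin 0 (Set.Ioi 0))
          (nhdsWithin 1 (Set.Ioi 1)) := by
        refine tendsto_nhdsWithin_iff.2 ⟨?_, ?_⟩
        · have : Filter.Tendsto (fun s : ℝ => 1 + s) (nhds 0) (nhds (1 + 0)) :=
            (continuous_const.add continuous_id).tendsto 0
          rw [add_zero] at this
          exact this.mono_left nhdsWithin_le_nhds
        · filter_upwards [self_mem_nhdsWithin] with s hs
          have : (0 : ℝ) < s := hs
          simp [this]
      have h2 := h.comp hshift
      refine h2.congr fun s => ?_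
      simp
    · have hc : ContinuousAt (fun s : ℝ => s * u * Real.log (s * u)) 0 :=
        (Real.continuous_mul_log.comp (continuous_id.mul continuous_const)).continuousAt
      have := hc.tendsto.mono_left (nhdsWithin_le_nhds (s := Set.Ioi (0 : ℝ)))
      simpa using this
  have hfin := le_of_tendsto_of_tendsto hlim1 hlim2 (by
    filter_upwards [Ioc_mem_nhdsGT (inv_pos.2 hu0)] with s hs
    exact key s hs.1 hs.2)
  simpa using hfin

open scoped ArithmeticFunction.vonMangoldt in
theorem sum_prime_powers_le_sum_vonMangoldt (N : ℕ) :
    ∑ p ∈ (N + 1).primesBelow, ∑ i ∈ Finset.range (Nat.log p N), (p : ℝ)⁻¹ ^ (i + 1) / (i + 1) ≤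
      ∑ n ∈ Finset.range (N + 1), Λ n / (n * Real.log n) := by
  let S : Finset (Σ _ : ℕ, ℕ) := (N + 1).primesBelow.sigma fun p => Finset.range (Nat.log p N)
  have hS : ∀ x ∈ S, x.1.Prime ∧ x.2 < Nat.log x.1 N := by
    intro x hx
    simp only [S, Finset.mem_sigma, Finset.mem_range] at hx
    exact ⟨Nat.prime_of_mem_primesBelow hx.1, hx.2⟩
  have hinj : Set.InjOn (fun x : (Σ _ : ℕ, ℕ) => x.1 ^ (x.2 + 1)) S := by
    rintro ⟨p, i⟩ hx ⟨q, j⟩ hy hxy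
    have hp := (hS _ hx).1
    have hq := (hS _ hy).1
    simp only at hxy hp hq
    have h1 : p = q := by
      rw [← hp.pow_minFac (k := i + 1) (by omega), hxy, hq.pow_minFac (by omega)]
    subst h1
    have h2 := Nat.pow_right_injective hp.two_le hxy
    have h3 : i = j := by omega
    rw [h3]
  have hsub : S.image (fun x : (Σ _ : ℕ, ℕ) => x.1 ^ (x.2 + 1)) ⊆ Finset.range (N + 1) := by
    intro n hn
    obtain ⟨⟨p, i⟩, hx, rfl⟩ := Finset.mem_image.1 hn
    obtain ⟨hp, hi⟩ := hS _ hx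
    simp only at hp hi
    rw [Finset.mem_range, Nat.lt_succ_iff]
    have hN : N ≠ 0 := by rintro rfl; simp at hi
    exact (Nat.pow_le_pow_right hp.pos hi).trans (Nat.pow_log_le_self p hN)
  calc _ = ∑ x ∈ S, (x.1 : ℝ)⁻¹ ^ (x.2 + 1) / (x.2 + 1) := by rw [Finset.sum_sigma]
    _ = ∑ x ∈ S, (fun n : ℕ => Λ n / (n * Real.log n)) (x.1 ^ (x.2 + 1)) := by
        refine Finset.sum_congr rfl fun x hx => ?_
        have hp := (hS _ hx).1
        have hl : Real.log x.1 ≠ 0 := (Real.log_pos (by exact_mod_cast hp.one_lt)).ne'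
        have hp0 : (x.1 : ℝ) ≠ 0 := by exact_mod_cast hp.ne_zero
        simp only
        rw [ArithmeticFunction.vonMangoldt_apply_pow (by omega),
          ArithmeticFunction.vonMangoldt_apply_prime hp]
        push_cast
        rw [Real.log_pow, inv_pow]
        push_cast
        have : (x.2 : ℝ) + 1 ≠ 0 := by positivity
        field_simp
    _ = ∑ n ∈ S.image (fun x : (Σ _ : ℕ, ℕ) => x.1 ^ (x.2 + 1)), Λ n / (n * Real.log n) :=
        (Finset.sum_image (f := fun n : ℕ => Λ n / (n * Real.log n)) hinj).symm
    _ ≤ _ := by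
        refine Finset.sum_le_sum_of_subset_of_nonneg hsub fun n _ _ => ?_
        exact div_nonneg ArithmeticFunction.vonMangoldt_nonneg
          (mul_nonneg (by positivity) (Real.log_natCast_nonneg n))

theorem inv_pow_succ_log_le {p N : ℕ} (hp : p.Prime) (hpN : p ≤ N) :
    (p : ℝ)⁻¹ ^ (Nat.log p N + 1) ≤ (N : ℝ) ^ (-(1 / 4) : ℝ) * (1 / (p : ℝ) ^ (3 / 2 : ℝ)) := by
  have hp0 : (0 : ℝ) < p := by exact_mod_cast hp.pos
  have hN0 : (0 : ℝ) < N := lt_of_lt_of_le hp0 (by exact_mod_cast hpN)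
  set P : ℝ := (p : ℝ) ^ (Nat.log p N + 1) with hP
  have hP0 : 0 < P := by positivity
  have h1 : (N : ℝ) ≤ P := by
    rw [hP]; exact_mod_cast (Nat.lt_pow_succ_log_self hp.one_lt N).le
  have h2 : (p : ℝ) ^ (2 : ℕ) ≤ P := by
    rw [hP]
    refine pow_le_pow_right₀ (by exact_mod_cast hp.one_le) ?_
    have := Nat.log_pos hp.one_lt hpN
    omega
  have h3 : (N : ℝ) ^ (1 / 4 : ℝ) ≤ P ^ (1 / 4 : ℝ) := Real.rpow_le_rpow hN0.le h1 (by norm_num)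
  have h4 : (p : ℝ) ^ (3 / 2 : ℝ) ≤ P ^ (3 / 4 : ℝ) := by
    calc (p : ℝ) ^ (3 / 2 : ℝ) = ((p : ℝ) ^ (2 : ℕ)) ^ (3 / 4 : ℝ) := by
          rw [← Real.rpow_natCast, ← Real.rpow_mul hp0.le]; norm_num
      _ ≤ _ := Real.rpow_le_rpow (by positivity) h2 (by norm_num)
  have h5 : (N : ℝ) ^ (1 / 4 : ℝ) * (p : ℝ) ^ (3 / 2 : ℝ) ≤ P := by
    calc _ ≤ P ^ (1 / 4 : ℝ) * P ^ (3 / 4 : ℝ) := by gcongr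
      _ = P := by rw [← Real.rpow_add hP0]; norm_num
  rw [inv_pow, Real.rpow_neg hN0.le, one_div ((p : ℝ) ^ (3 / 2 : ℝ)), ← mul_inv]
  exact inv_anti₀ (by positivity) h5

theorem neg_log_one_sub_inv_le {p N : ℕ} (hp : p.Prime) (hpN : p ≤ N) :
    -Real.log (1 - (p : ℝ)⁻¹) ≤
      (∑ i ∈ Finset.range (Nat.log p N), (p : ℝ)⁻¹ ^ (i + 1) / (i + 1)) +
        2 * ((N : ℝ) ^ (-(1 / 4) : ℝ) * (1 / (p : ℝ) ^ (3 / 2 : ℝ))) := by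
  have hp2 : (2 : ℝ) ≤ p := by exact_mod_cast hp.two_le
  have hx0 : 0 < (p : ℝ)⁻¹ := by positivity
  have hx : (p : ℝ)⁻¹ ≤ 1 / 2 := by
    rw [one_div]; exact inv_anti₀ two_pos hp2
  have h1 := Real.abs_log_sub_add_sum_range_le (x := (p : ℝ)⁻¹)
    (by rw [abs_of_pos hx0]; linarith) (Nat.log p N)
  rw [abs_of_pos hx0] at h1
  have h2 := (abs_le.1 h1).1
  have h3 : (p : ℝ)⁻¹ ^ (Nat.log p N + 1) / (1 - (p : ℝ)⁻¹) ≤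
      2 * (p : ℝ)⁻¹ ^ (Nat.log p N + 1) := by
    rw [div_le_iff₀ (by linarith)]
    have : 0 < (p : ℝ)⁻¹ ^ (Nat.log p N + 1) := by positivity
    nlinarith
  have h4 := inv_pow_succ_log_le hp hpN
  linarith

theorem exists_prod_primesBelow_le : ∃ C : ℝ, 0 ≤ C ∧ ∀ N : ℕ, 3 ≤ N →
    ∏ p ∈ (N + 1).primesBelow, (1 - (p : ℝ)⁻¹)⁻¹ ≤
      Real.exp Real.eulerMascheroniConstant * Real.log N + C / Real.log N := by
  obtain ⟨C, hC0, hC⟩ := exists_sum_vonMangoldt_div_log_le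
  have hsum := Real.summable_one_div_nat_rpow.2 (by norm_num : (1 : ℝ) < 3 / 2)
  set D := ∑' n : ℕ, 1 / (n : ℝ) ^ (3 / 2 : ℝ) with hD
  have hD0 : 0 ≤ D := tsum_nonneg fun n => by positivity
  set B := C + 128 * D with hB
  have hB0 : 0 ≤ B := by positivity
  refine ⟨Real.exp Real.eulerMascheroniConstant * (B * Real.exp B), by positivity, fun N hN => ?_⟩
  have hN' : (3 : ℝ) ≤ N := by exact_mod_cast hN
  set u := Real.log N with hu_def
  have hu : 1 ≤ u := by
    rw [Real.le_log_iff_exp_le (by linarith)]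
    linarith [Real.exp_one_lt_d9]
  have hu0 : 0 < u := by linarith
  have hfac : ∀ p ∈ (N + 1).primesBelow, 0 < 1 - (p : ℝ)⁻¹ := by
    intro p hp
    have hp1 : (1 : ℝ) < p := by exact_mod_cast (Nat.prime_of_mem_primesBelow hp).one_lt
    have := inv_lt_one_of_one_lt₀ hp1
    linarith
  have hlog : Real.log (∏ p ∈ (N + 1).primesBelow, (1 - (p : ℝ)⁻¹)⁻¹) ≤
      Real.log u + Real.eulerMascheroniConstant + B / u ^ 2 := by
    rw [Real.log_prod (fun p hp => (inv_pos.2 (hfac p hp)).ne')]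
    have h1 : ∑ p ∈ (N + 1).primesBelow, Real.log (1 - (p : ℝ)⁻¹)⁻¹ ≤
        ∑ p ∈ (N + 1).primesBelow,
          ((∑ i ∈ Finset.range (Nat.log p N), (p : ℝ)⁻¹ ^ (i + 1) / (i + 1)) +
          2 * ((N : ℝ) ^ (-(1 / 4) : ℝ) * (1 / (p : ℝ) ^ (3 / 2 : ℝ)))) := by
      refine Finset.sum_le_sum fun p hp => ?_
      rw [Real.log_inv]
      exact neg_log_one_sub_inv_le (Nat.prime_of_mem_primesBelow hp)
        (Nat.lt_succ_iff.1 (Nat.lt_of_mem_primesBelow hp))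
    rw [Finset.sum_add_distrib, ← Finset.mul_sum, ← Finset.mul_sum] at h1
    have h2 := sum_prime_powers_le_sum_vonMangoldt N
    have h3 := hC N hN
    have h4 : ∑ p ∈ (N + 1).primesBelow, 1 / (p : ℝ) ^ (3 / 2 : ℝ) ≤ D :=
      hsum.sum_le_tsum _ fun n _ => by positivity
    have h5 : (N : ℝ) ^ (-(1 / 4) : ℝ) ≤ 64 / u ^ 2 := by
      have h6 := Real.log_le_rpow_div (x := N) (ε := 1 / 8) (by positivity) (by norm_num)
      rw [← hu_def] at h6
      have h7 : u ^ 2 ≤ 64 * (N : ℝ) ^ (1 / 4 : ℝ) := by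
        calc u ^ 2 ≤ ((N : ℝ) ^ (1 / 8 : ℝ) / (1 / 8)) ^ 2 := by gcongr
          _ = 64 * ((N : ℝ) ^ (1 / 8 : ℝ)) ^ 2 := by ring
          _ = _ := by
            rw [← Real.rpow_natCast, ← Real.rpow_mul (by positivity)]; norm_num
      rw [Real.rpow_neg (by positivity), le_div_iff₀ (by positivity), inv_mul_le_iff₀ (by positivity)]
      linarith
    have h6 : 2 * ((N : ℝ) ^ (-(1 / 4) : ℝ) *
        ∑ p ∈ (N + 1).primesBelow, 1 / (p : ℝ) ^ (3 / 2 : ℝ)) ≤ 2 * (64 / u ^ 2 * D) := by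
      gcongr
    have h7 : B / u ^ 2 = C / u ^ 2 + 2 * (64 / u ^ 2 * D) := by rw [hB]; ring
    linarith
  have hprod : 0 < ∏ p ∈ (N + 1).primesBelow, (1 - (p : ℝ)⁻¹)⁻¹ :=
    Finset.prod_pos fun p hp => inv_pos.2 (hfac p hp)
  rw [← Real.exp_log hprod]
  refine (Real.exp_le_exp.2 hlog).trans ?_
  rw [Real.exp_add, Real.exp_add, Real.exp_log hu0]
  set t := B / u ^ 2 with ht
  have ht0 : 0 ≤ t := by positivity
  have htB : t ≤ B := div_le_self hB0 (one_le_pow₀ hu)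
  have het : Real.exp t ≤ 1 + t * Real.exp B := by
    have h1 := Real.add_one_le_exp (-t)
    have h2 : Real.exp (-t) * Real.exp t = 1 := by rw [← Real.exp_add]; simp
    have h3 : Real.exp t ≤ Real.exp B := Real.exp_le_exp.2 htB
    have h4 : 0 < Real.exp t := Real.exp_pos t
    nlinarith
  calc u * Real.exp Real.eulerMascheroniConstant * Real.exp t ≤
      u * Real.exp Real.eulerMascheroniConstant * (1 + t * Real.exp B) := by gcongr
    _ = _ := by rw [ht]; field_simp

/-- Finite sums of reciprocals of smooth numbers are bounded by the Euler product. -/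
theorem sum_smooth_inv_le_prod (N : ℕ) (s : Finset ℕ)
    (hs : ∀ n ∈ s, n ∈ (N + 1).smoothNumbers) :
    ∑ n ∈ s, 1 / (n : ℝ) ≤ ∏ p ∈ (N + 1).primesBelow, (1 - (p : ℝ)⁻¹)⁻¹ := by
  let f : ℕ →* ℝ := ⟨⟨fun n => (n : ℝ)⁻¹, by simp⟩, fun a b => by simp [mul_comm]⟩
  have hf : ∀ {p : ℕ}, p.Prime → ‖f p‖ < 1 := by
    intro p hp
    change ‖(p : ℝ)⁻¹‖ < 1
    rw [norm_inv, Real.norm_natCast]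
    exact inv_lt_one_of_one_lt₀ (by exact_mod_cast hp.one_lt)
  have h := (EulerProduct.summable_and_hasSum_smoothNumbers_prod_primesBelow_geometric hf (N + 1)).2
  have h2 := sum_le_hasSum (s.subtype (· ∈ (N + 1).smoothNumbers))
    (fun n _ => (by change (0 : ℝ) ≤ ((n : ℕ) : ℝ)⁻¹; positivity)) h
  refine le_trans (le_of_eq ?_) h2
  rw [Finset.sum_subtype_of_mem (fun n => f n) hs]
  exact Finset.sum_congr rfl fun n _ => by simp [f]

theorem sum_Icc_neg_filter_eq {M N : ℕ} {P : ℤ → Prop} [DecidablePred P] (hP0 : ¬ P 0)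
    (hP : ∀ n : ℕ, 0 < n → (P n ↔ IsSmooth N n)) (hPneg : ∀ n : ℕ, 0 < n → (P (-n) ↔ IsSmooth N n))
    (f : ℤ → ℂ) :
    ∑ n ∈ (Finset.Icc (-(M : ℤ)) (M : ℤ)).filter P, f n =
      ∑ n ∈ (Finset.Ioc 0 M).filter (IsSmooth N), (f n + f (-n)) := by
  set T := (Finset.Ioc 0 M).filter (IsSmooth N) with hT
  have hmem : ∀ n : ℕ, n ∈ T ↔ (0 < n ∧ n ≤ M) ∧ IsSmooth N n := fun n => by
    rw [hT, Finset.mem_filter, Finset.mem_Ioc]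
  have hset : (Finset.Icc (-(M : ℤ)) (M : ℤ)).filter P =
      T.image (fun n : ℕ => (n : ℤ)) ∪ T.image (fun n : ℕ => -(n : ℤ)) := by
    ext k
    simp only [Finset.mem_filter, Finset.mem_Icc, Finset.mem_union, Finset.mem_image, hmem]
    constructor
    · rintro ⟨⟨h1, h2⟩, h3⟩
      rcases lt_trichotomy k 0 with hk | hk | hk
      · right
        obtain ⟨n, rfl⟩ : ∃ n : ℕ, k = -n := ⟨k.natAbs, by omega⟩
        exact ⟨n, ⟨⟨by omega, by omega⟩, (hPneg n (by omega)).1 h3⟩, rfl⟩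
      · subst hk; exact absurd h3 hP0
      · left
        obtain ⟨n, rfl⟩ : ∃ n : ℕ, k = n := ⟨k.natAbs, by omega⟩
        exact ⟨n, ⟨⟨by omega, by omega⟩, (hP n (by omega)).1 h3⟩, rfl⟩
    · rintro (⟨n, ⟨⟨h1, h2⟩, h3⟩, rfl⟩ | ⟨n, ⟨⟨h1, h2⟩, h3⟩, rfl⟩)
      · exact ⟨⟨by omega, by omega⟩, (hP n h1).2 h3⟩
      · exact ⟨⟨by omega, by omega⟩, (hPneg n h1).2 h3⟩
  have hdisj : Disjoint (T.image (fun n : ℕ => (n : ℤ))) (T.image (fun n : ℕ => -(n : ℤ))) := by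
    rw [Finset.disjoint_left]
    intro k h1 h2
    obtain ⟨a, ha, rfl⟩ := Finset.mem_image.1 h1
    obtain ⟨b, hb, hab⟩ := Finset.mem_image.1 h2
    have := ((hmem a).1 ha).1.1
    omega
  rw [hset, Finset.sum_union hdisj, Finset.sum_image (fun a _ b _ h => by simpa using h),
    Finset.sum_image (fun a _ b _ h => by simpa using h), ← Finset.sum_add_distrib]

theorem e2pi_neg_add (t : ℝ) : e2pi t + e2pi (-t) = 2 * (Real.cos (2 * π * t) : ℂ) := by
  unfold e2pi
  rw [Complex.ofReal_cos, Complex.two_cos]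
  congr 2 <;> (push_cast; ring)

theorem norm_e2pi (t : ℝ) : ‖e2pi t‖ = 1 := by
  have : (2 * Real.pi * Complex.I * t : ℂ) = ((2 * π * t : ℝ) : ℂ) * I := by push_cast; ring
  rw [e2pi, this, Complex.norm_exp_ofReal_mul_I]

theorem norm_pair_le_of_even {q : ℕ} {χ : DirichletCharacter ℂ q} (hχ : χ.Even) (α : ℝ) (n : ℕ) :
    ‖χ (((n : ℤ) : ZMod q)) * (1 - e2pi ((n : ℤ) * α)) / ((n : ℤ) : ℂ) +
      χ (((-(n : ℤ) : ℤ) : ZMod q)) * (1 - e2pi ((-(n : ℤ) : ℤ) * α)) / ((-(n : ℤ) : ℤ) : ℂ)‖ ≤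
      2 * (1 / (n : ℝ)) := by
  have h1 : χ (((-(n : ℤ) : ℤ) : ZMod q)) = χ (((n : ℤ) : ZMod q)) := by
    rw [Int.cast_neg, hχ.eval_neg]
  rw [h1]
  push_cast
  have h2 : χ (n : ZMod q) * (1 - e2pi (n * α)) / n + χ (n : ZMod q) * (1 - e2pi (-n * α)) / -n =
      χ (n : ZMod q) * (e2pi (-n * α) - e2pi (n * α)) / n := by
    rw [div_neg]; ring
  rw [h2, norm_div, norm_mul, Complex.norm_natCast, mul_one_div]
  gcongr
  calc _ ≤ 1 * (‖e2pi (-n * α)‖ + ‖e2pi (n * α)‖) :=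
        mul_le_mul (χ.norm_le_one _) (norm_sub_le _ _) (norm_nonneg _) zero_le_one
    _ = 2 := by rw [norm_e2pi, norm_e2pi]; norm_num

theorem norm_pair_le_of_odd {q : ℕ} {χ : DirichletCharacter ℂ q} (hχ : χ.Odd) (α : ℝ) (n : ℕ) :
    ‖χ (((n : ℤ) : ZMod q)) * (1 - e2pi ((n : ℤ) * α)) / ((n : ℤ) : ℂ) +
      χ (((-(n : ℤ) : ℤ) : ZMod q)) * (1 - e2pi ((-(n : ℤ) : ℤ) * α)) / ((-(n : ℤ) : ℤ) : ℂ)‖ ≤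
      2 * (1 / (n : ℝ) - Real.cos (2 * π * (n * α)) / n) := by
  have h1 : χ (((-(n : ℤ) : ℤ) : ZMod q)) = -χ (((n : ℤ) : ZMod q)) := by
    rw [Int.cast_neg, hχ.eval_neg]
  rw [h1]
  push_cast
  have h3 := e2pi_neg_add (n * α)
  rw [← neg_mul] at h3
  have h2 : χ (n : ZMod q) * (1 - e2pi (n * α)) / n + -χ (n : ZMod q) * (1 - e2pi (-n * α)) / -n =
      χ (n : ZMod q) * ((2 * (1 - Real.cos (2 * π * (n * α))) : ℝ) : ℂ) / n := by
    rw [div_neg]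
    push_cast at h3 ⊢
    linear_combination (-χ (n : ZMod q) / n) * h3
  have hnn : 0 ≤ 2 * (1 - Real.cos (2 * π * (n * α))) := by
    linarith [Real.cos_le_one (2 * π * (n * α))]
  rw [h2, norm_div, norm_mul, Complex.norm_natCast, Complex.norm_real,
    Real.norm_of_nonneg hnn, ← sub_div, ← mul_div_assoc]
  exact div_le_div_of_nonneg_right (mul_le_of_le_one_left hnn (χ.norm_le_one _)) n.cast_nonneg

theorem floor_bounds {y : ℝ} (hy : 10 ≤ y) : 10 ≤ ⌊y⌋₊ ∧ 2 ≤ Real.log y ∧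
    Real.log y / 2 ≤ Real.log ⌊y⌋₊ ∧ Real.log ⌊y⌋₊ ≤ Real.log y ∧ 1 ≤ Real.log ⌊y⌋₊ := by
  have hN : 10 ≤ ⌊y⌋₊ := Nat.le_floor (by exact_mod_cast hy)
  have hN' : (10 : ℝ) ≤ (⌊y⌋₊ : ℝ) := by exact_mod_cast hN
  have h2 : 2 ≤ Real.log y := by
    rw [Real.le_log_iff_exp_le (by linarith), show (2 : ℝ) = 1 + 1 by norm_num, Real.exp_add]
    nlinarith [Real.exp_one_lt_d9, Real.exp_pos 1]
  have hfl := Nat.lt_floor_add_one y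
  have h3 : Real.log y / 2 ≤ Real.log ⌊y⌋₊ := by
    rw [div_le_iff₀ two_pos, mul_comm, ← Nat.cast_ofNat (R := ℝ) (n := 2), ← Real.log_pow]
    refine Real.log_le_log (by linarith) ?_
    nlinarith
  exact ⟨hN, h2, h3, Real.log_le_log (by linarith) (Nat.floor_le (by linarith)), by linarith⟩

theorem loglog_div_log_bounds {y : ℝ} (hy : 10 ≤ y) :
    1 / Real.log y ≤ 2 * (Real.log (Real.log y) / Real.log y) ∧
    Real.log (Real.log ⌊y⌋₊) / Real.log ⌊y⌋₊ ≤ 2 * (Real.log (Real.log y) / Real.log y) := by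
  obtain ⟨hN, h2, h3, h4, h5⟩ := floor_bounds hy
  have hll : 1 / 2 ≤ Real.log (Real.log y) := by
    have := Real.log_le_log two_pos h2
    linarith [Real.log_two_gt_d9]
  constructor
  · rw [← mul_div_assoc]
    gcongr
    linarith
  · have h6 : Real.log (Real.log ⌊y⌋₊) ≤ Real.log (Real.log y) :=
      Real.log_le_log (by linarith) h4
    calc _ ≤ Real.log (Real.log y) / (Real.log y / 2) :=
          div_le_div₀ (by linarith) h6 (by linarith) h3
      _ = _ := by field_simp

theorem mem_smoothNumbers_of_isSmooth {N n : ℕ} (h : IsSmooth N n) :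
    n ∈ (N + 1).smoothNumbers :=
  Nat.mem_smoothNumbers'.2 fun p hp hpn => Nat.lt_succ_of_le (h p hp hpn)

theorem exists_sum_smooth_inv_le : ∃ C : ℝ, 0 ≤ C ∧ ∀ (y : ℝ) (Z : ℕ), 10 ≤ y →
    ∑ n ∈ (Finset.Ioc 0 Z).filter (IsSmooth ⌊y⌋₊), 1 / (n : ℝ) ≤
      Real.exp Real.eulerMascheroniConstant * Real.log y +
        C * (Real.log (Real.log y) / Real.log y) := by
  obtain ⟨C, hC0, hC⟩ := exists_prod_primesBelow_le
  refine ⟨4 * C, by positivity, fun y Z hy => ?_⟩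
  obtain ⟨hN, h2, h3, h4, h5⟩ := floor_bounds hy
  obtain ⟨h6, -⟩ := loglog_div_log_bounds hy
  have h7 := (sum_smooth_inv_le_prod ⌊y⌋₊ ((Finset.Ioc 0 Z).filter (IsSmooth ⌊y⌋₊))
    (fun n hn => mem_smoothNumbers_of_isSmooth (Finset.mem_filter.1 hn).2)).trans
    (hC ⌊y⌋₊ (by omega))
  refine h7.trans ?_
  have h8 : C / Real.log ⌊y⌋₊ ≤ C / (Real.log y / 2) := by gcongr
  have h9 : C / (Real.log y / 2) = 2 * C * (1 / Real.log y) := by field_simp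
  have h10 : 2 * C * (1 / Real.log y) ≤ 2 * C * (2 * (Real.log (Real.log y) / Real.log y)) := by
    gcongr
  have h11 : Real.exp Real.eulerMascheroniConstant * Real.log ⌊y⌋₊ ≤
      Real.exp Real.eulerMascheroniConstant * Real.log y := by gcongr
  linarith

theorem exists_neg_sum_smooth_cos_floor_le : ∃ C : ℝ, 0 ≤ C ∧ ∀ (y : ℝ) (Z : ℕ), 10 ≤ y →
    ⌊y⌋₊ ≤ Z → ∀ α : ℝ,
    -∑ n ∈ (Finset.Ioc 0 Z).filter (IsSmooth ⌊y⌋₊), Real.cos (2 * π * (n * α)) / n ≤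
      Real.log 2 + C * (Real.log (Real.log y) / Real.log y) := by
  obtain ⟨C₁, N₀, hC₁, h₁⟩ := exists_neg_sum_smooth_cos_le
  obtain ⟨C₂, hC₂, h₂⟩ := exists_sum_smooth_inv_le
  set A := Real.exp Real.eulerMascheroniConstant
  set Y := Real.log ((N₀ : ℝ) + 10) with hY
  have hY0 : 0 ≤ Y := Real.log_nonneg (by linarith [Nat.cast_nonneg (α := ℝ) N₀])
  refine ⟨2 * C₁ + C₂ + A * Y * (2 * Y), by positivity, fun y Z hy hZ α => ?_⟩
  obtain ⟨hN, h2, h3, h4, h5⟩ := floor_bounds hy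
  obtain ⟨h6, h7⟩ := loglog_div_log_bounds hy
  set ρ := Real.log (Real.log y) / Real.log y with hρ
  have hρ0 : 0 ≤ ρ := by
    have : 0 ≤ 1 / Real.log y := by positivity
    linarith
  by_cases hlarge : N₀ ≤ ⌊y⌋₊
  · have h8 := h₁ ⌊y⌋₊ Z hlarge hZ α
    have h9 : C₁ * (Real.log (Real.log ⌊y⌋₊) / Real.log ⌊y⌋₊) ≤ C₁ * (2 * ρ) := by gcongr
    have h10 : 0 ≤ (C₂ + A * Y * (2 * Y)) * ρ := by positivity
    linarith
  · push Not at hlarge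
    have hyN : y < N₀ := (Nat.floor_lt (by linarith)).1 hlarge
    have hyY : Real.log y ≤ Y := Real.log_le_log (by linarith) (by linarith)
    have h8 := h₂ y Z hy
    have h9 : -∑ n ∈ (Finset.Ioc 0 Z).filter (IsSmooth ⌊y⌋₊), Real.cos (2 * π * (n * α)) / n ≤
        ∑ n ∈ (Finset.Ioc 0 Z).filter (IsSmooth ⌊y⌋₊), 1 / (n : ℝ) := by
      rw [← Finset.sum_neg_distrib]
      refine Finset.sum_le_sum fun n _ => ?_
      rw [← neg_div]
      gcongr
      linarith [Real.neg_one_le_cos (2 * π * (n * α))]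
    have h10 : A * Real.log y ≤ A * Y * (2 * Y) * ρ := by
      have h11 : 1 ≤ 2 * Y * ρ := by
        have h12 : 1 / Real.log y * Real.log y ≤ 2 * ρ * Y := by gcongr
        rw [one_div_mul_cancel (by linarith)] at h12
        linarith
      calc A * Real.log y ≤ A * Y * 1 := by rw [mul_one]; gcongr
        _ ≤ A * Y * (2 * Y * ρ) := by gcongr
        _ = _ := by ring
    have h13 : 0 ≤ 2 * C₁ * ρ := by positivity
    have h14 := Real.log_nonneg one_le_two
    linarith

/-- Corollary 5: the fundamental inequality. -/
theorem fundamental_inequality :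
    ∃ C : ℝ, 0 < C ∧
      ∀ (q : ℕ) (χ : DirichletCharacter ℂ q) (α z y : ℝ), 1 ≤ z → 10 ≤ y →
        ‖∑ n ∈ (Finset.Icc (-(⌊z⌋₊ : ℤ)) (⌊z⌋₊ : ℤ)).filter
            (fun n => n ≠ 0 ∧ ∀ p : ℕ, p.Prime → (p : ℤ) ∣ n → (p : ℝ) ≤ y),
            χ (n : ZMod q) * (1 - e2pi (n * α)) / n‖ ≤
          2 * Real.exp Real.eulerMascheroniConstant * Real.log y + 2 * Real.log 2 +
            C * Real.log (Real.log y) / Real.log y := by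
  obtain ⟨C₁, hC₁, h₁⟩ := exists_sum_smooth_inv_le
  obtain ⟨C₂, hC₂, h₂⟩ := exists_neg_sum_smooth_cos_floor_le
  refine ⟨2 * C₁ + 2 * C₂ + 1, by positivity, fun q χ α z y _ hy => ?_⟩
  obtain ⟨h6, -⟩ := loglog_div_log_bounds hy
  obtain ⟨-, h2, -⟩ := floor_bounds hy
  rw [mul_div_assoc]
  set ρ := Real.log (Real.log y) / Real.log y with hρ
  have hρ0 : 0 ≤ ρ := by
    have : 0 ≤ 1 / Real.log y := by positivity
    linarith
  have hlog2 := Real.log_nonneg one_le_two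
  have hsm : ∀ n : ℕ, (∀ p : ℕ, p.Prime → (p : ℤ) ∣ (n : ℤ) → (p : ℝ) ≤ y) ↔
      IsSmooth ⌊y⌋₊ n := by
    intro n
    refine forall_congr' fun p => forall_congr' fun _ => ?_
    rw [Int.natCast_dvd_natCast, Nat.le_floor_iff (by linarith)]
  rw [sum_Icc_neg_filter_eq (N := ⌊y⌋₊)
    (P := fun n : ℤ => n ≠ 0 ∧ ∀ p : ℕ, p.Prime → (p : ℤ) ∣ n → (p : ℝ) ≤ y) (by simp)
    (fun n hn => by simp only [hsm]; simp [hn.ne'])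
    (fun n hn => by simp only [dvd_neg, hsm]; simp [hn.ne'])]
  rcases χ.even_or_odd with hχ | hχ
  · refine (norm_sum_le_of_le _ fun n _ => norm_pair_le_of_even hχ α n).trans ?_
    rw [← Finset.mul_sum]
    have h3 := h₁ y ⌊z⌋₊ hy
    have h4 : 0 ≤ (2 * C₂ + 1) * ρ := by positivity
    linarith
  · refine (norm_sum_le_of_le _ fun n _ => norm_pair_le_of_odd hχ α n).trans ?_
    set Z := max ⌊z⌋₊ ⌊y⌋₊ with hZ
    have h3 : ∑ n ∈ (Finset.Ioc 0 ⌊z⌋₊).filter (IsSmooth ⌊y⌋₊),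
        2 * (1 / (n : ℝ) - Real.cos (2 * π * (n * α)) / n) ≤
        ∑ n ∈ (Finset.Ioc 0 Z).filter (IsSmooth ⌊y⌋₊),
          2 * (1 / (n : ℝ) - Real.cos (2 * π * (n * α)) / n) := by
      refine Finset.sum_le_sum_of_subset_of_nonneg ?_ fun n _ _ => ?_
      · exact Finset.filter_subset_filter _ (Finset.Ioc_subset_Ioc_right (le_max_left _ _))
      · rw [← sub_div]
        have := Real.cos_le_one (2 * π * (n * α))
        have : 0 ≤ 1 - Real.cos (2 * π * (n * α)) := by linarith
        positivity
    refine h3.trans ?_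
    rw [← Finset.mul_sum, Finset.sum_sub_distrib]
    have h4 := h₁ y Z hy
    have h5 := h₂ y Z hy (le_max_right _ _) α
    linarith
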